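/- For every ε > 0 there is a constant K(ε) with the following property. Let F be a normalized holomorphic Hecke eigenform of even weight k ≥ 12 for SL(2, ℤ) with normalized Hecke eigenvalues λ. Let r, f ∈ ℤ∖{0} and X₁, Z ≥ 1; let h : ℝ → ℂ be smooth, supported in [X₁, 2X₁], with |h^{(ν)}| ≤ K_ν (X₁/Z)^{−ν} for all ν ∈ ℕ₀. Write X = |r| X₁ and suppose there is a real Ξ with X/(100Z) ≤ Ξ ≤ 100(X + |f|) such that h(n) = 0 unless rn + f ∈ [Ξ, 2Ξ]. Then | Σ_{n ∈ ℕ} h(n) λ(rn + f) | ≤ K(ε) (k |r| Z (1+|f|))^{ε} ( Z(1 + |f|/X) + k )² |r|^{1/2}. -/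

import Mathlib

/-- Normalized Hecke eigenvalues: `λ(n) = a(n) n^{−(k−1)/2}` for `n ≥ 1`, `λ(m) = 0` for
`m ≤ 0`. -/
noncomputable def heckeLambda (k : ℕ) (a : ℕ → ℂ) (m : ℤ) : ℂ :=
  if 0 < m then a m.toNat * ((m.toNat : ℝ) ^ (-(((k : ℝ) - 1) / 2)) : ℝ) else 0

/-- `a : ℕ → ℂ` is the sequence of Fourier coefficients of a normalized holomorphic Hecke
eigenform of even weight `k ≥ 12` for `SL(2, ℤ)`. -/
def IsNormalizedHeckeEigenform (k : ℕ) (a : ℕ → ℂ) : Prop :=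
  Even k ∧ 12 ≤ k ∧
  (∃ F : CuspForm (CongruenceSubgroup.Gamma 1) k, F ≠ 0 ∧
    ∀ z : UpperHalfPlane, F z = ∑' n : ℕ,
      a (n + 1) * Complex.exp (2 * Real.pi * Complex.I * (n + 1) * (z : ℂ))) ∧
  a 1 = 1 ∧
  ∀ m n : ℕ, 1 ≤ m → 1 ≤ n →
    a m * a n = ∑ d ∈ (Nat.gcd m n).divisors, (d : ℂ) ^ (k - 1) * a (m * n / d ^ 2)


open Polynomial

namespace HES

lemma sum_ne_zero_of_degree {F : Type*} [Field F] {N d : ℕ} (g : Fin N → F[X])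
    (hg : ∀ n, (g n).degree = ((n : ℕ) + d : ℕ)) (c : Fin N → F) (hc : c ≠ 0) :
    ∑ n, c n • g n ≠ 0 := by
  obtain ⟨i, hi⟩ := Function.ne_iff.1 hc
  intro h
  have h1 := degree_sum_eq_of_disjoint (fun n => c n • g n) Finset.univ (by
    intro a ha b hb hab
    simp only [Finset.mem_univ, true_and, Set.mem_ofPred_eq, ne_eq, smul_eq_zero, not_or] at ha hb
    simp only [Function.onFun, Function.comp]
    rw [smul_eq_C_mul, smul_eq_C_mul, degree_C_mul ha.1, degree_C_mul hb.1, hg, hg]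
    intro h2
    apply hab
    apply Fin.ext
    have := (Nat.cast_inj (R := WithBot ℕ)).1 h2
    omega)
  rw [h, degree_zero] at h1
  have h2 : (c i • g i).degree ≤ (⊥ : WithBot ℕ) := by
    rw [h1]; exact Finset.le_sup (f := fun n => (c n • g n).degree) (Finset.mem_univ i)
  rw [smul_eq_C_mul, degree_C_mul hi, hg] at h2
  exact absurd h2 (by simp)

/-- the half trace polynomial -/
noncomputable def stW (p h : ℕ) (u v : ZMod p) : (ZMod p)[X] :=
  ∑ i ∈ Finset.range (h + 1), (C u * X ^ (p ^ h + p ^ i) + C v * X ^ (p ^ h - p ^ i))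

lemma stW_degree (p h : ℕ) [Fact p.Prime] (u v : ZMod p) (hu : u ≠ 0) :
    (stW p h u v).degree = (2 * p ^ h : ℕ) := by
  have hp := (Fact.out : p.Prime)
  unfold stW
  rw [Finset.sum_range_succ]
  have hpos : 0 < p ^ h := pow_pos hp.pos _
  have e1 : (C u * X ^ (p ^ h + p ^ h) : (ZMod p)[X]).degree = (2 * p ^ h : ℕ) := by
    rw [degree_C_mul_X_pow _ hu]; congr 1; ring
  have e2 : (C v * X ^ (p ^ h - p ^ h) : (ZMod p)[X]).degree < (2 * p ^ h : ℕ) := by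
    refine (degree_C_mul_X_pow_le _ _).trans_lt ?_
    exact_mod_cast (by omega)
  have e3 : (∑ i ∈ Finset.range h, (C u * X ^ (p ^ h + p ^ i) + C v * X ^ (p ^ h - p ^ i)) :
      (ZMod p)[X]).degree < (2 * p ^ h : ℕ) := by
    refine (degree_sum_le _ _).trans_lt ?_
    rw [Finset.sup_lt_iff (by exact_mod_cast (WithBot.bot_lt_coe _))]
    intro i hi
    have : p ^ i < p ^ h := Nat.pow_lt_pow_right hp.one_lt (Finset.mem_range.1 hi)
    refine (degree_add_le _ _).trans_lt (max_lt ?_ ?_)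
    · refine (degree_C_mul_X_pow_le _ _).trans_lt ?_
      exact_mod_cast (by omega)
    · refine (degree_C_mul_X_pow_le _ _).trans_lt ?_
      exact_mod_cast (by omega)
  rw [add_comm, degree_add_eq_left_of_degree_lt]
  · rw [degree_add_eq_left_of_degree_lt, e1]
    rw [e1]; exact e2
  · rw [degree_add_eq_left_of_degree_lt (by rw [e1]; exact e2), e1]
    exact e3

/-- Stepanov bound: number of `x` with given trace of `u x + v / x`. -/
theorem stepanov (p h : ℕ) [Fact p.Prime] (u v : ZMod p) (hu : u ≠ 0)
    (K : Type) [Field K] [Algebra (ZMod p) K] [Fintype K] [DecidableEq K]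
    (hcard : Fintype.card K = (p ^ (h + 1)) ^ 2) (t : ZMod p) (A : Finset K)
    (hA : ∀ x ∈ A, x ≠ 0 ∧ ∑ i ∈ Finset.range (2 * (h + 1)),
      (algebraMap _ K u * x + algebraMap _ K v * x⁻¹) ^ p ^ i = algebraMap _ K t) :
    A.card ≤ p ^ h * p ^ (h + 1) + 11 * p ^ (h + 1) := by
  have hp := (Fact.out : p.Prime)
  have : CharP K p := charP_of_injective_algebraMap (algebraMap (ZMod p) K).injective p
  have : ExpChar K p := ExpChar.prime hp
  set e := p ^ h with he
  set Q := p ^ (h + 1) with hQ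
  have hQe : Q = e * p := by rw [hQ, he, pow_succ]
  have he0 : 0 < e := pow_pos hp.pos _
  have hp2 := hp.two_le
  have hQ2 : 2 * e ≤ Q := by rw [hQe]; nlinarith
  set W := stW p h u v with hW
  have hWdeg := stW_degree p h u v hu
  rw [← hW, ← he] at hWdeg
  set m := e + 8 with hm
  set N := m * Q with hN
  set D := e * Q + m + 2 * Q with hD
  have hDN : D < N := by rw [hD, hN, hm]; nlinarith
  -- indices
  set li : ℕ → ℕ := fun n => n % e with hli
  set ji : ℕ → ℕ := fun n => (n / e) % p with hji
  set ii : ℕ → ℕ := fun n => n / e / p with hii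
  have hlilt : ∀ n, li n < e := fun n => Nat.mod_lt _ he0
  have hjilt : ∀ n, ji n < p := fun n => Nat.mod_lt _ hp.pos
  have hdec : ∀ n, n = li n + e * ji n + Q * ii n := by
    intro n
    have h1 := Nat.mod_add_div n e
    have h2 := Nat.mod_add_div (n / e) p
    simp only [hli, hji, hii]
    calc n = n % e + e * (n / e) := h1.symm
      _ = n % e + e * ((n / e) % p + p * (n / e / p)) := by rw [h2]
      _ = _ := by rw [hQe]; ring
  have hiilt : ∀ n, n < N → ii n < m := by
    intro n hn
    simp only [hii, Nat.div_div_eq_div_mul, ← hQe]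
    exact Nat.div_lt_of_lt_mul (by rw [mul_comm]; exact hn)
  set g : Fin N → (ZMod p)[X] := fun n =>
    X ^ (li n + ii n * Q + e * (p - 1 - ji n)) * W ^ (ji n) with hg
  have hgdeg : ∀ n, (g n).degree = ((n : ℕ) + e * (p - 1) : ℕ) := by
    intro n
    simp only [hg]
    rw [degree_mul, degree_X_pow, degree_pow, hWdeg]
    have h1 := hdec n
    have h2 := hjilt n
    have h3 : e * (p - 1 - ji n) + e * ji n = e * (p - 1) := by
      rw [← mul_add]; congr 1; omega
    rw [nsmul_eq_mul]
    norm_cast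
    conv_rhs => rw [h1]
    rw [← h3]; ring
  set V : (ZMod p)[X] := C t * X ^ e - W with hV
  have hVdeg : V.degree ≤ (2 * e : ℕ) := by
    refine (degree_sub_le _ _).trans (max_le ?_ hWdeg.le)
    refine (degree_C_mul_X_pow_le _ _).trans ?_
    exact_mod_cast (by omega)
  set P : Fin N → (ZMod p)[X] := fun n =>
    X ^ (li n * Q + ii n + e * (p - 1 - ji n)) * V ^ (ji n) with hP
  have hPdeg : ∀ n, (P n).degree < D := by
    intro n
    simp only [hP]
    rw [degree_mul, degree_X_pow]
    have h1 : (V ^ ji n).degree ≤ (ji n * (2 * e) : ℕ) := by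
      rw [degree_pow, nsmul_eq_mul]
      push_cast
      gcongr
      exact_mod_cast hVdeg
    refine (add_le_add le_rfl h1).trans_lt ?_
    have h2 := hjilt n
    have h3 : e * (p - 1 - ji n) + e * ji n = e * (p - 1) := by
      rw [← mul_add]; congr 1; omega
    have h4 := hiilt n n.2
    have h5 : (li n + 1) * Q ≤ e * Q := Nat.mul_le_mul_right _ (hlilt n)
    have h6 : e * (p - 1) + e = Q := by
      rw [hQe, ← Nat.mul_succ]; congr 1; omega
    have h7 : e * ji n ≤ e * (p - 1) := Nat.mul_le_mul_left _ (by omega)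
    rw [add_mul] at h5
    have : li n * Q + ii n + e * (p - 1 - ji n) + ji n * (2 * e) < D := by
      rw [hD, show ji n * (2 * e) = e * ji n + e * ji n by ring]; omega
    exact_mod_cast this
  -- kernel
  let L : (Fin N → ZMod p) →ₗ[ZMod p] (Fin D → ZMod p) :=
    LinearMap.pi fun k => (Polynomial.lcoeff (ZMod p) (k : ℕ)) ∘ₗ (Fintype.linearCombination (ZMod p) P)
  have hker : LinearMap.ker L ≠ ⊥ := L.ker_ne_bot_of_finrank_lt (by simpa using hDN)
  obtain ⟨c, hcker, hc0⟩ := (Submodule.ne_bot_iff _).1 hker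
  have hsum0 : ∑ n, c n • P n = 0 := by
    ext k
    by_cases hk : k < D
    · have := congrFun (LinearMap.mem_ker.1 hcker) ⟨k, hk⟩
      simpa [L, Fintype.linearCombination_apply] using this
    · rw [coeff_zero]
      apply coeff_eq_zero_of_degree_lt
      refine (degree_sum_le _ _).trans_lt ?_
      rw [Finset.sup_lt_iff (WithBot.bot_lt_coe _)]
      intro n _
      refine (degree_smul_le _ _).trans_lt ((hPdeg n).trans_le ?_)
      exact_mod_cast (not_lt.1 hk)
  set R := ∑ n, c n • g n with hR
  have hR0 : R ≠ 0 := sum_ne_zero_of_degree g hgdeg c hc0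
  have hRdeg : R.natDegree ≤ e * Q + 11 * Q := by
    apply natDegree_le_of_degree_le
    refine (degree_sum_le _ _).trans ?_
    apply Finset.sup_le
    intro n _
    refine (degree_smul_le _ _).trans ?_
    rw [hgdeg]
    have h6 : e * (p - 1) + e = Q := by
      rw [hQe, ← Nat.mul_succ]; congr 1; omega
    have := n.2
    have h8 : N = e * Q + 8 * Q := by rw [hN, hm]; ring
    exact_mod_cast (by omega)
  -- vanishing
  have hvan : ∀ x ∈ A, aeval x R = 0 := by
    intro x hx
    obtain ⟨hx0, htr⟩ := hA x hx
    set a := algebraMap (ZMod p) K with ha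
    have hfrob : ∀ (b : ZMod p) (i : ℕ), (a b) ^ p ^ i = a b := by
      intro b i
      rw [← map_pow, ZMod.pow_card_pow]
    set T := ∑ i ∈ Finset.range (h + 1), (a u * x + a v * x⁻¹) ^ p ^ i with hT
    have hpw : ∀ i, (a u * x + a v * x⁻¹) ^ p ^ i = a u * x ^ p ^ i + a v * (x ^ p ^ i)⁻¹ := by
      intro i
      rw [add_pow_expChar_pow, mul_pow, mul_pow, hfrob, hfrob, inv_pow]
    have hWx : aeval x W = x ^ e * T := by
      rw [hW, stW, map_sum, hT, Finset.mul_sum]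
      apply Finset.sum_congr rfl
      intro i hi
      have hle : p ^ i ≤ e := Nat.pow_le_pow_right hp.pos (by simpa [Nat.lt_succ_iff] using hi)
      rw [hpw]
      simp only [map_add, map_mul, aeval_C, map_pow, aeval_X]
      rw [← he, pow_sub₀ _ hx0 hle, pow_add]
      ring
    have hTQ : T ^ Q = a t - T := by
      rw [eq_sub_iff_add_eq', ← htr, two_mul, Finset.sum_range_add, hT, hQ, sum_pow_char_pow]
      congr 1
      apply Finset.sum_congr rfl
      intro i _
      rw [← pow_mul, ← pow_add, add_comm i]
    have hxq : (x ^ Q) ^ Q = x := by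
      rw [← pow_mul, ← sq, ← hcard]; exact FiniteField.pow_card x
    have hVx : aeval x V = x ^ e * (a t - T) := by
      simp only [hV, map_sub, map_mul, aeval_C, map_pow, aeval_X, hWx]
      ring
    have hRQ : (aeval x R) ^ Q = x ^ (e * (p - 1) * Q) * (x ^ (e * (p - 1)))⁻¹ *
        aeval x (∑ n, c n • P n) := by
      rw [hR, map_sum, map_sum, Finset.mul_sum, hQ, sum_pow_char_pow, ← hQ]
      apply Finset.sum_congr rfl
      intro n _
      simp only [map_smul, hg, hP, map_mul, map_pow, aeval_X, hWx, hVx]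
      rw [Algebra.smul_def, Algebra.smul_def, mul_pow, hQ, hfrob, ← hQ]
      have h3 : e * (p - 1 - ji n) + e * ji n = e * (p - 1) := by
        rw [← mul_add]; congr 1; have := hjilt n; omega
      have e1 : (x ^ (li n + ii n * Q + e * (p - 1 - ji n)) * (x ^ e * T) ^ ji n) =
          x ^ (e * (p - 1)) * x ^ (li n) * (x ^ Q) ^ (ii n) * T ^ ji n := by
        rw [← h3]; ring
      have e2 : x ^ (li n * Q + ii n + e * (p - 1 - ji n)) * (x ^ e * (a t - T)) ^ ji n =
          x ^ (e * (p - 1)) * (x ^ (li n * Q) * x ^ (ii n) * (a t - T) ^ ji n) := by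
        rw [← h3, mul_pow]; ring
      rw [e1, e2]
      have hxe : x ^ (e * (p - 1)) ≠ 0 := pow_ne_zero _ hx0
      have e3 : (x ^ (e * (p - 1)) * x ^ (li n) * (x ^ Q) ^ (ii n) * T ^ ji n) ^ Q =
          x ^ (e * (p - 1) * Q) * x ^ (li n * Q) * ((x ^ Q) ^ Q) ^ (ii n) * (T ^ Q) ^ ji n := by
        ring
      rw [e3, hxq, hTQ]
      field_simp
      rw [mul_comm]
    rw [hsum0, map_zero, mul_zero] at hRQ
    exact pow_eq_zero_iff (pow_pos hp.pos _).ne' |>.1 hRQ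
  have hsub : A ⊆ (R.aroots K).toFinset := by
    intro x hx
    rw [Multiset.mem_toFinset, mem_aroots]
    exact ⟨hR0, hvan x hx⟩
  calc A.card ≤ (R.aroots K).toFinset.card := Finset.card_le_card hsub
    _ ≤ (R.aroots K).card := Multiset.toFinset_card_le _
    _ ≤ (R.map (algebraMap (ZMod p) K)).natDegree := card_roots' _
    _ ≤ R.natDegree := natDegree_map_le
    _ ≤ _ := hRdeg

end HES

open Polynomial

namespace HES

section LF
variable {p : ℕ} [Fact p.Prime]

/-- the multiplicative function on monic polynomials -/
noncomputable def eta (ψ : AddChar (ZMod p) ℂ) (u v : ZMod p) (g : (ZMod p)[X]) : ℂ :=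
  if g.coeff 0 = 0 then 0 else ψ (-(u * g.nextCoeff) - v * (g.coeff 1 / g.coeff 0))

lemma eta_mul (ψ : AddChar (ZMod p) ℂ) (u v : ZMod p) {g h : (ZMod p)[X]} (hg : g.Monic)
    (hh : h.Monic) : eta ψ u v (g * h) = eta ψ u v g * eta ψ u v h := by
  unfold eta
  by_cases h1 : g.coeff 0 = 0
  · simp [h1]
  by_cases h2 : h.coeff 0 = 0
  · simp [h2]
  rw [if_neg h1, if_neg h2, if_neg (by rw [mul_coeff_zero]; exact mul_ne_zero h1 h2),
    ← AddChar.map_add_eq_mul]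
  congr 1
  rw [hg.nextCoeff_mul hh, mul_coeff_zero, mul_coeff_one]
  field_simp
  ring

lemma eta_one (ψ : AddChar (ZMod p) ℂ) (u v : ZMod p) : eta ψ u v 1 = 1 := by
  unfold eta
  have h2 : (1 : (ZMod p)[X]).nextCoeff = 0 := by simp [nextCoeff]
  rw [h2]
  simp [coeff_one]

lemma eta_pow (ψ : AddChar (ZMod p) ℂ) (u v : ZMod p) {g : (ZMod p)[X]} (hg : g.Monic) (n : ℕ) :
    eta ψ u v (g ^ n) = eta ψ u v g ^ n := by
  induction n with
  | zero => simp [eta_one]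
  | succ n ih => rw [pow_succ, eta_mul _ _ _ (hg.pow n) hg, ih, pow_succ]

lemma monic_finite (d : ℕ) : {g : (ZMod p)[X] | g.Monic ∧ g.natDegree = d}.Finite := by
  have : Finite {g : (ZMod p)[X] // g.Monic ∧ g.natDegree = d} :=
    Finite.of_equiv _ ((monicEquivDegreeLT (R := ZMod p) d).trans (degreeLTEquiv _ d).toEquiv).symm
  exact Set.finite_coe_iff.1 this

/-- monic polynomials of given degree -/
noncomputable def MM (p : ℕ) [Fact p.Prime] (d : ℕ) : Finset (ZMod p)[X] :=
  (monic_finite (p := p) d).toFinset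

lemma mem_MM {d : ℕ} {g : (ZMod p)[X]} : g ∈ MM p d ↔ g.Monic ∧ g.natDegree = d := by
  simp [MM]

/-- coefficient sums of the L-function -/
noncomputable def AA (ψ : AddChar (ZMod p) ℂ) (u v : ZMod p) (d : ℕ) : ℂ :=
  ∑ g ∈ MM p d, eta ψ u v g

lemma AA_zero (ψ : AddChar (ZMod p) ℂ) (u v : ZMod p) : AA ψ u v 0 = 1 := by
  have : MM p 0 = {1} := by
    ext g
    rw [mem_MM, Finset.mem_singleton]
    constructor
    · rintro ⟨h1, h2⟩; exact (Monic.natDegree_eq_zero h1).1 h2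
    · rintro rfl; simp
  rw [AA, this, Finset.sum_singleton, eta_one]

lemma AA_one (ψ : AddChar (ZMod p) ℂ) (u v : ZMod p) :
    AA ψ u v 1 = ∑ x : (ZMod p)ˣ, ψ (u * x + v * (x⁻¹ : (ZMod p)ˣ)) := by
  have : AA ψ u v 1 = ∑ x : ZMod p, eta ψ u v (X + C x) := by
    rw [AA]
    symm
    refine Finset.sum_bij (fun x _ => X + C x) ?_ ?_ ?_ ?_
    · intro x _; rw [mem_MM]; exact ⟨monic_X_add_C x, natDegree_X_add_C x⟩
    · intro x _ y _ h; simpa using h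
    · intro g hg
      rw [mem_MM] at hg
      refine ⟨g.coeff 0, Finset.mem_univ _, ?_⟩
      have := eq_X_add_C_of_natDegree_le_one (p := g) (by omega)
      have h1 : g.coeff 1 = 1 := by have := hg.1.coeff_natDegree; rwa [hg.2] at this
      rw [h1] at this
      simpa using this.symm
    · intros; rfl
  rw [this]
  have h2 : ∀ x : ZMod p, eta ψ u v (X + C x) = if x = 0 then 0 else ψ (-(u * x) - v * x⁻¹) := by
    intro x
    unfold eta
    have : (X + C x : (ZMod p)[X]).nextCoeff = x := by
      rw [nextCoeff_of_natDegree_pos (by simp)]; simp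
    rw [this]; simp [coeff_X, coeff_C]
  simp_rw [h2]
  rw [← Finset.sum_filter_add_sum_filter_not Finset.univ (fun x : ZMod p => x = 0),
    Finset.sum_eq_zero (s := Finset.univ.filter (fun x : ZMod p => x = 0))
      (by intro x hx; simp at hx; simp [hx]), zero_add]
  symm
  refine Finset.sum_bij (fun x _ => -(x : ZMod p)) ?_ ?_ ?_ ?_
  · intro x _; simp
  · intro x _ y _ h; simpa [Units.ext_iff] using h
  · intro x hx
    simp only [Finset.mem_filter, Finset.mem_univ, true_and] at hx
    exact ⟨Units.mk0 (-x) (by simpa using hx), Finset.mem_univ _, by simp⟩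
  · intro x _
    rw [if_neg (by simp)]
    congr 1
    rw [Units.val_inv_eq_inv_val, inv_neg]; ring

lemma sum_char_eq_zero {ψ : AddChar (ZMod p) ℂ} (hψ : ψ ≠ 1) {c : ZMod p} (hc : c ≠ 0) :
    ∑ x, ψ (c * x) = 0 := by
  have := AddChar.sum_mulShift c (ψ := ψ) (AddChar.IsPrimitive.of_ne_one hψ)
  rw [if_neg hc] at this
  simpa [mul_comm] using this

lemma AA_two {ψ : AddChar (ZMod p) ℂ} (hψ : ψ ≠ 1) {u v : ZMod p} (hu : u ≠ 0) (hv : v ≠ 0) :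
    AA ψ u v 2 = p := by
  have : AA ψ u v 2 = ∑ x : ZMod p × ZMod p, eta ψ u v (X ^ 2 + C x.1 * X + C x.2) := by
    rw [AA]
    symm
    refine Finset.sum_bij (fun x _ => X ^ 2 + C x.1 * X + C x.2) ?_ ?_ ?_ ?_
    · intro x _; rw [mem_MM]; constructor
      · monicity!
      · compute_degree!
    · intro x _ y _ h
      have h0 := congrArg (fun g => coeff g 0) h
      have h1 := congrArg (fun g => coeff g 1) h
      simp [coeff_X, coeff_C] at h0 h1
      exact Prod.ext h1 h0
    · intro g hg
      rw [mem_MM] at hg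
      refine ⟨(g.coeff 1, g.coeff 0), Finset.mem_univ _, ?_⟩
      have h2 : g.coeff 2 = 1 := by have := hg.1.coeff_natDegree; rwa [hg.2] at this
      have := g.as_sum_range_C_mul_X_pow' (n := 3) (by omega)
      conv_rhs => rw [this]
      simp [Finset.sum_range_succ, h2]
      ring
    · intros; rfl
  rw [this, Fintype.sum_prod_type_right]
  have h2 : ∀ a b : ZMod p, eta ψ u v (X ^ 2 + C a * X + C b) =
      if b = 0 then 0 else ψ (-(u + v / b) * a) := by
    intro a b
    unfold eta
    have hd : (X ^ 2 + C a * X + C b : (ZMod p)[X]).natDegree = 2 := by compute_degree!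
    have : (X ^ 2 + C a * X + C b : (ZMod p)[X]).nextCoeff = a := by
      rw [nextCoeff_of_natDegree_pos (by omega), hd]; simp [coeff_X, coeff_C]
    rw [this]; simp only [coeff_add, coeff_X_pow, coeff_C_mul, coeff_X, coeff_C]
    simp
    split_ifs with h
    · rfl
    · congr 1; field_simp; ring
  simp_rw [h2]
  rw [Finset.sum_eq_single (-v / u)]
  · have : -v / u ≠ 0 := div_ne_zero (neg_ne_zero.2 hv) hu
    simp only [this, if_false]
    have h3 : ∀ a : ZMod p, -(u + v / (-v / u)) * a = 0 := by intro a; field_simp; ring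
    simp_rw [h3]
    simp [ZMod.card]
  · intro b _ hb
    by_cases hb0 : b = 0
    · simp [hb0]
    simp only [hb0, if_false]
    apply sum_char_eq_zero hψ
    intro h
    apply hb
    field_simp at h ⊢
    linear_combination -h
  · simp

lemma AA_zero_of_ge {ψ : AddChar (ZMod p) ℂ} (hψ : ψ ≠ 1) {u v : ZMod p} (hu : u ≠ 0)
    {d : ℕ} (hd : 3 ≤ d) : AA ψ u v d = 0 := by
  obtain ⟨s, hs⟩ : ∃ s, ψ s ≠ 1 := by
    by_contra! h; exact hψ (by ext x; simpa using h x)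
  have key : ∀ g ∈ MM p d, g + C (s / u) * X ^ (d - 1) ∈ MM p d ∧
      eta ψ u v (g + C (s / u) * X ^ (d - 1)) = ψ (-s) * eta ψ u v g := by
    intro g hg
    rw [mem_MM] at hg
    have hdeg : (C (s / u) * X ^ (d - 1)).degree < g.degree := by
      refine (degree_C_mul_X_pow_le _ _).trans_lt ?_
      rw [degree_eq_natDegree hg.1.ne_zero, hg.2]
      exact_mod_cast (by omega)
    have hn : (g + C (s / u) * X ^ (d - 1)).natDegree = d := by
      rw [natDegree_add_eq_left_of_degree_lt hdeg, hg.2]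
    refine ⟨mem_MM.2 ⟨hg.1.add_of_left hdeg, hn⟩, ?_⟩
    unfold eta
    have c0 : (g + C (s / u) * X ^ (d - 1)).coeff 0 = g.coeff 0 := by
      rw [coeff_add, coeff_C_mul_X_pow, if_neg (by omega), add_zero]
    have c1 : (g + C (s / u) * X ^ (d - 1)).coeff 1 = g.coeff 1 := by
      rw [coeff_add, coeff_C_mul_X_pow, if_neg (by omega), add_zero]
    have cn : (g + C (s / u) * X ^ (d - 1)).nextCoeff = g.nextCoeff + s / u := by
      rw [nextCoeff_of_natDegree_pos (by omega), nextCoeff_of_natDegree_pos (by omega), hn, hg.2,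
        coeff_add, coeff_C_mul_X_pow, if_pos rfl]
    rw [c0, c1, cn]
    split_ifs
    · simp
    · rw [← AddChar.map_add_eq_mul]; congr 1; field_simp; ring
  have h1 : AA ψ u v d = ψ (-s) * AA ψ u v d := by
    conv_lhs => rw [AA]
    rw [AA, Finset.mul_sum]
    symm
    refine Finset.sum_bij (fun g _ => g + C (s / u) * X ^ (d - 1)) (fun g hg => (key g hg).1) ?_ ?_
      (fun g hg => (key g hg).2.symm)
    · intro g _ h _ e; simpa using e
    · intro g hg
      have h2 : g - C (s / u) * X ^ (d - 1) ∈ MM p d := by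
        rw [mem_MM] at hg ⊢
        have hdeg : (C (s / u) * X ^ (d - 1)).degree < g.degree := by
          refine (degree_C_mul_X_pow_le _ _).trans_lt ?_
          rw [degree_eq_natDegree hg.1.ne_zero, hg.2]
          exact_mod_cast (by omega)
        exact ⟨hg.1.sub_of_left hdeg, by rw [natDegree_eq_of_degree_eq (degree_sub_eq_left_of_degree_lt hdeg), hg.2]⟩
      exact ⟨_, h2, by simp⟩
  have h2 : (1 - ψ (-s)) * AA ψ u v d = 0 := by linear_combination h1
  rcases mul_eq_zero.1 h2 with h | h
  · exfalso; apply hs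
    have h3 : ψ (-s) = 1 := by linear_combination -h
    have := AddChar.map_add_eq_mul ψ s (-s)
    rw [h3, mul_one, add_neg_cancel, AddChar.map_zero_eq_one] at this
    exact this.symm
  · exact h

/-- irreducible monic polynomials of degree at most `d` -/
noncomputable def IR (p : ℕ) [Fact p.Prime] (d : ℕ) : Finset (ZMod p)[X] :=
  open Classical in ((Finset.range (d + 1)).biUnion (MM p)).filter Irreducible

lemma mem_IR {d : ℕ} {g : (ZMod p)[X]} :
    g ∈ IR p d ↔ g.Monic ∧ g.natDegree ≤ d ∧ Irreducible g := by
  classical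
  simp only [IR, Finset.mem_filter, Finset.mem_biUnion, Finset.mem_range, mem_MM]
  constructor
  · rintro ⟨⟨e, he, h1, h2⟩, h3⟩; exact ⟨h1, by omega, h3⟩
  · rintro ⟨h1, h2, h3⟩; exact ⟨⟨_, by omega, h1, rfl⟩, h3⟩

open Classical in
lemma degree_eq_sum {d : ℕ} {g : (ZMod p)[X]} (hg : g ∈ MM p d) :
    (d : ℂ) = ∑ P ∈ IR p d, ∑ i ∈ Finset.Icc 1 d, if P ^ i ∣ g then (P.natDegree : ℂ) else 0 := by
  rw [mem_MM] at hg
  obtain ⟨hm, hd⟩ := hg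
  have hg0 := hm.ne_zero
  open UniqueFactorizationMonoid in
  have h1 : (normalizedFactors g).prod = g := by
    have := prod_normalizedFactors_eq hg0
    rwa [hm.normalize_eq_self] at this
  open UniqueFactorizationMonoid in
  have hmem : ∀ P ∈ normalizedFactors g, P ∈ IR p d := by
    intro P hP
    rw [mem_IR]
    have hi := irreducible_of_normalized_factor P hP
    have hdv := dvd_of_mem_normalizedFactors hP
    refine ⟨?_, ?_, hi⟩
    · have := normalize_normalized_factor P hP
      rw [← this]; exact monic_normalize hi.ne_zero
    · rw [← hd]; exact natDegree_le_of_dvd hdv hg0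
  open UniqueFactorizationMonoid in
  have h2 : g.natDegree = ((normalizedFactors g).map natDegree).sum := by
    conv_lhs => rw [← h1]
    rw [natDegree_multiset_prod_of_monic]
    intro P hP; exact (mem_IR.1 (hmem P hP)).1
  open UniqueFactorizationMonoid in
  have h3 : ∀ P ∈ IR p d, (∑ i ∈ Finset.Icc 1 d, if P ^ i ∣ g then (P.natDegree : ℂ) else 0) =
      ((normalizedFactors g).count P * P.natDegree : ℕ) := by
    intro P hP
    rw [mem_IR] at hP
    have hiff : ∀ i, P ^ i ∣ g ↔ i ≤ (normalizedFactors g).count P := by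
      intro i
      have := emultiplicity_eq_count_normalizedFactors hP.2.2 hg0
      rw [hP.1.normalize_eq_self] at this
      rw [pow_dvd_iff_le_emultiplicity, this]
      exact_mod_cast Iff.rfl
    have hle : (normalizedFactors g).count P ≤ d := by
      have h4 := (hiff _).2 le_rfl
      have h5 := natDegree_le_of_dvd h4 hg0
      rw [natDegree_pow, hd] at h5
      have := hP.2.2.natDegree_pos
      nlinarith
    simp_rw [hiff]
    rw [← Finset.sum_filter]
    have : (Finset.Icc 1 d).filter (fun i => i ≤ (normalizedFactors g).count P) =
        Finset.Icc 1 ((normalizedFactors g).count P) := by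
      ext i; simp; omega
    rw [this]; simp
  rw [Finset.sum_congr rfl h3, ← Nat.cast_sum]
  congr 1
  conv_lhs => rw [← hd, h2, Finset.sum_multiset_map_count]
  simp only [smul_eq_mul]
  apply Finset.sum_subset
  · intro P hP; rw [Multiset.mem_toFinset] at hP; exact hmem P hP
  · intro P _ hP; rw [Multiset.mem_toFinset] at hP; simp [Multiset.count_eq_zero_of_notMem hP]

open Classical in
lemma sum_dvd (ψ : AddChar (ZMod p) ℂ) (u v : ZMod p) {d e : ℕ} {Q : (ZMod p)[X]} (hQ : Q.Monic)
    (he : Q.natDegree = e) : (∑ g ∈ MM p d, if Q ∣ g then eta ψ u v g else 0) =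
      if e ≤ d then eta ψ u v Q * AA ψ u v (d - e) else 0 := by
  split_ifs with h
  · rw [AA, Finset.mul_sum, ← Finset.sum_filter]
    symm
    refine Finset.sum_bij (fun g _ => Q * g) ?_ ?_ ?_ ?_
    · intro g hg
      rw [mem_MM] at hg
      rw [Finset.mem_filter, mem_MM]
      exact ⟨⟨hQ.mul hg.1, by rw [hQ.natDegree_mul hg.1]; omega⟩, dvd_mul_right _ _⟩
    · intro g _ g' _ hgg; exact mul_left_cancel₀ hQ.ne_zero hgg
    · intro g hg
      rw [Finset.mem_filter, mem_MM] at hg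
      obtain ⟨⟨h1, h2⟩, g', rfl⟩ := hg
      have := hQ.of_mul_monic_left h1
      refine ⟨g', ?_, rfl⟩
      rw [mem_MM]
      rw [hQ.natDegree_mul this] at h2
      exact ⟨this, by omega⟩
    · intro g hg
      rw [mem_MM] at hg
      rw [eta_mul _ _ _ hQ hg.1]
  · apply Finset.sum_eq_zero
    intro g hg
    rw [mem_MM] at hg
    rw [if_neg]
    intro h1
    have := natDegree_le_of_dvd h1 hg.1.ne_zero
    omega

/-- power sums -/
noncomputable def SS (ψ : AddChar (ZMod p) ℂ) (u v : ZMod p) (j : ℕ) : ℂ :=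
  ∑ P ∈ (IR p j).filter (fun P => P.natDegree ∣ j), P.natDegree * eta ψ u v P ^ (j / P.natDegree)

lemma newton (ψ : AddChar (ZMod p) ℂ) (u v : ZMod p) (d : ℕ) :
    d * AA ψ u v d = ∑ j ∈ Finset.Icc 1 d, SS ψ u v j * AA ψ u v (d - j) := by
  classical
  have h1 : d * AA ψ u v d = ∑ P ∈ IR p d, ∑ i ∈ Finset.Icc 1 d, 
      if i * P.natDegree ≤ d then
        P.natDegree * eta ψ u v P ^ i * AA ψ u v (d - i * P.natDegree) else 0 := by
    rw [AA, Finset.mul_sum]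
    rw [Finset.sum_congr rfl (fun g hg => by rw [degree_eq_sum hg])]
    simp_rw [Finset.sum_mul]
    rw [Finset.sum_comm]
    refine Finset.sum_congr rfl fun P hP => ?_
    rw [Finset.sum_comm]
    refine Finset.sum_congr rfl fun i hi => ?_
    rw [mem_IR] at hP
    have := sum_dvd ψ u v (d := d) (hP.1.pow i) (natDegree_pow P i)
    rw [eta_pow _ _ _ hP.1] at this
    have h2 : ∀ g, (if P ^ i ∣ g then (P.natDegree : ℂ) else 0) * eta ψ u v g =
      P.natDegree * (if P ^ i ∣ g then eta ψ u v g else 0) := by intro g; split_ifs <;> simp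
    simp_rw [h2]
    rw [← Finset.mul_sum, this]
    split_ifs <;> ring
  have h2 : ∀ j ∈ Finset.Icc 1 d, SS ψ u v j * AA ψ u v (d - j) = ∑ P ∈ IR p d,
      ∑ i ∈ Finset.Icc 1 d, if j = i * P.natDegree then
        P.natDegree * eta ψ u v P ^ i * AA ψ u v (d - i * P.natDegree) else 0 := by
    intro j hj
    rw [Finset.mem_Icc] at hj
    rw [SS, Finset.sum_mul]
    have hsub : (IR p j).filter (fun P => P.natDegree ∣ j) =
        (IR p d).filter (fun P => P.natDegree ∣ j) := by
      ext P
      simp only [Finset.mem_filter, mem_IR]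
      constructor
      · rintro ⟨⟨h1, h2, h3⟩, h4⟩; exact ⟨⟨h1, by omega, h3⟩, h4⟩
      · rintro ⟨⟨h1, h2, h3⟩, h4⟩; exact ⟨⟨h1, Nat.le_of_dvd (by omega) h4, h3⟩, h4⟩
    rw [hsub, Finset.sum_filter]
    refine Finset.sum_congr rfl fun P hP => ?_
    rw [mem_IR] at hP
    have hpos := hP.2.2.natDegree_pos
    split_ifs with hdv
    · obtain ⟨c, hc⟩ := hdv
      have hc1 : 1 ≤ c := by
        rcases Nat.eq_zero_or_pos c with h | h
        · subst h; omega
        · exact h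
      have hdiv : j / P.natDegree = c := by rw [hc]; exact Nat.mul_div_cancel_left _ hpos
      rw [Finset.sum_eq_single c]
      · rw [if_pos (by rw [hc, mul_comm]), hdiv, hc, mul_comm c]
      · intro b _ hb
        rw [if_neg]
        intro h; apply hb
        rw [hc, mul_comm] at h
        exact (Nat.eq_of_mul_eq_mul_right hpos h).symm
      · intro h; exfalso; apply h
        rw [Finset.mem_Icc]; exact ⟨hc1, by nlinarith⟩
    · symm
      apply Finset.sum_eq_zero
      intro i _
      rw [if_neg]
      rintro rfl
      exact hdv (dvd_mul_left _ _)
  rw [h1, Finset.sum_congr rfl h2]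
  conv_rhs => rw [Finset.sum_comm]
  refine Finset.sum_congr rfl fun P hP => ?_
  conv_rhs => rw [Finset.sum_comm]
  refine Finset.sum_congr rfl fun i hi => ?_
  rw [mem_IR] at hP
  rw [Finset.mem_Icc] at hi
  have hpos := hP.2.2.natDegree_pos
  have : i * P.natDegree ∈ Finset.Icc 1 d ↔ i * P.natDegree ≤ d := by
    rw [Finset.mem_Icc]; constructor
    · exact fun h => h.2
    · intro h; exact ⟨by nlinarith, h⟩
  simp only [Finset.sum_ite_eq', this]

end LF
end HES

open Polynomial

namespace HES

section WB
variable {p : ℕ} [Fact p.Prime]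

open IntermediateField in
lemma nextCoeff_minpoly_inv {F K : Type*} [Field F] [Field K] [Algebra F K] [FiniteDimensional F K]
    {x : K} (hx : x ≠ 0) : (minpoly F x⁻¹).nextCoeff =
      (minpoly F x).coeff 1 / (minpoly F x).coeff 0 ∧ (minpoly F x).coeff 0 ≠ 0 := by
  have hint : IsIntegral F x := IsIntegral.of_finite F x
  have hint' : IsIntegral F x⁻¹ := IsIntegral.of_finite F x⁻¹
  have h0 : (minpoly F x).coeff 0 ≠ 0 := minpoly.coeff_zero_ne_zero hint hx
  refine ⟨?_, h0⟩
  set P := minpoly F x with hP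
  have htr : P.natTrailingDegree = 0 := by
    rw [natTrailingDegree_eq_zero]; exact Or.inr h0
  have hpos : 0 < P.natDegree := minpoly.natDegree_pos hint
  have hdeg : (C (P.coeff 0)⁻¹ * P.reverse).natDegree = P.natDegree := by
    rw [natDegree_C_mul (inv_ne_zero h0), reverse_natDegree, htr, Nat.sub_zero]
  have hmon : (C (P.coeff 0)⁻¹ * P.reverse).Monic := by
    rw [Monic, leadingCoeff_mul, leadingCoeff_C, reverse_leadingCoeff, trailingCoeff, htr,
      inv_mul_cancel₀ h0]
  have hev : aeval x⁻¹ (C (P.coeff 0)⁻¹ * P.reverse) = 0 := by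
    rw [map_mul]
    have : Invertible x := invertibleOfNonzero hx
    have h1 := (eval₂_reverse_eq_zero_iff (algebraMap F K) x P).2 (by
      rw [← aeval_def]; exact minpoly.aeval F x)
    rw [invOf_eq_inv, ← aeval_def] at h1
    rw [h1, mul_zero]
  have heq : P.natDegree = (minpoly F x⁻¹).natDegree := by
    rw [hP, ← IntermediateField.adjoin.finrank hint, ← IntermediateField.adjoin.finrank hint']
    have : F⟮x⟯ = F⟮x⁻¹⟯ := by
      apply le_antisymm
      · rw [adjoin_simple_le_iff]
        have := F⟮x⁻¹⟯.inv_mem (mem_adjoin_simple_self F x⁻¹)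
        rwa [inv_inv] at this
      · rw [adjoin_simple_le_iff]
        exact F⟮x⟯.inv_mem (mem_adjoin_simple_self F x)
    rw [this]
  have hq := minpoly.unique_of_degree_le_degree_minpoly F x⁻¹ hmon hev (by
    rw [degree_eq_natDegree hmon.ne_zero, degree_eq_natDegree (minpoly.ne_zero hint'), hdeg, heq])
  rw [← hq, nextCoeff_of_natDegree_pos (by rw [hdeg]; exact hpos), hdeg, coeff_C_mul,
    coeff_reverse, revAt_le (by omega), Nat.sub_sub_self hpos]
  field_simp

lemma eta_minpoly {K : Type} [Field K] [Algebra (ZMod p) K] [Fintype K]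
    (ψ : AddChar (ZMod p) ℂ) (u v : ZMod p) {x : K} (hx : x ≠ 0) :
    ψ (Algebra.trace (ZMod p) K (algebraMap _ K u * x + algebraMap _ K v * x⁻¹)) =
    eta ψ u v (minpoly (ZMod p) x) ^
      (Module.finrank (ZMod p) K / (minpoly (ZMod p) x).natDegree) := by
  open IntermediateField in
  have : FiniteDimensional (ZMod p) K := Module.Finite.of_finite
  obtain ⟨h1, h0⟩ := nextCoeff_minpoly_inv (F := ZMod p) hx
  have hint : IsIntegral (ZMod p) x := IsIntegral.of_finite _ x
  have hadj : (ZMod p)⟮x⁻¹⟯ = (ZMod p)⟮x⟯ := by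
    apply le_antisymm
    · rw [adjoin_simple_le_iff]
      exact ((ZMod p)⟮x⟯).inv_mem (mem_adjoin_simple_self _ x)
    · rw [adjoin_simple_le_iff]
      have := ((ZMod p)⟮x⁻¹⟯).inv_mem (mem_adjoin_simple_self _ x⁻¹)
      rwa [inv_inv] at this
  have hfin : Module.finrank (ZMod p) K / (minpoly (ZMod p) x).natDegree =
      Module.finrank (ZMod p)⟮x⟯ K := by
    rw [← Module.finrank_mul_finrank (ZMod p) (ZMod p)⟮x⟯ K, IntermediateField.adjoin.finrank hint]
    exact Nat.mul_div_cancel_left _ (minpoly.natDegree_pos hint)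
  have t1 := trace_eq_finrank_mul_minpoly_nextCoeff (ZMod p) x
  have t2 := trace_eq_finrank_mul_minpoly_nextCoeff (ZMod p) x⁻¹
  rw [h1, hadj] at t2
  rw [hfin, eta, if_neg h0, ← AddChar.map_nsmul_eq_pow, map_add, ← Algebra.smul_def,
    ← Algebra.smul_def, map_smul, map_smul, t1, t2]
  congr 1
  simp only [smul_eq_mul, nsmul_eq_mul]
  ring

lemma SS_eq_sum {K : Type} [Field K] [Algebra (ZMod p) K] [Fintype K] [DecidableEq K] {j : ℕ}
    (hj : 0 < j) (hK : Fintype.card K = p ^ j) (ψ : AddChar (ZMod p) ℂ) (u v : ZMod p) :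
    SS ψ u v j = ∑ x : K, if x = 0 then 0 else
      ψ (Algebra.trace (ZMod p) K (algebraMap _ K u * x + algebraMap _ K v * x⁻¹)) := by
  classical
  have hp := (Fact.out : p.Prime)
  have : FiniteDimensional (ZMod p) K := Module.Finite.of_finite
  have hfr : Module.finrank (ZMod p) K = j := by
    have := Module.card_eq_pow_finrank (K := ZMod p) (V := K)
    rw [hK, ZMod.card] at this
    exact (Nat.pow_right_injective hp.two_le this).symm
  have h1 : ∀ x : K, (if x = 0 then 0 else
      ψ (Algebra.trace (ZMod p) K (algebraMap _ K u * x + algebraMap _ K v * x⁻¹))) =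
      eta ψ u v (minpoly (ZMod p) x) ^ (j / (minpoly (ZMod p) x).natDegree) := by
    intro x
    split_ifs with hx
    · subst hx
      rw [minpoly.zero, natDegree_X, Nat.div_one]; simp [eta, hj.ne']
    · rw [eta_minpoly ψ u v hx, hfr]
  simp_rw [h1]
  rw [← Finset.sum_fiberwise_of_maps_to (s := Finset.univ)
    (t := (IR p j).filter (fun P => P.natDegree ∣ j)) (g := fun x : K => minpoly (ZMod p) x), SS]
  · refine Finset.sum_congr rfl fun P hP => ?_
    rw [Finset.mem_filter, mem_IR] at hP
    obtain ⟨⟨hm, -, hi⟩, hd⟩ := hP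
    rw [Finset.sum_congr rfl (g := fun _ => eta ψ u v P ^ (j / P.natDegree)) (by
      intro x hx; rw [Finset.mem_filter] at hx; simp only [hx.2]), Finset.sum_const, nsmul_eq_mul]
    congr 2
    have hsp : (P.map (algebraMap (ZMod p) K)).Splits := by
      have h2 := FiniteField.splits_X_pow_card_sub_X p (K := K)
      refine h2.of_dvd ?_ ?_
      · rw [Polynomial.map_ne_zero_iff (algebraMap (ZMod p) K).injective]
        exact FiniteField.X_pow_card_sub_X_ne_zero _ (by rw [hK]; exact Nat.one_lt_pow (by omega) hp.one_lt)
      · apply Polynomial.map_dvd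
        have := hi.natDegree_dvd_iff_dvd_X_pow_card_pow_sub_X.1 hd
        rwa [Nat.card_eq_fintype_card, ZMod.card, ← hK] at this
    rw [← card_rootSet_eq_natDegree (K := K) (PerfectField.separable_of_irreducible hi) hsp, ← Set.toFinset_card]
    congr 1
    ext x
    simp only [Set.mem_toFinset, Finset.mem_filter, Finset.mem_univ, true_and, mem_rootSet]
    constructor
    · rintro ⟨_, h⟩
      exact (minpoly.eq_of_irreducible_of_monic hi h hm).symm
    · rintro rfl
      exact ⟨hm.ne_zero, minpoly.aeval _ _⟩
  · intro x _
    have hint : IsIntegral (ZMod p) x := IsIntegral.of_finite _ x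
    have hd : (minpoly (ZMod p) x).natDegree ∣ j := by rw [← hfr]; exact minpoly.degree_dvd hint
    rw [Finset.mem_filter, mem_IR]
    exact ⟨⟨minpoly.monic hint, Nat.le_of_dvd hj hd, minpoly.irreducible hint⟩, hd⟩

lemma SS_eq_pow {ψ : AddChar (ZMod p) ℂ} (hψ : ψ ≠ 1) {u v : ZMod p} (hu : u ≠ 0) (hv : v ≠ 0)
    {α β : ℂ} (h1 : α + β = -AA ψ u v 1) (h2 : α * β = p) (d : ℕ) :
    SS ψ u v (d + 1) = -(α ^ (d + 1) + β ^ (d + 1)) := by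
  induction d using Nat.strong_induction_on with
  | _ d ih =>
  have hN := newton ψ u v (d + 1)
  match d, ih, hN with
  | 0, _, hN =>
    simp [AA_zero] at hN
    rw [pow_one, pow_one, h1, neg_neg, zero_add, ← hN]
  | 1, ih, hN =>
    have i0 := ih 0 (by norm_num)
    rw [Finset.sum_Icc_succ_top (by norm_num)] at hN
    simp [AA_zero, AA_two hψ hu hv] at hN i0 ⊢
    norm_num at hN ⊢
    rw [i0] at hN
    linear_combination -hN + (α + β) * h1 - 2 * h2
  | d + 2, ih, hN =>
    have i0 := ih d (by omega)
    have i1 := ih (d + 1) (by omega)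
    rw [AA_zero_of_ge hψ hu (by omega), Finset.sum_Icc_succ_top (by omega),
      Finset.sum_Icc_succ_top (by omega), Finset.sum_Icc_succ_top (by omega),
      Finset.sum_eq_zero] at hN
    · have e1 : d + 2 + 1 - (d + 1) = 2 := by omega
      have e2 : d + 2 + 1 - (d + 1 + 1) = 1 := by omega
      have e3 : d + 2 + 1 - (d + 1 + 1 + 1) = 0 := by omega
      rw [e1, e2, e3, AA_zero, AA_two hψ hu hv, i0, i1] at hN
      have h3 : AA ψ u v 1 = -(α + β) := by rw [h1]; ring
      rw [h3, ← h2] at hN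
      have e4 : d + 2 + 1 = d + 1 + 1 + 1 := rfl
      rw [e4]
      linear_combination -hN
    · intro j hj
      rw [Finset.mem_Icc] at hj
      rw [AA_zero_of_ge hψ hu (by omega), mul_zero]

lemma pow_bound_le {a P C : ℝ} (hP : 0 < P)
    (h : ∀ H : ℕ, a ^ (2 * (H + 1)) ≤ C * P ^ (H + 1)) : a ^ 2 ≤ P := by
  by_contra! hlt
  have h1 : 1 < a ^ 2 / P := by rwa [one_lt_div hP]
  have ht := tendsto_pow_atTop_atTop_of_one_lt h1
  obtain ⟨N, hN⟩ := ((Filter.tendsto_atTop.1 ht (C + 1)).and (Filter.eventually_ge_atTop 1)).exists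
  obtain ⟨H, rfl⟩ : ∃ H, N = H + 1 := ⟨N - 1, by omega⟩
  have h2 := h H
  rw [pow_mul] at h2
  have h3 := hN.1
  rw [div_pow, le_div_iff₀ (by positivity)] at h3
  have : 0 < P ^ (H + 1) := by positivity
  nlinarith

lemma roots_exist (s P : ℝ) (hP : 0 < P) : ∃ α β : ℂ, α + β = -(s : ℂ) ∧ α * β = (P : ℂ) ∧
    (∀ H : ℕ, -(2 * P ^ H) ≤ (α ^ (2 * H) + β ^ (2 * H)).re) ∧
    ((∃ C : ℝ, ∀ H : ℕ, (α ^ (2 * (H + 1)) + β ^ (2 * (H + 1))).re ≤ C * P ^ (H + 1)) →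
      s ^ 2 ≤ 4 * P) := by
  rcases le_or_gt (s ^ 2) (4 * P) with h | h
  · set t := √(4 * P - s ^ 2) with ht
    have ht2 : t ^ 2 = 4 * P - s ^ 2 := Real.sq_sqrt (by linarith)
    have ht2' : (t : ℂ) ^ 2 = 4 * P - s ^ 2 := by exact_mod_cast ht2
    have hI := Complex.I_sq
    have nb : ∀ e : ℝ, e ^ 2 = 1 → ∀ H : ℕ,
        ‖((-(s : ℂ) + e * t * Complex.I) / 2) ^ (2 * H)‖ = P ^ H := by
      intro e he H
      rw [norm_pow, pow_mul]
      congr 1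
      rw [← Complex.normSq_eq_norm_sq, Complex.normSq_apply]
      have : (-(s : ℂ) + e * t * Complex.I) / 2 = ((-s / 2 : ℝ) : ℂ) + ((e * t / 2 : ℝ) : ℂ) * Complex.I := by
        push_cast; ring
      rw [this]
      simp only [Complex.add_re, Complex.ofReal_re, Complex.re_ofReal_mul, Complex.I_re, Complex.add_im,
        Complex.ofReal_im, Complex.im_ofReal_mul, Complex.I_im]
      linear_combination (e ^ 2 / 4) * ht2 + (4 * P - s ^ 2) / 4 * he
    refine ⟨(-s + (1 : ℝ) * t * Complex.I) / 2, (-s + (-1 : ℝ) * t * Complex.I) / 2, ?_, ?_, ?_, fun _ => h⟩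
    · push_cast; ring
    · push_cast; linear_combination (-(t : ℂ) ^ 2 / 4) * hI + ht2' / 4
    · intro H
      have h1 := (abs_le.1 ((Complex.abs_re_le_norm _).trans_eq (nb 1 (by norm_num) H))).1
      have h2 := (abs_le.1 ((Complex.abs_re_le_norm _).trans_eq (nb (-1) (by norm_num) H))).1
      rw [Complex.add_re]
      linarith
  · set t := √(s ^ 2 - 4 * P) with ht
    have ht2 : t ^ 2 = s ^ 2 - 4 * P := Real.sq_sqrt (by linarith)
    have hre : ∀ H, ((((-s + t) / 2 : ℝ) : ℂ) ^ (2 * H) + (((-s - t) / 2 : ℝ) : ℂ) ^ (2 * H)).re =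
        ((-s + t) / 2) ^ (2 * H) + ((-s - t) / 2) ^ (2 * H) := by
      intro H; rw [← Complex.ofReal_pow, ← Complex.ofReal_pow, ← Complex.ofReal_add, Complex.ofReal_re]
    have hpos : ∀ (a : ℝ) (H : ℕ), 0 ≤ a ^ (2 * H) := fun a H => by rw [pow_mul]; positivity
    refine ⟨((-s + t) / 2 : ℝ), ((-s - t) / 2 : ℝ), ?_, ?_, ?_, ?_⟩
    · push_cast; ring
    · norm_cast; linear_combination -ht2 / 4
    · intro H
      rw [hre]
      have := hpos ((-s + t) / 2) H
      have := hpos ((-s - t) / 2) H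
      have : 0 < P ^ H := by positivity
      linarith
    · rintro ⟨C, hC⟩
      simp_rw [hre] at hC
      have h1 := pow_bound_le hP (a := (-s + t) / 2) (C := C) (fun H => by
        have := hC H; have := hpos ((-s - t) / 2) (H + 1); linarith)
      have h2 := pow_bound_le hP (a := (-s - t) / 2) (C := C) (fun H => by
        have := hC H; have := hpos ((-s + t) / 2) (H + 1); linarith)
      nlinarith

lemma AA_one_real (ψ : AddChar (ZMod p) ℂ) (u v : ZMod p) :
    ((AA ψ u v 1).re : ℂ) = AA ψ u v 1 := by
  rw [← Complex.conj_eq_iff_re, AA_one, map_sum]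
  rw [← Equiv.sum_comp (Equiv.neg (ZMod p)ˣ)]
  refine Finset.sum_congr rfl fun x _ => ?_
  rw [← AddChar.map_neg_eq_conj]
  congr 1
  simp only [Equiv.neg_apply, inv_neg, Units.val_neg]
  ring

lemma sum_SS {K : Type} [Field K] [Algebra (ZMod p) K] [Fintype K] [DecidableEq K] {j : ℕ}
    (hj : 0 < j) (hK : Fintype.card K = p ^ j) {ψ : AddChar (ZMod p) ℂ} (hψ : ψ ≠ 1) (u v : ZMod p) :
    ∑ c ∈ Finset.univ.filter (fun c : ZMod p => c ≠ 0), SS ψ (c * u) (c * v) j =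
    p * ((Finset.univ.filter (fun x : K => x ≠ 0 ∧
      Algebra.trace (ZMod p) K (algebraMap _ K u * x + algebraMap _ K v * x⁻¹) = 0)).card : ℂ)
      - ((p : ℂ) ^ j - 1) := by
  set T : K → ZMod p := fun x =>
    Algebra.trace (ZMod p) K (algebraMap _ K u * x + algebraMap _ K v * x⁻¹) with hT
  have h1 : ∀ c : ZMod p, SS ψ (c * u) (c * v) j = ∑ x : K, if x = 0 then 0 else ψ (c * T x) := by
    intro c
    rw [SS_eq_sum hj hK]
    refine Finset.sum_congr rfl fun x _ => ?_
    have : algebraMap (ZMod p) K (c * u) * x + algebraMap (ZMod p) K (c * v) * x⁻¹ =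
        c • (algebraMap _ K u * x + algebraMap _ K v * x⁻¹) := by
      rw [Algebra.smul_def, map_mul, map_mul]; ring
    rw [this, map_smul, smul_eq_mul]
  simp_rw [h1]
  rw [Finset.sum_comm]
  have h2 : ∀ x : K, (∑ c ∈ Finset.univ.filter (fun c : ZMod p => c ≠ 0),
      if x = 0 then (0 : ℂ) else ψ (c * T x)) =
      p * (if x ≠ 0 ∧ T x = 0 then 1 else 0) - (if x ≠ 0 then 1 else 0) := by
    intro x
    by_cases hx : x = 0
    · simp [hx]
    simp only [hx, if_false, not_false_eq_true, if_true, true_and, ne_eq]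
    have h3 := Finset.sum_filter_add_sum_filter_not Finset.univ (fun c : ZMod p => c = 0)
      (fun c => ψ (c * T x))
    rw [Finset.filter_eq' Finset.univ, if_pos (Finset.mem_univ _), Finset.sum_singleton, zero_mul,
      AddChar.map_zero_eq_one] at h3
    split_ifs with h0
    · simp only [h0, mul_zero, AddChar.map_zero_eq_one] at h3 ⊢
      simp [ZMod.card] at h3
      simp
      linear_combination h3
    · have h4 := sum_char_eq_zero hψ h0
      simp_rw [mul_comm (T x)] at h4
      rw [h4] at h3
      linear_combination h3
  simp_rw [h2]
  rw [Finset.sum_sub_distrib, ← Finset.mul_sum, Finset.sum_boole, Finset.sum_boole]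
  congr 2
  rw [Finset.filter_ne' Finset.univ, Finset.card_erase_of_mem (Finset.mem_univ _), Finset.card_univ,
    hK, Nat.cast_sub (Nat.one_le_pow _ _ (Fact.out : p.Prime).pos)]
  push_cast; ring

lemma sum_SS_lower {ψ : AddChar (ZMod p) ℂ} (hψ : ψ ≠ 1) {u v : ZMod p} (hu : u ≠ 0) (h : ℕ) :
    -(12 * (p : ℝ) ^ 2 * p ^ (h + 1)) ≤
    (∑ c ∈ Finset.univ.filter (fun c : ZMod p => c ≠ 0), SS ψ (c * u) (c * v) (2 * (h + 1))).re := by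
  classical
  have hp := (Fact.out : p.Prime)
  let K := GaloisField p (2 * (h + 1))
  have : Fintype K := Fintype.ofFinite _
  have hK : Fintype.card K = p ^ (2 * (h + 1)) := by
    rw [← Nat.card_eq_fintype_card]; exact GaloisField.card p _ (by omega)
  have hfr : Module.finrank (ZMod p) K = 2 * (h + 1) := GaloisField.finrank p (by omega)
  rw [sum_SS (K := K) (by omega) hK hψ]
  set T : K → ZMod p := fun x =>
    Algebra.trace (ZMod p) K (algebraMap _ K u * x + algebraMap _ K v * x⁻¹) with hT
  have hst : ∀ t : ZMod p, (Finset.univ.filter (fun x : K => x ≠ 0 ∧ T x = t)).card ≤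
      p ^ h * p ^ (h + 1) + 11 * p ^ (h + 1) := by
    intro t
    apply stepanov p h u v hu K (by rw [hK, ← pow_mul]; ring_nf) t
    intro x hx
    simp only [Finset.mem_filter, Finset.mem_univ, true_and] at hx
    refine ⟨hx.1, ?_⟩
    rw [← hx.2, hT]
    simp only
    rw [FiniteField.algebraMap_trace_eq_sum_pow, hfr, Nat.card_eq_fintype_card, ZMod.card]
  have htot : (Finset.univ.filter (fun x : K => x ≠ 0)).card = ∑ t : ZMod p,
      (Finset.univ.filter (fun x : K => x ≠ 0 ∧ T x = t)).card := by
    rw [Finset.card_eq_sum_card_fiberwise (f := T) (t := Finset.univ) (by simp)]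
    simp_rw [Finset.filter_filter]
  rw [Finset.filter_ne' Finset.univ, Finset.card_erase_of_mem (Finset.mem_univ _), Finset.card_univ,
    hK, ← Finset.add_sum_erase _ _ (Finset.mem_univ (0 : ZMod p))] at htot
  have hle : ∑ t ∈ Finset.univ.erase (0 : ZMod p),
      (Finset.univ.filter (fun x : K => x ≠ 0 ∧ T x = t)).card ≤
      (p - 1) * (p ^ h * p ^ (h + 1) + 11 * p ^ (h + 1)) := by
    refine (Finset.sum_le_card_nsmul _ _ _ (fun t _ => hst t)).trans ?_
    rw [Finset.card_erase_of_mem (Finset.mem_univ _), Finset.card_univ, ZMod.card, smul_eq_mul]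
  set N0 := (Finset.univ.filter (fun x : K => x ≠ 0 ∧ T x = 0)).card
  have h1 : p ^ (2 * (h + 1)) ≤ N0 + (p - 1) * (p ^ h * p ^ (h + 1) + 11 * p ^ (h + 1)) + 1 := by
    omega
  have h2 : (p : ℝ) ^ (2 * (h + 1)) ≤
      N0 + (p - 1) * (p ^ h * p ^ (h + 1) + 11 * p ^ (h + 1)) + 1 := by
    have := (Nat.cast_le (α := ℝ)).2 h1
    rw [Nat.cast_add, Nat.cast_add, Nat.cast_mul, Nat.cast_sub hp.one_le] at this
    exact_mod_cast this
  have hre : ((p : ℂ) * N0 - ((p : ℂ) ^ (2 * (h + 1)) - 1)).re =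
      p * N0 - ((p : ℝ) ^ (2 * (h + 1)) - 1) := by
    have : (p : ℂ) * N0 - ((p : ℂ) ^ (2 * (h + 1)) - 1) =
      ((p * N0 - ((p : ℝ) ^ (2 * (h + 1)) - 1) : ℝ) : ℂ) := by push_cast; ring
    rw [this, Complex.ofReal_re]
  rw [hre]
  have hp1 : (1 : ℝ) ≤ p := by exact_mod_cast hp.one_le
  have e1 : (p : ℝ) ^ (2 * (h + 1)) = p * (p ^ h * p ^ (h + 1)) := by ring
  have e2 : (1 : ℝ) ≤ p ^ (h + 1) := one_le_pow₀ hp1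
  rw [e1] at h2 ⊢
  set A : ℝ := p ^ h * p ^ (h + 1)
  set B : ℝ := p ^ (h + 1)
  have h3 := mul_le_mul_of_nonneg_left h2 (by linarith : (0 : ℝ) ≤ p)
  have h4 : 0 ≤ (p : ℝ) * (p - 1) := mul_nonneg (by linarith) (by linarith)
  nlinarith [mul_nonneg (by linarith : (0 : ℝ) ≤ p) (by linarith : 0 ≤ B), mul_le_mul_of_nonneg_left e2 (by positivity : (0 : ℝ) ≤ p ^ 2)]

/-- Weil bound for Kloosterman sums modulo a prime. -/
theorem weil {ψ : AddChar (ZMod p) ℂ} (hψ : ψ ≠ 1) {u v : ZMod p} (hu : u ≠ 0) (hv : v ≠ 0) :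
    ‖∑ x : (ZMod p)ˣ, ψ (u * x + v * (x⁻¹ : (ZMod p)ˣ))‖ ≤ 2 * √p := by
  have hp := (Fact.out : p.Prime)
  have hP : (0 : ℝ) < p := by exact_mod_cast hp.pos
  choose α β h1 h2 h3 h4 using fun c : ZMod p => roots_exist (AA ψ (c * u) (c * v) 1).re p hP
  have hS : ∀ c : ZMod p, c ≠ 0 → ∀ H : ℕ, SS ψ (c * u) (c * v) (2 * (H + 1)) =
      -(α c ^ (2 * (H + 1)) + β c ^ (2 * (H + 1))) := by
    intro c hc H
    have := SS_eq_pow hψ (mul_ne_zero hc hu) (mul_ne_zero hc hv) (α := α c) (β := β c)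
      (by rw [h1, AA_one_real]) (by rw [h2]; simp) (2 * H + 1)
    exact this
  have key := h4 1 ⟨12 * p ^ 2 + 2 * p, fun H => by
    have hlow := sum_SS_lower hψ (v := v) hu H
    rw [Finset.sum_congr rfl (fun c hc => hS c (by simpa using hc) H), Complex.re_sum,
      ← Finset.add_sum_erase _ _ (by simp : (1 : ZMod p) ∈ Finset.univ.filter (fun c : ZMod p => c ≠ 0))]
      at hlow
    have hup : ∑ c ∈ (Finset.univ.filter (fun c : ZMod p => c ≠ 0)).erase 1,
        (-(α c ^ (2 * (H + 1)) + β c ^ (2 * (H + 1)))).re ≤ p * (2 * (p : ℝ) ^ (H + 1)) := by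
      refine (Finset.sum_le_card_nsmul _ _ (2 * (p : ℝ) ^ (H + 1)) (fun c _ => ?_)).trans ?_
      · have := h3 c (H + 1); rw [Complex.neg_re]; linarith
      · rw [nsmul_eq_mul]
        gcongr
        refine (Finset.card_le_univ _).trans_eq (ZMod.card p)
    rw [Complex.neg_re] at hlow
    nlinarith⟩
  rw [one_mul, one_mul] at key
  rw [← AA_one, ← AA_one_real, Complex.norm_real, Real.norm_eq_abs]
  apply abs_le_of_sq_le_sq _ (by positivity)
  rw [mul_pow, Real.sq_sqrt hP.le]; linarith

end WB
end HES


namespace HES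

/-- Kloosterman sum -/
noncomputable def KS {c : ℕ} [NeZero c] (ψ : AddChar (ZMod c) ℂ) (m n : ℤ) : ℂ :=
  ∑ x : (ZMod c)ˣ, ψ (m * x + n * (x⁻¹ : (ZMod c)ˣ))

lemma KS_mul {a b : ℕ} [NeZero a] [NeZero b] [NeZero (a * b)] (hab : a.Coprime b)
    {ψ : AddChar (ZMod (a * b)) ℂ} (hψ : ψ.IsPrimitive) :
    ∃ (ψ₁ : AddChar (ZMod a) ℂ) (ψ₂ : AddChar (ZMod b) ℂ), ψ₁.IsPrimitive ∧ ψ₂.IsPrimitive ∧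
      ∀ m n : ℤ, KS ψ m n = KS ψ₁ m n * KS ψ₂ m n := by
  let e := ZMod.chineseRemainder hab
  let i1 : ZMod a →+ ZMod (a * b) := e.symm.toAddMonoidHom.comp (AddMonoidHom.inl _ _)
  let i2 : ZMod b →+ ZMod (a * b) := e.symm.toAddMonoidHom.comp (AddMonoidHom.inr _ _)
  refine ⟨ψ.compAddMonoidHom i1, ψ.compAddMonoidHom i2, ?_, ?_, ?_⟩
  · intro x hx h
    have : i1 x ≠ 0 := by
      simpa [i1] using hx
    apply hψ this
    ext y
    have h1 := DFunLike.congr_fun h (e y).1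
    simp only [AddChar.mulShift_apply, AddChar.compAddMonoidHom_apply, AddChar.one_apply] at h1 ⊢
    rw [← h1]
    congr 1
    apply e.injective
    simp [i1]
    ext <;> simp
  · intro x hx h
    have : i2 x ≠ 0 := by
      simpa [i2] using hx
    apply hψ this
    ext y
    have h1 := DFunLike.congr_fun h (e y).2
    simp only [AddChar.mulShift_apply, AddChar.compAddMonoidHom_apply, AddChar.one_apply] at h1 ⊢
    rw [← h1]
    congr 1
    apply e.injective
    simp [i2]
    ext <;> simp
  · intro m n
    rw [KS, KS, KS, Fintype.sum_mul_sum, ← Fintype.sum_prod_type']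
    refine Fintype.sum_equiv ((Units.mapEquiv e.toMulEquiv).trans MulEquiv.prodUnits).toEquiv _ _ ?_
    intro x
    simp only [AddChar.compAddMonoidHom_apply]
    rw [← AddChar.map_add_eq_mul]
    congr 1
    apply e.injective
    ext
    · simp [i1, i2]
      rfl
    · simp [i1, i2]
      rfl

section avg
variable {c : ℕ} [NeZero c]

lemma sum_prim {ψ : AddChar (ZMod c) ℂ} (hψ : ψ.IsPrimitive) (b : ZMod c) :
    ∑ x, ψ (b * x) = if b = 0 then (c : ℂ) else 0 := by
  have := AddChar.sum_mulShift b hψ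
  simp_rw [mul_comm b]
  rw [this]; simp [ZMod.card]

lemma norm_char (ψ : AddChar (ZMod c) ℂ) (x : ZMod c) : ‖ψ x‖ = 1 := ψ.norm_apply x

lemma KS_triv (ψ : AddChar (ZMod c) ℂ) (m n : ℤ) : ‖KS ψ m n‖ ≤ c := by
  rw [KS]
  refine (norm_sum_le _ _).trans ?_
  simp_rw [norm_char]
  rw [Finset.sum_const, Finset.card_univ, nsmul_eq_mul, mul_one, ZMod.card_units_eq_totient]
  exact_mod_cast Nat.totient_le c

lemma KS_shift (ψ : AddChar (ZMod c) ℂ) (m n : ℤ) (s w : ZMod c) (hs : s ^ 3 = 0) :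
    KS ψ m n = ∑ x : (ZMod c)ˣ, ψ (m * x + n * (x⁻¹ : (ZMod c)ˣ)) *
      ψ (s * (m * x - n * (x⁻¹ : (ZMod c)ˣ)) * w + s ^ 2 * (n * (x⁻¹ : (ZMod c)ˣ)) * w ^ 2) := by
  let y : (ZMod c)ˣ := ⟨1 + s * w, 1 - s * w + s ^ 2 * w ^ 2, by linear_combination w ^ 3 * hs,
    by linear_combination w ^ 3 * hs⟩
  rw [KS, ← Equiv.sum_comp (Equiv.mulRight y)]
  refine Finset.sum_congr rfl fun x _ => ?_
  rw [← AddChar.map_add_eq_mul]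
  congr 1
  simp only [Equiv.coe_mulRight, mul_inv, Units.val_mul]
  have : ((y⁻¹ : (ZMod c)ˣ) : ZMod c) = 1 - s * w + s ^ 2 * w ^ 2 := rfl
  rw [this]
  have h2 : (y : ZMod c) = 1 + s * w := rfl
  rw [h2]
  ring

lemma KS_even {ψ : AddChar (ZMod c) ℂ} (hψ : ψ.IsPrimitive) (m n : ℤ) (s : ZMod c) (hs : s ^ 2 = 0) :
    ‖KS ψ m n‖ ≤ (Finset.univ.filter (fun x : (ZMod c)ˣ =>
      s * (m * x - n * (x⁻¹ : (ZMod c)ˣ)) = 0)).card := by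
  have h1 : (c : ℂ) * KS ψ m n = ∑ w : ZMod c, ∑ x : (ZMod c)ˣ, ψ (m * x + n * (x⁻¹ : (ZMod c)ˣ)) *
      ψ (s * (m * x - n * (x⁻¹ : (ZMod c)ˣ)) * w) := by
    rw [Finset.sum_congr rfl (g := fun _ => KS ψ m n)]
    · simp [ZMod.card]
    · intro w _
      rw [KS_shift ψ m n s w (by linear_combination s * hs)]
      refine Finset.sum_congr rfl fun x _ => ?_
      rw [hs, zero_mul, zero_mul, add_zero]
  rw [Finset.sum_comm] at h1
  simp_rw [← Finset.mul_sum, sum_prim hψ] at h1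
  have hc : (c : ℂ) ≠ 0 := NeZero.ne _
  have h2 : KS ψ m n = ∑ x : (ZMod c)ˣ, ψ (m * x + n * (x⁻¹ : (ZMod c)ˣ)) *
      (if s * (m * x - n * (x⁻¹ : (ZMod c)ˣ)) = 0 then 1 else 0) := by
    apply mul_left_cancel₀ hc
    rw [h1, Finset.mul_sum]
    refine Finset.sum_congr rfl fun x _ => ?_
    split_ifs <;> ring
  rw [h2]
  refine (norm_sum_le _ _).trans ?_
  rw [Finset.card_filter, Nat.cast_sum]
  refine Finset.sum_le_sum fun x _ => ?_
  rw [norm_mul, norm_char]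
  split_ifs <;> simp

lemma gauss_sq {ψ : AddChar (ZMod c) ℂ} (hψ : ψ.IsPrimitive) (B D : ZMod c) :
    (‖∑ w : ZMod c, ψ (B * w + D * w ^ 2)‖ ^ 2 : ℝ) ≤
      c * ‖∑ t ∈ Finset.univ.filter (fun t : ZMod c => 2 * D * t = 0), ψ (B * t + D * t ^ 2)‖ := by
  have h1 : ((‖∑ w : ZMod c, ψ (B * w + D * w ^ 2)‖ ^ 2 : ℝ) : ℂ) =
      c * ∑ t ∈ Finset.univ.filter (fun t : ZMod c => 2 * D * t = 0), ψ (B * t + D * t ^ 2) := by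
    push_cast
    rw [← Complex.mul_conj', map_sum, Finset.sum_mul_sum, Finset.sum_comm]
    have h2 : ∀ w : ZMod c, ∑ x : ZMod c, ψ (B * x + D * x ^ 2) *
        (starRingEnd ℂ) (ψ (B * w + D * w ^ 2)) =
        ∑ t : ZMod c, ψ (B * t + D * t ^ 2) * ψ (2 * D * t * w) := by
      intro w
      rw [← Equiv.sum_comp (Equiv.addRight w)]
      refine Finset.sum_congr rfl fun t _ => ?_
      rw [← AddChar.map_neg_eq_conj, ← AddChar.map_add_eq_mul, ← AddChar.map_add_eq_mul]
      congr 1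
      simp only [Equiv.coe_addRight]
      ring
    simp_rw [h2]
    rw [Finset.sum_comm]
    simp_rw [← Finset.mul_sum, sum_prim hψ]
    rw [Finset.sum_filter, Finset.mul_sum]
    refine Finset.sum_congr rfl fun x _ => ?_
    split_ifs <;> ring
  have h3 := congrArg norm h1
  rw [norm_mul, Complex.norm_natCast, Complex.norm_real, Real.norm_of_nonneg (by positivity)] at h3
  exact h3.le

lemma card_mul_eq_zero_le (d : ℕ) (hd : 0 < d) :
    (Finset.univ.filter (fun t : ZMod c => (d : ZMod c) * t = 0)).card ≤ d := by
  have := IsAddCyclic.card_nsmul_eq_zero_le (α := ZMod c) hd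
  simpa [nsmul_eq_mul] using this

end avg

section pp
variable {p : ℕ} [Fact p.Prime]

instance (k : ℕ) : NeZero (p ^ k) := ⟨pow_ne_zero _ (Fact.out : p.Prime).ne_zero⟩

lemma KS_odd {c l : ℕ} [NeZero c] (hc : c = p ^ (2 * l + 1)) (hl : 1 ≤ l) (hp2 : p ≠ 2)
    {ψ : AddChar (ZMod c) ℂ}
    (hψ : ψ.IsPrimitive) (m n : ℤ) (hn : ¬ (p : ℤ) ∣ n) :
    ‖KS ψ m n‖ * √p ≤ (Finset.univ.filter (fun x : (ZMod c)ˣ =>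
      (p : ZMod c) ^ (l + 1) * (m * x - n * (x⁻¹ : (ZMod c)ˣ)) = 0)).card := by
  have hp := (Fact.out : p.Prime)
  set P : ZMod c := (p : ZMod c) with hP
  have hPc : P ^ (2 * l + 1) = 0 := by
    rw [hP, ← Nat.cast_pow, ← hc]; exact ZMod.natCast_self _
  have h3 : (P ^ l) ^ 3 = 0 := by
    rw [← pow_mul]; exact pow_eq_zero_of_le (by omega) hPc
  have hunit : IsUnit ((2 * n : ℤ) : ZMod c) := by
    rw [ZMod.coe_int_isUnit_iff_isCoprime, hc, Nat.cast_pow]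
    apply IsCoprime.pow_left
    rw [Prime.coprime_iff_not_dvd (Nat.prime_iff_prime_int.1 hp)]
    intro h
    rcases (Nat.prime_iff_prime_int.1 hp).dvd_or_dvd h with h | h
    · exact hp2 ((Nat.prime_dvd_prime_iff_eq hp Nat.prime_two).1 (by exact_mod_cast h))
    · exact hn h
  set G : (ZMod c)ˣ → ℂ := fun x => ∑ w : ZMod c,
    ψ ((P ^ l * (m * x - n * (x⁻¹ : (ZMod c)ˣ))) * w + ((P ^ l) ^ 2 * (n * (x⁻¹ : (ZMod c)ˣ))) * w ^ 2)
    with hG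
  have h1 : (c : ℂ) * KS ψ m n = ∑ x : (ZMod c)ˣ, ψ (m * x + n * (x⁻¹ : (ZMod c)ˣ)) * G x := by
    simp_rw [hG, Finset.mul_sum]
    rw [Finset.sum_comm, Finset.sum_congr rfl (g := fun _ => KS ψ m n)]
    · simp [ZMod.card]
    · intro w _
      rw [KS_shift ψ m n (P ^ l) w h3]
  have h2 : ∀ x, ‖G x‖ * √p ≤ c * (if P ^ (l + 1) * (m * x - n * (x⁻¹ : (ZMod c)ˣ)) = 0 then 1 else 0) := by
    intro x
    have hset : ∀ t : ZMod c, 2 * ((P ^ l) ^ 2 * (n * (x⁻¹ : (ZMod c)ˣ))) * t = 0 ↔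
        P ^ (2 * l) * t = 0 := by
      intro t
      obtain ⟨y, hy⟩ := hunit
      have : 2 * ((P ^ l) ^ 2 * (n * (x⁻¹ : (ZMod c)ˣ))) * t =
        ((y * x⁻¹ : (ZMod c)ˣ) : ZMod c) * (P ^ (2 * l) * t) := by
        rw [Units.val_mul, hy]; push_cast; ring
      rw [this, Units.mul_right_eq_zero]
    have hg := gauss_sq hψ (P ^ l * (m * x - n * (x⁻¹ : (ZMod c)ˣ)))
      ((P ^ l) ^ 2 * (n * (x⁻¹ : (ZMod c)ˣ)))
    simp_rw [hset] at hg
    rw [Finset.sum_congr (s₁ := Finset.univ.filter (fun t : ZMod c => P ^ (2 * l) * t = 0)) rfl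
      (g := fun t => ψ (P ^ l * (m * x - n * (x⁻¹ : (ZMod c)ˣ)) * t)) (by
      intro t ht
      rw [Finset.mem_filter] at ht
      congr 1
      linear_combination (n * (x⁻¹ : (ZMod c)ˣ)) * t * ht.2)] at hg
    have hcp : (c : ℝ) = p ^ (2 * l) * p := by rw [hc]; push_cast; ring
    have hcpos : (0 : ℝ) < c := by rw [hcp]; have := hp.pos; positivity
    split_ifs with hB
    · have h4 : ‖∑ t ∈ Finset.univ.filter (fun t : ZMod c => P ^ (2 * l) * t = 0),
          ψ (P ^ l * (m * x - n * (x⁻¹ : (ZMod c)ˣ)) * t)‖ ≤ p ^ (2 * l) := by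
        refine (norm_sum_le _ _).trans ?_
        simp_rw [norm_char]
        rw [Finset.sum_const, nsmul_eq_mul, mul_one]
        have := card_mul_eq_zero_le (c := c) (p ^ (2 * l)) (pow_pos hp.pos _)
        simp_rw [Nat.cast_pow, ← hP] at this
        exact (Nat.cast_le.2 this).trans_eq (by push_cast; rfl)
      rw [mul_one]
      apply le_of_sq_le_sq _ hcpos.le
      rw [mul_pow, Real.sq_sqrt (by positivity)]
      calc ‖G x‖ ^ 2 * p ≤ (c * p ^ (2 * l)) * p := by
            gcongr
            exact hg.trans (by gcongr)
        _ = c ^ 2 := by rw [sq, mul_assoc, ← hcp]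
    · have hB2 : P ^ l * (m * x - n * (x⁻¹ : (ZMod c)ˣ)) * P ≠ 0 := by
        intro h; apply hB; rw [← h]; ring
      have := hψ hB2
      obtain ⟨r, hr⟩ : ∃ r, ψ (P ^ l * (m * x - n * (x⁻¹ : (ZMod c)ˣ)) * P * r) ≠ 1 := by
        by_contra! h
        apply this
        ext r
        simpa using h r
      have hz : ∑ t ∈ Finset.univ.filter (fun t : ZMod c => P ^ (2 * l) * t = 0),
          ψ (P ^ l * (m * x - n * (x⁻¹ : (ZMod c)ˣ)) * t) = 0 := by
        set T := ∑ t ∈ Finset.univ.filter (fun t : ZMod c => P ^ (2 * l) * t = 0),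
          ψ (P ^ l * (m * x - n * (x⁻¹ : (ZMod c)ˣ)) * t) with hT
        have hh : T = ψ (P ^ l * (m * x - n * (x⁻¹ : (ZMod c)ˣ)) * P * r) * T := by
          rw [hT, Finset.mul_sum]
          symm
          refine Finset.sum_bij (fun t _ => t + P * r) ?_ ?_ ?_ ?_
          · intro t ht
            rw [Finset.mem_filter] at ht ⊢
            exact ⟨Finset.mem_univ _, by linear_combination ht.2 + r * hPc⟩
          · intro a _ b _ h; simpa using h
          · intro t ht
            rw [Finset.mem_filter] at ht
            refine ⟨t - P * r, ?_, by ring⟩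
            rw [Finset.mem_filter]
            exact ⟨Finset.mem_univ _, by linear_combination ht.2 - r * hPc⟩
          · intro t _
            rw [← AddChar.map_add_eq_mul]; congr 1; ring
        have h5 : (1 - ψ (P ^ l * (m * x - n * (x⁻¹ : (ZMod c)ˣ)) * P * r)) * T = 0 := by
          linear_combination hh
        rcases mul_eq_zero.1 h5 with h | h
        · exact absurd (by linear_combination -h) hr
        · exact h
      rw [hz, norm_zero, mul_zero] at hg
      have h6 : ‖G x‖ = 0 := by
        have : ‖G x‖ ^ 2 ≤ 0 := hg
        nlinarith [norm_nonneg (G x)]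
      rw [h6]; simp
  have hcpos : (0 : ℝ) < c := by rw [hc]; have := hp.pos; positivity
  have h4 := congrArg norm h1
  rw [norm_mul, Complex.norm_natCast] at h4
  have h5 : c * (‖KS ψ m n‖ * √p) ≤ c * ((Finset.univ.filter (fun x : (ZMod c)ˣ =>
      P ^ (l + 1) * (m * x - n * (x⁻¹ : (ZMod c)ˣ)) = 0)).card : ℝ) := by
    rw [← mul_assoc, h4, Finset.card_filter, Nat.cast_sum, Finset.mul_sum]
    calc _ ≤ (∑ x : (ZMod c)ˣ, ‖G x‖) * √p := by
          gcongr
          refine (norm_sum_le _ _).trans (Finset.sum_le_sum fun x _ => ?_)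
          rw [norm_mul, norm_char, one_mul]
      _ ≤ _ := by
          rw [Finset.sum_mul]
          refine Finset.sum_le_sum fun x _ => (h2 x).trans_eq ?_
          push_cast; rfl
  exact le_of_mul_le_mul_left h5 hcpos

lemma dvd_two_mul {a b x : ℤ} {l : ℕ} (hx : ¬ (p : ℤ) ∣ x) (hs : a + b = 2 * x)
    (h : (p : ℤ) ^ l ∣ a * b) : (p : ℤ) ^ l ∣ 2 * a ∨ (p : ℤ) ^ l ∣ 2 * b := by
  have hp := Nat.prime_iff_prime_int.1 (Fact.out : p.Prime)
  rw [dvd_mul] at h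
  obtain ⟨u, v, hu, hv, huv⟩ := h
  obtain ⟨i, -, hi⟩ := (dvd_prime_pow hp l).1 ⟨v, huv⟩
  obtain ⟨j, -, hj⟩ := (dvd_prime_pow hp l).1 ⟨u, by rw [mul_comm]; exact huv⟩
  have hcop : ∀ i, (p : ℤ) ^ i ∣ 2 * x → (p : ℤ) ^ i ∣ 2 := by
    intro i h
    refine IsCoprime.dvd_of_dvd_mul_right ?_ h
    exact IsCoprime.pow_left ((Prime.coprime_iff_not_dvd hp).2 hx)
  have hi' := hi.symm.dvd.trans hu
  have hj' := hj.symm.dvd.trans hv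
  have hl : (p : ℤ) ^ l ∣ p ^ i * p ^ j := by
    rw [huv]; exact mul_dvd_mul hi.dvd hj.dvd
  rcases le_total i j with hij | hij
  · right
    have : (p : ℤ) ^ i ∣ 2 := hcop i (by rw [← hs]; exact dvd_add hi' ((pow_dvd_pow _ hij).trans hj'))
    exact hl.trans (mul_dvd_mul this hj')
  · left
    have : (p : ℤ) ^ j ∣ 2 := hcop j (by rw [← hs]; exact dvd_add ((pow_dvd_pow _ hij).trans hi') hj')
    exact hl.trans (by rw [mul_comm]; exact mul_dvd_mul this hi')

lemma mul_pow_eq_zero_iff {c k l : ℕ} [NeZero c] (hc : c = p ^ k) (hl : l ≤ k) (y : ℤ) :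
    (p : ZMod c) ^ (k - l) * (y : ZMod c) = 0 ↔ (p : ℤ) ^ l ∣ y := by
  have hp := (Fact.out : p.Prime)
  have : (p : ZMod c) ^ (k - l) * (y : ZMod c) = (((p : ℤ) ^ (k - l) * y : ℤ) : ZMod c) := by push_cast; rfl
  rw [this, ZMod.intCast_zmod_eq_zero_iff_dvd, hc]
  have h2 : ((p ^ k : ℕ) : ℤ) = (p : ℤ) ^ (k - l) * p ^ l := by
    rw [← pow_add, Nat.sub_add_cancel hl]; push_cast; rfl
  rw [h2]
  exact mul_dvd_mul_iff_left (pow_ne_zero _ (by exact_mod_cast hp.ne_zero))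

lemma count_le {c k l : ℕ} [NeZero c] (hc : c = p ^ k) (hl : l ≤ k) (hl1 : 1 ≤ l) (m n : ℤ)
    (hmn : ¬ ((p : ℤ) ∣ m ∧ (p : ℤ) ∣ n)) :
    (Finset.univ.filter (fun x : (ZMod c)ˣ =>
      (p : ZMod c) ^ (k - l) * (m * x - n * (x⁻¹ : (ZMod c)ˣ)) = 0)).card ≤
      if (p : ℤ) ∣ n then 0 else 4 * p ^ (k - l) := by
  have hp := (Fact.out : p.Prime)
  have hpi := Nat.prime_iff_prime_int.1 hp
  have hcast : ∀ x : (ZMod c)ˣ, (((x : ZMod c).val : ℤ) : ZMod c) = x := by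
    intro x; simp
  have hcop : ∀ x : (ZMod c)ˣ, ¬ (p : ℤ) ∣ ((x : ZMod c).val : ℤ) := by
    intro x h
    have h1 := ZMod.val_coe_unit_coprime x
    have h2 : p ∣ (x : ZMod c).val := by exact_mod_cast h
    have h3 : p ∣ c := by rw [hc]; exact dvd_pow_self p (by omega)
    exact hp.one_lt.ne' (Nat.dvd_one.1 (h1 ▸ Nat.dvd_gcd h2 h3))
  have hdv : ∀ x : (ZMod c)ˣ, (p : ZMod c) ^ (k - l) * (m * x - n * (x⁻¹ : (ZMod c)ˣ)) = 0 →
      (p : ℤ) ^ l ∣ m * ((x : ZMod c).val : ℤ) ^ 2 - n := by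
    intro x hx
    rw [← mul_pow_eq_zero_iff hc hl]
    push_cast
    simp only [ZMod.natCast_val, ZMod.cast_id', id_eq]
    have h1 : ((x⁻¹ : (ZMod c)ˣ) : ZMod c) * x = 1 := Units.inv_mul x
    linear_combination (x : ZMod c) * hx + (p : ZMod c) ^ (k - l) * n * h1
  rcases Finset.eq_empty_or_nonempty (Finset.univ.filter (fun x : (ZMod c)ˣ =>
      (p : ZMod c) ^ (k - l) * (m * x - n * (x⁻¹ : (ZMod c)ˣ)) = 0)) with he | ⟨x0, hx0⟩
  · rw [he]; simp
  rw [Finset.mem_filter] at hx0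
  have h0 := hdv x0 hx0.2
  have hpl : (p : ℤ) ∣ (p : ℤ) ^ l := dvd_pow_self _ (by omega)
  have hm : ¬ (p : ℤ) ∣ m := by
    intro h
    apply hmn
    refine ⟨h, ?_⟩
    have := (hpl.trans h0)
    exact (dvd_sub_right (h.mul_right _)).1 this
  rw [if_neg]
  · have hsub : (Finset.univ.filter (fun x : (ZMod c)ˣ =>
        (p : ZMod c) ^ (k - l) * (m * x - n * (x⁻¹ : (ZMod c)ˣ)) = 0)).map
        ⟨fun x : (ZMod c)ˣ => (x : ZMod c), Units.val_injective⟩ ⊆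
        ((Finset.univ.filter (fun t : ZMod c => ((2 * p ^ (k - l) : ℕ) : ZMod c) * t = 0)).image
          (fun t => t + x0)) ∪
        ((Finset.univ.filter (fun t : ZMod c => ((2 * p ^ (k - l) : ℕ) : ZMod c) * t = 0)).image
          (fun t => t - x0)) := by
      intro y hy
      simp only [Finset.mem_map, Finset.mem_filter, Finset.mem_univ, true_and,
        Function.Embedding.coeFn_mk] at hy
      obtain ⟨x, hx, rfl⟩ := hy
      have h1 := hdv x hx
      have h2 : (p : ℤ) ^ l ∣ (((x : ZMod c).val : ℤ) - ((x0 : ZMod c).val : ℤ)) *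
          (((x : ZMod c).val : ℤ) + ((x0 : ZMod c).val : ℤ)) := by
        have h3 := dvd_sub h1 h0
        have h4 : (p : ℤ) ^ l ∣ m * ((((x : ZMod c).val : ℤ) - ((x0 : ZMod c).val : ℤ)) *
          (((x : ZMod c).val : ℤ) + ((x0 : ZMod c).val : ℤ))) := by
          obtain ⟨q, hq⟩ := h3
          exact ⟨q, by linear_combination hq⟩
        exact (IsCoprime.pow_left ((Prime.coprime_iff_not_dvd hpi).2 hm)).dvd_of_dvd_mul_left h4
      rw [Finset.mem_union, Finset.mem_image, Finset.mem_image]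
      rcases dvd_two_mul (hcop x) (show (((x : ZMod c).val : ℤ) - ((x0 : ZMod c).val : ℤ)) +
          (((x : ZMod c).val : ℤ) + ((x0 : ZMod c).val : ℤ)) = 2 * ((x : ZMod c).val : ℤ) by ring) h2 with h5 | h5
      · left
        refine ⟨x - x0, ?_, by simp⟩
        rw [← mul_pow_eq_zero_iff hc hl] at h5
        push_cast at h5
        simp only [ZMod.natCast_val, ZMod.cast_id', id_eq] at h5
        rw [Finset.mem_filter]
        exact ⟨Finset.mem_univ _, by push_cast; linear_combination h5⟩
      · right
        refine ⟨x + x0, ?_, by simp⟩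
        rw [← mul_pow_eq_zero_iff hc hl] at h5
        push_cast at h5
        simp only [ZMod.natCast_val, ZMod.cast_id', id_eq] at h5
        rw [Finset.mem_filter]
        exact ⟨Finset.mem_univ _, by push_cast; linear_combination h5⟩
    have h6 := Finset.card_le_card hsub
    rw [Finset.card_map] at h6
    refine h6.trans ((Finset.card_union_le _ _).trans ?_)
    have h7 := card_mul_eq_zero_le (c := c) (2 * p ^ (k - l)) (by have := hp.pos; positivity)
    have h8 := Finset.card_image_le (s := Finset.univ.filter (fun t : ZMod c =>
      ((2 * p ^ (k - l) : ℕ) : ZMod c) * t = 0)) (f := fun t => t + (x0 : ZMod c))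
    have h9 := Finset.card_image_le (s := Finset.univ.filter (fun t : ZMod c =>
      ((2 * p ^ (k - l) : ℕ) : ZMod c) * t = 0)) (f := fun t => t - (x0 : ZMod c))
    omega
  · intro h
    have h1 := (dvd_sub_left h).1 (hpl.trans h0)
    rcases hpi.dvd_or_dvd h1 with h2 | h2
    · exact hm h2
    · exact hcop x0 (hpi.dvd_of_dvd_pow h2)

end pp

end HES


namespace HES
section pp2
variable {p : ℕ} [Fact p.Prime]

lemma KS_red {c c' k : ℕ} [NeZero c] [NeZero c'] (hk : 1 ≤ k) (hc : c = p ^ (k + 1))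
    (hc' : c' = p ^ k) {ψ : AddChar (ZMod c) ℂ} (hψ : ψ.IsPrimitive) :
    ∃ ψ' : AddChar (ZMod c') ℂ, ψ'.IsPrimitive ∧
      ∀ m n : ℤ, KS ψ (p * m) (p * n) = p * KS ψ' m n := by
  have hp := (Fact.out : p.Prime)
  have hcc : c = p * c' := by rw [hc, hc', pow_succ']
  have hdvd : c' ∣ c := ⟨p, by rw [hcc, mul_comm]⟩
  let i0 : ℤ →+ ZMod c := (AddMonoidHom.mulLeft (p : ZMod c)).comp (Int.castAddHom (ZMod c))
  have hi0 : i0 c' = 0 := by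
    simp only [i0, AddMonoidHom.comp_apply, AddMonoidHom.coe_mulLeft, Int.coe_castAddHom]
    have : ((p * c' : ℕ) : ZMod c) = 0 := by rw [← hcc]; exact ZMod.natCast_self c
    exact_mod_cast this
  let i : ZMod c' →+ ZMod c := ZMod.lift c' ⟨i0, hi0⟩
  have hi : ∀ z : ZMod c, i (ZMod.castHom hdvd (ZMod c') z) = p * z := by
    intro z
    obtain ⟨z, rfl⟩ := ZMod.intCast_surjective z
    rw [map_intCast]
    simp [i, i0]
  have hinj : ∀ x : ZMod c', i x = 0 → x = 0 := by
    intro x hx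
    obtain ⟨z, rfl⟩ := ZMod.intCast_surjective x
    have h1 := hi z
    rw [map_intCast, hx] at h1
    rw [ZMod.intCast_zmod_eq_zero_iff_dvd]
    have h2 : (((p : ℤ) * z : ℤ) : ZMod c) = 0 := by push_cast; exact h1.symm
    rw [ZMod.intCast_zmod_eq_zero_iff_dvd, hcc] at h2
    push_cast at h2
    exact (mul_dvd_mul_iff_left (by exact_mod_cast hp.ne_zero)).1 h2
  refine ⟨ψ.compAddMonoidHom i, ?_, ?_⟩
  · intro x hx h
    apply hψ (a := i x) (fun h => hx (hinj x h))
    ext y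
    obtain ⟨z, rfl⟩ := ZMod.ringHom_surjective (ZMod.castHom hdvd (ZMod c')) x
    have h1 := DFunLike.congr_fun h (ZMod.castHom hdvd (ZMod c') y)
    simp only [AddChar.mulShift_apply, AddChar.compAddMonoidHom_apply, AddChar.one_apply] at h1 ⊢
    rw [← h1, ← map_mul, hi, hi, mul_assoc]
  · intro m n
    set g : (ZMod c')ˣ → ℂ := fun u => (ψ.compAddMonoidHom i) (m * u + n * (u⁻¹ : (ZMod c')ˣ)) with hg
    have h1 : KS ψ (p * m) (p * n) = ∑ x : (ZMod c)ˣ, g (ZMod.unitsMap hdvd x) := by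
      rw [KS]
      refine Finset.sum_congr rfl fun x _ => ?_
      rw [hg]
      simp only [AddChar.compAddMonoidHom_apply]
      congr 1
      have : ((ZMod.unitsMap hdvd x : (ZMod c')ˣ) : ZMod c') = ZMod.castHom hdvd (ZMod c') x := rfl
      rw [← map_inv]
      have h2 : ((ZMod.unitsMap hdvd x⁻¹ : (ZMod c')ˣ) : ZMod c') =
        ZMod.castHom hdvd (ZMod c') (x⁻¹ : (ZMod c)ˣ) := rfl
      rw [this, h2, ← map_intCast (ZMod.castHom hdvd (ZMod c')) m,
        ← map_intCast (ZMod.castHom hdvd (ZMod c')) n, ← map_mul, ← map_mul, ← map_add, hi]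
      push_cast
      ring
    have hsurj := ZMod.unitsMap_surjective hdvd
    obtain ⟨N, hN⟩ : ∃ N : ℕ, ∀ u : (ZMod c')ˣ,
        (Finset.univ.filter (fun x => ZMod.unitsMap hdvd x = u)).card = N := by
      refine ⟨_, fun u => MonoidHom.card_fiber_eq_of_mem_range (ZMod.unitsMap hdvd) (x := u) (y := 1) (hsurj u) (hsurj 1)⟩
    have hNp : N = p := by
      have h3 := Finset.card_eq_sum_card_fiberwise (s := (Finset.univ : Finset (ZMod c)ˣ))
        (t := (Finset.univ : Finset (ZMod c')ˣ)) (f := ZMod.unitsMap hdvd) (by intro x _; simp)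
      rw [Finset.sum_congr rfl (fun u _ => hN u), Finset.sum_const, Finset.card_univ, Finset.card_univ,
        ZMod.card_units_eq_totient, ZMod.card_units_eq_totient, hc, hc',
        Nat.totient_prime_pow_succ hp, Nat.totient_prime_pow hp (by omega), smul_eq_mul] at h3
      have h4 : p ^ k = p ^ (k - 1) * p := by rw [← pow_succ]; congr 1; omega
      have h5 : 0 < p ^ (k - 1) * (p - 1) := Nat.mul_pos (pow_pos hp.pos _) (by have := hp.one_lt; omega)
      apply Nat.eq_of_mul_eq_mul_left h5
      rw [← h3, h4]; ring
    rw [h1, KS, Finset.mul_sum, ← Finset.sum_fiberwise (s := Finset.univ) (g := ZMod.unitsMap hdvd)]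
    refine Finset.sum_congr rfl fun u _ => ?_
    rw [Finset.sum_congr rfl (g := fun _ => g u)]
    · rw [Finset.sum_const, hN u, hNp, nsmul_eq_mul]
    · intro x hx
      rw [(Finset.mem_filter.1 hx).2]

lemma gcd_aux (n : ℤ) (k : ℕ) (h : ¬ (p : ℤ) ∣ n) : Int.gcd n ((p ^ k : ℕ) : ℤ) = 1 := by
  rw [← Int.isCoprime_iff_gcd_eq_one]
  push_cast
  exact (IsCoprime.pow_left ((Prime.coprime_iff_not_dvd (Nat.prime_iff_prime_int.1 (Fact.out : p.Prime))).2 h)).symm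

lemma KS_pp {k : ℕ} (hk : 1 ≤ k) : ∀ {c : ℕ} [NeZero c] (_ : c = p ^ k) {ψ : AddChar (ZMod c) ℂ}
    (_ : ψ.IsPrimitive) (m n : ℤ), ‖KS ψ m n‖ ≤ 8 * √(c * Int.gcd n c) := by
  have hp := (Fact.out : p.Prime)
  have hpi := Nat.prime_iff_prime_int.1 hp
  induction k, hk using Nat.le_induction with
  | base =>
    intro c _ hc ψ hψ m n
    rw [pow_one] at hc
    subst hc
    by_cases hn : (c : ℤ) ∣ n
    · have h1 : Int.gcd n c = c := by
        zify; exact Int.gcd_eq_right (by positivity) hn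
      rw [h1, Real.sqrt_mul_self (by positivity)]
      have := KS_triv ψ m n
      have h0 : (0 : ℝ) ≤ c := by positivity
      linarith
    · have h1 : Int.gcd n c = 1 := by
        have := gcd_aux (p := c) n 1 hn
        simpa using this
      rw [h1]
      have hn0 : (n : ZMod c) ≠ 0 := by rwa [Ne, ZMod.intCast_zmod_eq_zero_iff_dvd]
      have hc1 : 1 ≤ √(c : ℝ) := Real.one_le_sqrt.2 (by exact_mod_cast hp.one_lt.le)
      have hψ1 : ψ ≠ 1 := by
        have := hψ (a := 1) one_ne_zero
        simpa using this
      by_cases hm : (m : ZMod c) = 0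
      · rw [KS]
        simp only [hm, zero_mul, zero_add]
        have h2 : ∑ x : (ZMod c)ˣ, ψ (n * (x⁻¹ : (ZMod c)ˣ)) = -1 := by
          rw [Fintype.sum_equiv (Equiv.inv _) (fun x : (ZMod c)ˣ => ψ (n * (x⁻¹ : (ZMod c)ˣ)))
            (fun x : (ZMod c)ˣ => ψ (n * x)) (fun x => rfl)]
          have h3 := sum_prim hψ (n : ZMod c)
          rw [if_neg hn0, ← Finset.add_sum_erase _ _ (Finset.mem_univ (0 : ZMod c))] at h3
          have h4 : ∑ x ∈ Finset.univ.erase (0 : ZMod c), ψ (n * x) = ∑ x : (ZMod c)ˣ, ψ (n * x) := by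
            symm
            refine Finset.sum_bij (fun x _ => (x : ZMod c)) ?_ ?_ ?_ ?_
            · intro x _; simp
            · intro x _ y _ h; exact Units.ext h
            · intro y hy
              exact ⟨Units.mk0 y (Finset.ne_of_mem_erase hy), Finset.mem_univ _, rfl⟩
            · intro x _; rfl
          rw [h4] at h3
          simp only [mul_zero, AddChar.map_zero_eq_one] at h3
          linear_combination h3
        rw [h2]
        simp only [norm_neg, norm_one, Nat.cast_one, mul_one]
        linarith
      · have := weil hψ1 hm hn0
        simp only [Nat.cast_one, mul_one]
        rw [KS]
        linarith
  | succ k hk ih =>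
    intro c _ hc ψ hψ m n
    by_cases hmn : (p : ℤ) ∣ m ∧ (p : ℤ) ∣ n
    · obtain ⟨⟨m', rfl⟩, ⟨n', rfl⟩⟩ := hmn
      obtain ⟨ψ', hψ', h⟩ := KS_red (c' := p ^ k) hk hc rfl hψ
      rw [h, norm_mul, Complex.norm_natCast]
      have h1 := ih rfl hψ' m' n'
      have h2 : Int.gcd (p * n') c = p * Int.gcd n' (p ^ k : ℕ) := by
        rw [hc, pow_succ']; push_cast; rw [Int.gcd_mul_left]; simp
      have h3 : √((c : ℝ) * Int.gcd (p * n') c) = p * √((p ^ k : ℕ) * Int.gcd n' (p ^ k : ℕ)) := by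
        rw [h2, hc, pow_succ']; push_cast
        rw [show (p : ℝ) * p ^ k * (p * (Int.gcd n' (p ^ k) : ℝ)) = p ^ 2 * (p ^ k * (Int.gcd n' (p ^ k) : ℝ)) by ring,
          Real.sqrt_mul (by positivity), Real.sqrt_sq (by positivity)]
      rw [h3]
      calc _ ≤ (p : ℝ) * _ := mul_le_mul_of_nonneg_left h1 (by positivity)
        _ = _ := by ring
    · -- s = p^(k+1-l)
      have hPc : (p : ZMod c) ^ (k + 1) = 0 := by
        rw [← Nat.cast_pow, ← hc]; exact ZMod.natCast_self _
      obtain ⟨l, hl⟩ : ∃ l, l = (k + 1) / 2 := ⟨_, rfl⟩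
      have hs : ((p : ZMod c) ^ (k + 1 - l)) ^ 2 = 0 := by
        rw [← pow_mul, show (k + 1 - l) * 2 = (k + 1) + ((k + 1 - l) * 2 - (k + 1)) by omega, pow_add, hPc, zero_mul]
      have h1 := KS_even hψ m n _ hs
      have h2 := count_le hc (l := l) (by omega) (by omega) m n hmn
      by_cases hn : (p : ℤ) ∣ n
      · rw [if_pos hn] at h2
        have h3 : ‖KS ψ m n‖ ≤ 0 := h1.trans (by exact_mod_cast h2)
        exact h3.trans (by positivity)
      rw [if_neg hn] at h2
      have hg : Int.gcd n c = 1 := by rw [hc]; exact gcd_aux n _ hn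
      have hcr : (c : ℝ) = (p : ℝ) ^ (k + 1) := by rw [hc]; push_cast; rfl
      rw [hg, Nat.cast_one, mul_one, hcr]
      have h2' : ((Finset.univ.filter (fun x : (ZMod c)ˣ =>
      (p : ZMod c) ^ (k + 1 - l) * (m * x - n * (x⁻¹ : (ZMod c)ˣ)) = 0)).card : ℝ) ≤ 4 * p ^ (k + 1 - l) := by
        exact_mod_cast h2
      by_cases hev : k + 1 = 2 * l
      · rw [hev, show (p : ℝ) ^ (2 * l) = (p ^ l) ^ 2 by rw [← pow_mul]; congr 1; omega, Real.sqrt_sq (by positivity)]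
        have : k + 1 - l = l := by omega
        rw [this] at h1 h2'
        have : (0 : ℝ) ≤ p ^ l := by positivity
        linarith
      · have hod : k + 1 = 2 * l + 1 := by omega
        rw [hod, pow_succ (p : ℝ) (2 * l), Real.sqrt_mul (by positivity),
          show (p : ℝ) ^ (2 * l) = (p ^ l) ^ 2 by rw [← pow_mul]; congr 1; omega, Real.sqrt_sq (by positivity)]
        have hkl : k + 1 - l = l + 1 := by omega
        rw [hkl] at h1 h2'
        have hpl : (0 : ℝ) ≤ p ^ l := by positivity
        by_cases hp2 : p = 2
        · have h4 : (1 : ℝ) ≤ √p := Real.one_le_sqrt.2 (by exact_mod_cast hp.one_lt.le)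
          rw [pow_succ (p : ℝ) l] at h2'
          have h5 : (p : ℝ) = 2 := by rw [hp2]; norm_num
          have h6 : (p : ℝ) ^ l * 1 ≤ p ^ l * √p := by gcongr
          have h7 : 4 * ((p : ℝ) ^ l * p) = 8 * (p ^ l * 1) := by rw [h5]; ring
          linarith
        · have h3 := (KS_odd (by rw [hc, hod]) (by omega) hp2 hψ m n hn).trans h2'
          have hpp : 0 < √(p : ℝ) := Real.sqrt_pos.2 (by exact_mod_cast hp.pos)
          have h4 : (p : ℝ) = √p * √p := (Real.mul_self_sqrt (by positivity)).symm
          refine le_of_mul_le_mul_right (h3.trans ?_) hpp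
          rw [pow_succ]
          have : 4 * ((p : ℝ) ^ l * p) = 4 * (p ^ l * √p * √p) := by rw [mul_assoc ((p : ℝ) ^ l), ← h4]
          rw [this]
          have h5 : 0 ≤ (p : ℝ) ^ l * √p * √p := by positivity
          linarith
end pp2

lemma KS_bound : ∀ (c : ℕ) [NeZero c] {ψ : AddChar (ZMod c) ℂ}
    (_ : ψ.IsPrimitive) (m n : ℤ), ‖KS ψ m n‖ ≤ (c.divisors.card : ℝ) ^ 3 * √(c * Int.gcd n c) := by
  intro c
  induction c using Nat.recOnPosPrimePosCoprime with
  | zero => intro h; exact absurd rfl h.out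
  | one =>
    intro _ ψ hψ m n
    have := KS_triv ψ m n
    simpa using this
  | prime_pow p k hp hk =>
    intro _ ψ hψ m n
    haveI := Fact.mk hp
    refine (KS_pp hk rfl hψ m n).trans ?_
    gcongr
    have : 2 ≤ (p ^ k).divisors.card := by
      rw [Nat.divisors_prime_pow hp, Finset.card_map, Finset.card_range]; omega
    calc (8 : ℝ) = 2 ^ 3 := by norm_num
      _ ≤ _ := by gcongr; exact_mod_cast this
  | coprime a b ha hb hab iha ihb =>
    intro _ ψ hψ m n
    haveI : NeZero a := ⟨by omega⟩
    haveI : NeZero b := ⟨by omega⟩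
    obtain ⟨ψ₁, ψ₂, h1, h2, h⟩ := KS_mul hab hψ
    rw [h, norm_mul]
    refine (mul_le_mul (iha h1 m n) (ihb h2 m n) (norm_nonneg _) (by positivity)).trans_eq ?_
    rw [hab.card_divisors_mul]
    have : Int.gcd n ((a * b : ℕ) : ℤ) = Int.gcd n a * Int.gcd n b := by
      simp only [Int.gcd, Int.natAbs_natCast]
      exact Nat.Coprime.gcd_mul _ hab
    rw [this]
    push_cast
    rw [show (a : ℝ) * b * (Int.gcd n a * Int.gcd n b) = (a * Int.gcd n a) * (b * Int.gcd n b) by ring,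
      Real.sqrt_mul (x := (a : ℝ) * Int.gcd n a) (by positivity)]
    ring

end HES


namespace HES

lemma tau_bound {ε : ℝ} (hε : 0 < ε) : ∃ C : ℝ, 1 ≤ C ∧ ∀ n : ℕ, 1 ≤ n →
    (n.divisors.card : ℝ) ≤ C * (n : ℝ) ^ ε := by
  set C0 : ℝ := 1 + 1 / (ε * Real.log 2) with hC0
  have hl2 : 0 < Real.log 2 := Real.log_pos (by norm_num)
  have hC1 : 1 ≤ C0 := by rw [hC0]; have : 0 < 1 / (ε * Real.log 2) := by positivity
                          linarith
  set P : ℕ := ⌈(2 : ℝ) ^ (1 / ε)⌉₊ with hP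
  refine ⟨C0 ^ P, one_le_pow₀ hC1, fun n hn => ?_⟩
  have hn0 : n ≠ 0 := by omega
  have h1 : (n : ℝ) ^ ε = ∏ p ∈ n.primeFactors, ((p : ℝ) ^ ε) ^ (n.factorization p) := by
    conv_lhs => rw [← Nat.prod_factorization_pow_eq_self hn0]
    rw [Finsupp.prod, Nat.cast_prod, ← Real.finsetProd_rpow _ _ (by intro i _; positivity)]
    refine Finset.prod_congr rfl fun p _ => ?_
    push_cast
    rw [← Real.rpow_natCast, ← Real.rpow_mul (by positivity), mul_comm, Real.rpow_mul (by positivity), Real.rpow_natCast]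
  have h2 : ∀ p ∈ n.primeFactors, ((n.factorization p + 1 : ℕ) : ℝ) ≤
      (if p < P then C0 else 1) * ((p : ℝ) ^ ε) ^ (n.factorization p) := by
    intro p hp
    have hpp := Nat.prime_of_mem_primeFactors hp
    have hp2 : (2 : ℝ) ≤ p := by exact_mod_cast hpp.two_le
    set v := n.factorization p
    split_ifs with h
    · have h3 : 1 + v * (ε * Real.log 2) ≤ ((p : ℝ) ^ ε) ^ v := by
        have h4 : ((2 : ℝ) ^ ε) ^ v ≤ ((p : ℝ) ^ ε) ^ v := by gcongr
        refine le_trans ?_ h4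
        rw [Real.rpow_def_of_pos (by norm_num), ← Real.exp_nat_mul]
        have := Real.add_one_le_exp ((v : ℝ) * (Real.log 2 * ε))
        linarith
      have h5 : C0 * (1 + v * (ε * Real.log 2)) = C0 + v * (ε * Real.log 2) + v := by
        rw [hC0]; field_simp; ring
      have h6 := mul_le_mul_of_nonneg_left h3 (by linarith : 0 ≤ C0)
      have h7 : 0 ≤ (v : ℝ) * (ε * Real.log 2) := by positivity
      push_cast
      linarith
    · have h3 : 2 ≤ (p : ℝ) ^ ε := by
        have h4 : (2 : ℝ) ^ (1 / ε) ≤ p := (Nat.le_ceil _).trans (by exact_mod_cast not_lt.1 h)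
        calc (2 : ℝ) = ((2 : ℝ) ^ (1 / ε)) ^ ε := by
              rw [← Real.rpow_mul (by norm_num), one_div_mul_cancel hε.ne', Real.rpow_one]
          _ ≤ _ := by gcongr
      rw [one_mul]
      calc ((v + 1 : ℕ) : ℝ) ≤ ((2 ^ v : ℕ) : ℝ) := by exact_mod_cast Nat.lt_two_pow_self
        _ = 2 ^ v := by push_cast; rfl
        _ ≤ _ := by gcongr
  rw [Nat.card_divisors hn0, h1]
  push_cast
  push_cast at h2
  refine (Finset.prod_le_prod (fun p _ => by positivity) h2).trans ?_
  rw [Finset.prod_mul_distrib]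
  gcongr
  rw [← Finset.prod_filter, Finset.prod_const]
  refine pow_le_pow_right₀ hC1 ?_
  calc _ ≤ (Finset.range P).card := Finset.card_le_card (by
        intro p hp; rw [Finset.mem_filter] at hp; simpa using hp.2)
    _ = P := by simp

end HES


namespace HES
open UpperHalfPlane
open scoped MatrixGroups

lemma norm_exp_term (n : ℕ) (z : ℂ) :
    ‖Complex.exp (2 * Real.pi * Complex.I * (n + 1) * z)‖ = Real.exp (-2 * Real.pi * (n + 1) * z.im) := by
  rw [Complex.norm_exp]
  congr 1
  have : (2 * Real.pi * Complex.I * (n + 1) * z : ℂ) = ((2 * Real.pi * (n + 1) : ℝ) : ℂ) * (Complex.I * z) := by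
    push_cast; ring
  rw [this, Complex.re_ofReal_mul]
  simp

/-- package of facts -/
lemma eigen_pkg {k : ℕ} {a : ℕ → ℂ} (h : IsNormalizedHeckeEigenform k a) :
    ∃ F : ℍ → ℂ, (∀ y : ℝ, 0 < y → Summable (fun n : ℕ => ‖a (n + 1)‖ * Real.exp (-2 * Real.pi * (n + 1) * y))) ∧
      (∀ z : ℍ, F z = ∑' n : ℕ, a (n + 1) * Complex.exp (2 * Real.pi * Complex.I * (n + 1) * (z : ℂ))) ∧
      (∀ (γ : SL(2, ℤ)) (z : ℍ), F (γ • z) = (denom γ z) ^ (k : ℤ) * F z) ∧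
      (∃ C : ℝ, ∀ z : ℍ, ‖F z‖ ≤ C / z.im ^ (k / 2 : ℝ)) := by
  obtain ⟨hk, hk12, ⟨F, hF0, hF⟩, -⟩ := h
  have hmod : ∀ (γ : SL(2, ℤ)) (z : ℍ), F (γ • z) = (denom γ z) ^ (k : ℤ) * F z := by
    intro γ z
    exact SlashInvariantForm.slash_action_eqn_SL'' F (CongruenceSubgroup.mem_Gamma_one γ) z
  refine ⟨F, ?_, hF, hmod, ?_⟩
  · by_contra hcon
    push Not at hcon
    obtain ⟨y0, hy0, hns⟩ := hcon
    have hz : ∀ z : ℍ, z.im ≤ y0 → F z = 0 := by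
      intro z hz
      rw [hF z]
      apply tsum_eq_zero_of_not_summable
      intro hs
      apply hns
      refine Summable.of_nonneg_of_le (fun n => by positivity) (fun n => ?_) hs.norm
      rw [norm_mul, norm_exp_term]
      refine mul_le_mul_of_nonneg_left (Real.exp_le_exp.2 ?_) (norm_nonneg _)
      have h1 : (0 : ℝ) < 2 * Real.pi * (n + 1) := by positivity
      have : (2 * Real.pi * (n + 1)) * z.im ≤ (2 * Real.pi * (n + 1)) * y0 := by gcongr
      change -2 * Real.pi * (n + 1) * y0 ≤ -2 * Real.pi * (n + 1) * z.im
      linarith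
    apply hF0
    ext z
    obtain ⟨N, hN⟩ : ∃ N : ℕ, z.im / y0 ≤ (z.re + N) ^ 2 := by
      obtain ⟨N, hN⟩ := exists_nat_ge (z.im / y0 + 1 + |z.re|)
      refine ⟨N, ?_⟩
      have h2 := neg_abs_le z.re
      have h3 : 0 < z.im / y0 := div_pos z.im_pos hy0
      nlinarith
    have h1 := hmod (ModularGroup.S * ModularGroup.T ^ N) z
    have him : ((ModularGroup.S * ModularGroup.T ^ N) • z).im ≤ y0 := by
      rw [mul_smul, ModularGroup.im_smul_eq_div_normSq, ModularGroup.denom_S]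
      have h4 : (ModularGroup.T ^ N • z : ℍ).im = z.im := by
        have := ModularGroup.im_T_zpow_smul z N
        simpa using this
      rw [h4]
      have h2 : z.im ≤ y0 * (z.re + N) ^ 2 := by
        rw [div_le_iff₀ hy0] at hN; linarith
      rw [div_le_iff₀ (Complex.normSq_pos.2 (ne_zero _))]
      refine h2.trans ?_
      rw [Complex.normSq_apply]
      have h3 : ((ModularGroup.T ^ N • z : ℍ) : ℂ).re = z.re + N := by
        have := ModularGroup.re_T_zpow_smul z N
        simpa using this
      rw [h3]
      nlinarith [mul_self_nonneg ((ModularGroup.T ^ N • z : ℍ) : ℂ).im]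
    rw [hz _ him] at h1
    rcases mul_eq_zero.1 h1.symm with h2 | h2
    · exact absurd h2 (zpow_ne_zero _ (denom_ne_zero _ _))
    · simpa using h2
  · have := CuspFormClass.exists_bound (k := (k : ℤ)) F
    simpa using this

end HES


namespace HES
open UpperHalfPlane
open scoped MatrixGroups

section bessel
open MeasureTheory AddCircle

lemma bessel_circle (c : ℕ → ℂ) (hs : Summable (fun n => ‖c n‖)) (M : ℝ)
    (hM : ∀ x : ℝ, ‖∑' n, c n * Complex.exp (2 * Real.pi * Complex.I * (n + 1) * x)‖ ≤ M) (s : Finset ℕ) :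
    ∑ n ∈ s, ‖c n‖ ^ 2 ≤ M ^ 2 := by
  haveI : Fact ((0 : ℝ) < 1) := ⟨one_pos⟩
  have hM0 : 0 ≤ M := (norm_nonneg _).trans (hM 0)
  let e : ℕ → C(AddCircle (1 : ℝ), ℂ) := fun n => fourier (n + 1)
  have hsum : Summable (fun n => c n • e n) := by
    refine Summable.of_norm ?_
    refine hs.congr fun n => ?_
    rw [norm_smul, fourier_norm, mul_one]
  obtain ⟨g, hg⟩ := hsum
  have hgM : ‖g‖ ≤ M := by
    rw [ContinuousMap.norm_le _ hM0]
    intro x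
    induction x using QuotientAddGroup.induction_on with
    | H x =>
      have h1 := (ContinuousMap.evalCLM ℂ (x : AddCircle (1 : ℝ))).hasSum hg
      have h2 := hM x
      have h3 : ∑' n, c n * Complex.exp (2 * Real.pi * Complex.I * (n + 1) * x) = g (x : AddCircle (1 : ℝ)) := by
        rw [← ContinuousMap.evalCLM_apply ℂ, ← h1.tsum_eq]
        refine tsum_congr fun n => ?_
        simp only [e, ContinuousMap.evalCLM_apply, ContinuousMap.smul_apply, fourier_coe_apply, smul_eq_mul]
        push_cast
        simp
      rw [h3] at h2
      exact h2
  let T := ContinuousMap.toLp (E := ℂ) 2 (haarAddCircle (T := (1 : ℝ))) ℂ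
  have hT : ‖T g‖ ≤ M := by
    have h1 : ‖T‖ ≤ 1 := by
      have := ContinuousMap.toLp_norm_le (p := 2) (𝕜 := ℂ) (E := ℂ) (haarAddCircle (T := (1 : ℝ)))
      simpa [measureUnivNNReal] using this
    calc _ ≤ ‖T‖ * ‖g‖ := T.le_opNorm g
      _ ≤ 1 * M := by gcongr
      _ = M := one_mul _
  have hort : Orthonormal ℂ (fun n : ℕ => fourierLp (T := (1 : ℝ)) 2 ((n : ℤ) + 1)) :=
    orthonormal_fourier.comp (fun n : ℕ => (n : ℤ) + 1) (fun a b h => by simpa using h)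
  have hTg := T.hasSum hg
  have hin : ∀ n : ℕ, inner ℂ (fourierLp (T := (1 : ℝ)) 2 ((n : ℤ) + 1)) (T g) = c n := by
    intro n
    have h1 := (innerSL ℂ (fourierLp (T := (1 : ℝ)) 2 ((n : ℤ) + 1))).hasSum hTg
    refine h1.unique ?_
    have h2 : ∀ m, innerSL ℂ (fourierLp (T := (1 : ℝ)) 2 ((n : ℤ) + 1)) (T (c m • e m)) = if m = n then c n else 0 := by
      intro m
      rw [map_smul, map_smul]
      have h3 : T (e m) = fourierLp (T := (1 : ℝ)) 2 ((m : ℤ) + 1) := rfl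
      rw [h3, innerSL_apply_apply]
      have h4 := orthonormal_iff_ite.1 hort n m
      rw [h4]
      by_cases hmn : m = n
      · subst hmn; simp
      · simp [hmn, Ne.symm hmn]
    simp_rw [h2]
    exact hasSum_ite_eq n (c n)
  calc _ = ∑ n ∈ s, ‖inner ℂ (fourierLp (T := (1 : ℝ)) 2 ((n : ℤ) + 1)) (T g)‖ ^ 2 := by
        refine Finset.sum_congr rfl fun n _ => ?_
        rw [hin]
    _ ≤ ‖T g‖ ^ 2 := hort.sum_inner_products_le _
    _ ≤ M ^ 2 := by gcongr
end bessel

end HES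


namespace HES
open UpperHalfPlane
open scoped MatrixGroups

/-- eigenvalues on naturals -/
noncomputable def lam (k : ℕ) (a : ℕ → ℂ) (n : ℕ) : ℂ := heckeLambda k a (n : ℤ)

lemma lam_zero (k : ℕ) (a : ℕ → ℂ) : lam k a 0 = 0 := by simp [lam, heckeLambda]

lemma lam_pos (k : ℕ) (a : ℕ → ℂ) {n : ℕ} (hn : 1 ≤ n) :
    lam k a n = a n * ((n : ℝ) ^ (-(((k : ℝ) - 1) / 2)) : ℝ) := by
  rw [lam, heckeLambda, if_pos (by exact_mod_cast hn)]
  simp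

lemma norm_a (k : ℕ) (a : ℕ → ℂ) {n : ℕ} (hn : 1 ≤ n) :
    ‖a n‖ = ‖lam k a n‖ * (n : ℝ) ^ (((k : ℝ) - 1) / 2) := by
  have hn' : (0 : ℝ) < n := by exact_mod_cast hn
  rw [lam_pos k a hn, norm_mul, Complex.norm_real, Real.norm_of_nonneg (by positivity), mul_assoc,
    ← Real.rpow_add hn']
  simp

lemma norm_a_sq (k : ℕ) (a : ℕ → ℂ) (hk : 1 ≤ k) {n : ℕ} (hn : 1 ≤ n) :
    ‖a n‖ ^ 2 = ‖lam k a n‖ ^ 2 * (n : ℝ) ^ (k - 1) := by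
  have hn' : (0 : ℝ) < n := by exact_mod_cast hn
  rw [norm_a k a hn, mul_pow, ← Real.rpow_natCast (_ ^ _) 2, ← Real.rpow_mul hn'.le, ← Real.rpow_natCast (n : ℝ) (k - 1)]
  rw [Nat.cast_sub hk]
  push_cast
  rw [div_mul_cancel₀ _ (two_ne_zero)]

variable {k : ℕ} {a : ℕ → ℂ}

lemma lam_hecke (h : IsNormalizedHeckeEigenform k a) {m n : ℕ} (hm : 1 ≤ m) (hn : 1 ≤ n) :
    lam k a m * lam k a n = ∑ d ∈ (Nat.gcd m n).divisors, lam k a (m * n / d ^ 2) := by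
  obtain ⟨-, hk12, -, -, hH⟩ := h
  have h1 := hH m n hm hn
  rw [lam_pos k a hm, lam_pos k a hn, mul_mul_mul_comm, h1, Finset.sum_mul]
  refine Finset.sum_congr rfl fun d hd => ?_
  have hdg := Nat.dvd_of_mem_divisors hd
  have hd0 : 0 < d := Nat.pos_of_mem_divisors hd
  obtain ⟨m', rfl⟩ := hdg.trans (Nat.gcd_dvd_left m n)
  obtain ⟨n', rfl⟩ := hdg.trans (Nat.gcd_dvd_right _ n)
  have hm' : 1 ≤ m' := Nat.pos_of_mul_pos_left hm
  have hn' : 1 ≤ n' := Nat.pos_of_mul_pos_left hn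
  have h2 : d * m' * (d * n') / d ^ 2 = m' * n' := by
    rw [show d * m' * (d * n') = m' * n' * d ^ 2 by ring]
    exact Nat.mul_div_cancel _ (by positivity)
  rw [h2, lam_pos k a (Nat.mul_pos hm' hn')]
  have e1 : (0 : ℝ) < d := by exact_mod_cast hd0
  have e2 : (0 : ℝ) < m' := by exact_mod_cast hm'
  have e3 : (0 : ℝ) < n' := by exact_mod_cast hn'
  have h3 : (d : ℝ) ^ (k - 1) * (((d * m' : ℕ) : ℝ) ^ (-(((k : ℝ) - 1) / 2)) * ((d * n' : ℕ) : ℝ) ^ (-(((k : ℝ) - 1) / 2))) =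
      ((m' * n' : ℕ) : ℝ) ^ (-(((k : ℝ) - 1) / 2)) := by
    push_cast
    rw [← Real.mul_rpow (by positivity) (by positivity), show (d : ℝ) * m' * (d * n') = d ^ 2 * (m' * n') by ring,
      Real.mul_rpow (by positivity) (by positivity), ← mul_assoc, ← Real.rpow_natCast, ← Real.rpow_natCast, ← Real.rpow_mul e1.le,
      ← Real.rpow_add e1]
    push_cast [Nat.cast_sub (by omega : 1 ≤ k)]
    rw [show ((k : ℝ) - 1 + 2 * -((k - 1) / 2)) = 0 by ring, Real.rpow_zero, one_mul]
  rw [← h3]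
  push_cast
  ring

lemma meansq {F : ℍ → ℂ} (hs : ∀ y : ℝ, 0 < y → Summable (fun n : ℕ => ‖a (n + 1)‖ * Real.exp (-2 * Real.pi * (n + 1) * y)))
    (hF : ∀ z : ℍ, F z = ∑' n : ℕ, a (n + 1) * Complex.exp (2 * Real.pi * Complex.I * (n + 1) * (z : ℂ)))
    {y M : ℝ} (hy : 0 < y) (hM : ∀ z : ℍ, z.im = y → ‖F z‖ ≤ M) (s : Finset ℕ) :
    ∑ n ∈ s, ‖a (n + 1)‖ ^ 2 * Real.exp (-4 * Real.pi * (n + 1) * y) ≤ M ^ 2 := by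
  have h1 := bessel_circle (fun n => a (n + 1) * Complex.exp (2 * Real.pi * Complex.I * (n + 1) * (Complex.I * y)))
    (by
      refine (hs y hy).congr fun n => ?_
      rw [norm_mul, norm_exp_term]; simp) M (by
      intro x
      have h2 := hM ⟨x + Complex.I * y, by simpa using hy⟩ (by simp [UpperHalfPlane.im])
      rw [hF] at h2
      convert h2 using 3
      ext n
      rw [mul_assoc, ← Complex.exp_add]
      congr 2
      simp only [UpperHalfPlane.coe_mk]
      ring) s
  refine le_trans (Finset.sum_le_sum fun n _ => ?_) h1
  rw [norm_mul, norm_exp_term, mul_pow, ← Real.exp_nat_mul]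
  refine le_of_eq ?_
  congr 2
  simp
  ring

lemma sum_inv_sq (n : ℕ) : ∑ d ∈ Finset.Icc 1 n, (1 : ℝ) / d ^ 2 ≤ 2 := by
  have h : ∀ n : ℕ, 1 ≤ n → ∑ d ∈ Finset.Icc 1 n, (1 : ℝ) / d ^ 2 ≤ 2 - 1 / n := by
    intro n hn
    induction n, hn using Nat.le_induction with
    | base => norm_num
    | succ n hn ih =>
      rw [Finset.sum_Icc_succ_top (by omega)]
      have h1 : (0 : ℝ) < n := by exact_mod_cast hn
      have h2 : (1 : ℝ) / ((n + 1 : ℕ) : ℝ) ^ 2 ≤ 1 / n - 1 / (n + 1 : ℕ) := by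
        push_cast
        rw [div_sub_div _ _ h1.ne' (by positivity), div_le_div_iff₀ (by positivity) (by positivity)]
        nlinarith
      linarith
  rcases Nat.eq_zero_or_pos n with rfl | hn
  · simp
  · have := h n hn
    have : (0 : ℝ) ≤ 1 / n := by positivity
    linarith [h n hn]

lemma lam_le (h : IsNormalizedHeckeEigenform k a) (n : ℕ) : ‖lam k a n‖ ≤ 2 * n := by
  have hh := h
  obtain ⟨F, hs, hF, -, C, hC⟩ := eigen_pkg h
  have hk12 := h.2.1
  -- crude bound
  obtain ⟨K, hK⟩ : ∃ K : ℝ, ∀ n : ℕ, 1 ≤ n → ‖lam k a n‖ ≤ K * n := by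
    refine ⟨|C| * Real.exp (2 * Real.pi), fun n hn => ?_⟩
    obtain ⟨n, rfl⟩ : ∃ m, n = m + 1 := ⟨n - 1, by omega⟩
    have hn' : (0 : ℝ) < (n + 1 : ℕ) := by positivity
    have h1 := meansq hs hF (y := 1 / (n + 1 : ℕ)) (M := |C| * ((n + 1 : ℕ) : ℝ) ^ (k / 2 : ℝ)) (by positivity) (by
      intro z hz
      refine (hC z).trans ?_
      rw [hz, Real.div_rpow (by norm_num) hn'.le, Real.one_rpow, div_div_eq_mul_div, div_one]
      gcongr
      exact le_abs_self C) {n}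
    rw [Finset.sum_singleton] at h1
    have h2 : -4 * Real.pi * ((n : ℝ) + 1) * (1 / (n + 1 : ℕ)) = 2 * (-(2 * Real.pi)) := by
      push_cast; field_simp; ring
    rw [h2] at h1
    have h3 : Real.exp (2 * (-(2 * Real.pi))) = Real.exp (-(2 * Real.pi)) ^ 2 := by
      rw [← Real.exp_nat_mul]; norm_num
    rw [h3, ← mul_pow] at h1
    have h4 := abs_le_of_sq_le_sq h1 (by positivity)
    rw [abs_of_nonneg (by positivity), norm_a k a (by omega)] at h4
    have h5 : ((n + 1 : ℕ) : ℝ) ^ (k / 2 : ℝ) ≤ ((n + 1 : ℕ) : ℝ) ^ (((k : ℝ) - 1) / 2) * (n + 1 : ℕ) := by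
      nth_rewrite 3 [← Real.rpow_one ((n + 1 : ℕ) : ℝ)]
      rw [← Real.rpow_add hn']
      exact Real.rpow_le_rpow_of_exponent_le (by push_cast; linarith [(n.cast_nonneg : (0 : ℝ) ≤ n)]) (by linarith)
    set q := ((n + 1 : ℕ) : ℝ) ^ (((k : ℝ) - 1) / 2)
    have hq : 0 < q := by positivity
    have h6 : ‖lam k a (n + 1)‖ * (q * Real.exp (-(2 * Real.pi))) ≤ (|C| * Real.exp (2 * Real.pi) * (n + 1 : ℕ)) * (q * Real.exp (-(2 * Real.pi))) := by
      calc _ ≤ |C| * (q * (n + 1 : ℕ)) := by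
            rw [← mul_assoc]; exact h4.trans (by gcongr)
        _ = _ := by rw [Real.exp_neg]; field_simp
    exact le_of_mul_le_mul_right h6 (by positivity)
  -- sup
  set S : Set ℝ := Set.range (fun n : ℕ => ‖lam k a (n + 1)‖ / (n + 1 : ℕ)) with hS
  have hbdd : BddAbove S := by
    refine ⟨K, ?_⟩
    rintro _ ⟨n, rfl⟩
    exact (div_le_iff₀ (by positivity)).2 (hK (n + 1) (by omega))
  set C' := sSup S with hC'
  have hle : ∀ n : ℕ, 1 ≤ n → ‖lam k a n‖ ≤ C' * n := by
    intro n hn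
    obtain ⟨n, rfl⟩ : ∃ m, n = m + 1 := ⟨n - 1, by omega⟩
    rw [← div_le_iff₀ (by positivity)]
    exact le_csSup hbdd ⟨n, rfl⟩
  have hC0 : 0 ≤ C' := by
    have := hle 1 le_rfl
    have h2 := norm_nonneg (lam k a 1)
    simp at this; linarith
  have hsq : ∀ n : ℕ, 1 ≤ n → ‖lam k a n‖ ^ 2 ≤ 2 * C' * n ^ 2 := by
    intro n hn
    have h1 := lam_hecke hh hn hn
    rw [← norm_pow, sq, h1, Nat.gcd_self]
    calc _ ≤ ∑ d ∈ n.divisors, ‖lam k a (n * n / d ^ 2)‖ := norm_sum_le _ _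
      _ ≤ ∑ d ∈ n.divisors, C' * n ^ 2 * (1 / d ^ 2) := by
          refine Finset.sum_le_sum fun d hd => ?_
          have hdn := Nat.dvd_of_mem_divisors hd
          have hd0 := Nat.pos_of_mem_divisors hd
          have hdd : d ^ 2 ∣ n * n := by rw [← sq]; exact pow_dvd_pow_of_dvd hdn 2
          refine (hle _ (Nat.div_pos (Nat.le_of_dvd (by positivity) hdd) (by positivity))).trans_eq ?_
          rw [Nat.cast_div hdd (by positivity)]
          push_cast; ring
      _ ≤ ∑ d ∈ Finset.Icc 1 n, C' * n ^ 2 * (1 / d ^ 2) := by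
          refine Finset.sum_le_sum_of_subset_of_nonneg ?_ (fun _ _ _ => by positivity)
          intro d hd
          rw [Finset.mem_Icc]
          exact ⟨Nat.pos_of_mem_divisors hd, Nat.divisor_le hd⟩
      _ ≤ C' * n ^ 2 * 2 := by
          rw [← Finset.mul_sum]; gcongr; exact sum_inv_sq n
      _ = _ := by ring
  have hC2 : C' ≤ √(2 * C') := by
    refine csSup_le (Set.range_nonempty _) ?_
    rintro _ ⟨n, rfl⟩
    refine Real.le_sqrt_of_sq_le ?_
    rw [div_pow, div_le_iff₀ (by positivity)]
    exact hsq (n + 1) (by omega)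
  have hC3 : C' ≤ 2 := by
    have h1 := (Real.le_sqrt hC0 (by positivity)).1 hC2
    by_contra hcon
    push Not at hcon
    nlinarith
  rcases Nat.eq_zero_or_pos n with rfl | hn
  · simp [lam_zero]
  · exact (hle n hn).trans (by gcongr)

end HES


namespace HES
open UpperHalfPlane
open scoped MatrixGroups
variable {k : ℕ} {a : ℕ → ℂ}

lemma pow_exp_le (s : ℕ) (hs : 1 ≤ s) {u : ℝ} (hu : 0 ≤ u) :
    u ^ s * Real.exp (-(2 * Real.pi * u)) ≤ (s / (2 * Real.pi * Real.exp 1)) ^ s := by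
  have hs' : (0 : ℝ) < s := by exact_mod_cast hs
  have hpi := Real.pi_pos
  have h1 := Real.add_one_le_exp (2 * Real.pi * u / s - 1)
  rw [sub_add_cancel] at h1
  have h2 : (2 * Real.pi * u / s) ^ s ≤ Real.exp (2 * Real.pi * u / s - 1) ^ s := by gcongr
  rw [← Real.exp_nat_mul] at h2
  have h3 : (s : ℝ) * (2 * Real.pi * u / s - 1) = 2 * Real.pi * u + -(s * 1) := by field_simp; ring
  rw [h3, Real.exp_add, Real.exp_neg, Real.exp_nat_mul] at h2
  rw [Real.exp_neg]
  have h4 : u ^ s = (2 * Real.pi * u / s) ^ s * (s / (2 * Real.pi)) ^ s := by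
    rw [← mul_pow]; congr 1; field_simp
  rw [h4, div_mul_eq_div_div (s : ℝ) (2 * Real.pi) (Real.exp 1), div_pow _ (Real.exp 1)]
  have h5 : 0 < Real.exp (2 * Real.pi * u) := Real.exp_pos _
  have h6 : 0 < Real.exp 1 ^ s := by positivity
  calc _ ≤ (Real.exp (2 * Real.pi * u) * (Real.exp 1 ^ s)⁻¹) * (s / (2 * Real.pi)) ^ s * (Real.exp (2 * Real.pi * u))⁻¹ := by gcongr
    _ = _ := by field_simp

lemma sup_bound (h : IsNormalizedHeckeEigenform k a) {κ : ℕ} (hκ : k = 2 * κ) {F : ℍ → ℂ}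
    (hs : ∀ y : ℝ, 0 < y → Summable (fun n : ℕ => ‖a (n + 1)‖ * Real.exp (-2 * Real.pi * (n + 1) * y)))
    (hF : ∀ z : ℍ, F z = ∑' n : ℕ, a (n + 1) * Complex.exp (2 * Real.pi * Complex.I * (n + 1) * (z : ℂ)))
    (hmod : ∀ (γ : SL(2, ℤ)) (z : ℍ), F (γ • z) = (denom γ z) ^ (k : ℤ) * F z) (z : ℍ) :
    ‖F z‖ * z.im ^ κ ≤ 8 * (((κ + 3 : ℕ) : ℝ) / (2 * Real.pi * Real.exp 1)) ^ (κ + 3) := by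
  set B := (((κ + 3 : ℕ) : ℝ) / (2 * Real.pi * Real.exp 1)) ^ (κ + 3) with hB
  have hB0 : 0 ≤ B := by positivity
  have key : ∀ z : ℍ, 3 ≤ 4 * z.im ^ 2 → ‖F z‖ * z.im ^ κ ≤ 8 * B := by
    intro z hz
    have hy := z.im_pos
    set y := z.im with hyd
    have hy3 : 1 ≤ 2 * y ^ 3 := by
      have : (17 : ℝ) / 20 ≤ y := by
        by_contra hc; push Not at hc; nlinarith
      have h2 : y ^ 3 = y * y ^ 2 := by ring
      rw [h2]; nlinarith
    have hterm : ∀ n : ℕ, ‖a (n + 1)‖ * Real.exp (-2 * Real.pi * (n + 1) * y) * y ^ κ ≤ 4 * B * (1 / ((n + 1 : ℕ) : ℝ) ^ 2) := by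
      intro n
      have hN1 : (1 : ℝ) ≤ (n + 1 : ℕ) := by push_cast; linarith [(n.cast_nonneg : (0 : ℝ) ≤ n)]
      have hN : (0 : ℝ) < (n + 1 : ℕ) := by positivity
      have h1 : ‖a (n + 1)‖ ≤ 2 * ((n + 1 : ℕ) : ℝ) ^ (κ + 1) := by
        rw [norm_a k a (by omega : 1 ≤ n + 1)]
        have h2 : ((n + 1 : ℕ) : ℝ) ^ (((k : ℝ) - 1) / 2) ≤ ((n + 1 : ℕ) : ℝ) ^ κ := by
          rw [← Real.rpow_natCast]
          refine Real.rpow_le_rpow_of_exponent_le hN1 ?_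
          rw [hκ]; push_cast; linarith
        calc _ ≤ (2 * ((n + 1 : ℕ) : ℝ)) * ((n + 1 : ℕ) : ℝ) ^ κ := by
              gcongr
              exact lam_le h _
          _ = _ := by ring
      have h3 := pow_exp_le (κ + 3) (by omega) (u := (n + 1 : ℕ) * y) (by positivity)
      rw [← hB] at h3
      have h4 : -2 * Real.pi * ((n : ℝ) + 1) * y = -(2 * Real.pi * ((n + 1 : ℕ) * y)) := by push_cast; ring
      rw [h4]
      set E := Real.exp (-(2 * Real.pi * ((n + 1 : ℕ) * y)))
      have hE : 0 < E := Real.exp_pos _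
      set N : ℝ := ((n + 1 : ℕ) : ℝ)
      calc _ ≤ 2 * N ^ (κ + 1) * E * y ^ κ := by gcongr
        _ = 2 * ((N * y) ^ (κ + 3) * E) * (1 / N ^ 2) * (1 / y ^ 3) := by field_simp; ring
        _ ≤ 2 * B * (1 / N ^ 2) * 2 := by
            gcongr
            rw [div_le_iff₀ (by positivity)]; exact hy3
        _ = _ := by ring
    rw [hF z]
    have hsum : Summable (fun n : ℕ => ‖a (n + 1) * Complex.exp (2 * Real.pi * Complex.I * (n + 1) * (z : ℂ))‖) := by
      refine (hs y hy).congr fun n => ?_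
      rw [norm_mul, norm_exp_term]; rfl
    have h1 : ‖∑' n : ℕ, a (n + 1) * Complex.exp (2 * Real.pi * Complex.I * (n + 1) * (z : ℂ))‖ ≤
        ∑' n : ℕ, ‖a (n + 1)‖ * Real.exp (-2 * Real.pi * (n + 1) * y) := by
      refine (norm_tsum_le_tsum_norm hsum).trans_eq ?_
      refine tsum_congr fun n => ?_
      rw [norm_mul, norm_exp_term]; rfl
    calc _ ≤ (∑' n : ℕ, ‖a (n + 1)‖ * Real.exp (-2 * Real.pi * (n + 1) * y)) * y ^ κ := by gcongr
      _ = ∑' n : ℕ, ‖a (n + 1)‖ * Real.exp (-2 * Real.pi * (n + 1) * y) * y ^ κ := by rw [tsum_mul_right]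
      _ ≤ 8 * B := by
          refine Real.tsum_le_of_sum_range_le (fun n => by positivity) fun n => ?_
          calc _ ≤ ∑ i ∈ Finset.range n, 4 * B * (1 / ((i + 1 : ℕ) : ℝ) ^ 2) := Finset.sum_le_sum fun i _ => hterm i
            _ = 4 * B * ∑ i ∈ Finset.Icc 1 n, (1 : ℝ) / i ^ 2 := by
                rw [← Finset.mul_sum, Finset.range_eq_Ico, Finset.sum_Ico_add' (fun i : ℕ => (1 : ℝ) / (i : ℝ) ^ 2) 0 n 1]
                rfl
            _ ≤ 4 * B * 2 := by gcongr; exact sum_inv_sq n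
            _ = _ := by ring
  obtain ⟨g, hg⟩ := ModularGroup.exists_smul_mem_fd z
  have h1 := key _ (ModularGroup.three_le_four_mul_im_sq_of_mem_fd hg)
  have hd : 0 < ‖denom g z‖ := norm_pos_iff.2 (denom_ne_zero _ _)
  rw [hmod, norm_mul, norm_zpow, ModularGroup.im_smul_eq_div_normSq, Complex.normSq_eq_norm_sq, div_pow, ← pow_mul, ← hκ,
    zpow_natCast] at h1
  convert h1 using 1
  field_simp

lemma window (h : IsNormalizedHeckeEigenform k a) (L : ℕ) (hL : 1 ≤ L) (s : Finset ℕ)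
    (hs : ∀ n ∈ s, L ≤ n ∧ k * n ≤ (k + 1) * L) :
    ∑ n ∈ s, ‖lam k a n‖ ^ 2 ≤ 64 * Real.exp 7 * (k : ℝ) ^ 6 * L := by
  obtain ⟨F, hsm, hF, hmod, -⟩ := eigen_pkg h
  obtain ⟨κ, hκ⟩ := h.1
  replace hκ : k = 2 * κ := by omega
  have hk12 := h.2.1
  have hκ0 : (0 : ℝ) < κ := by exact_mod_cast (by omega : 0 < κ)
  have hL0 : (0 : ℝ) < L := by exact_mod_cast hL
  have hpi := Real.pi_pos
  set B := (((κ + 3 : ℕ) : ℝ) / (2 * Real.pi * Real.exp 1)) ^ (κ + 3) with hB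
  have hB0 : 0 ≤ B := by positivity
  set y : ℝ := κ / (2 * Real.pi * L) with hy
  have hy0 : 0 < y := by positivity
  have h1 := meansq hsm hF (y := y) (M := 8 * B / y ^ κ) hy0 (by
    intro z hz
    have := sup_bound h hκ hsm hF hmod z
    rw [hz] at this
    rw [le_div_iff₀ (by positivity)]
    exact this) (s.image (fun n => n - 1))
  rw [Finset.sum_image (by
    intro x hx y hy hxy
    have h2 := (hs x hx).1
    have h3 := (hs y hy).1
    simp only at hxy
    omega)] at h1
  have h2 : ∑ n ∈ s, ‖lam k a n‖ ^ 2 * ((L : ℝ) ^ (k - 1) * Real.exp (-(k + 1))) ≤ (8 * B / y ^ κ) ^ 2 := by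
    refine le_trans (Finset.sum_le_sum fun n hn => ?_) h1
    obtain ⟨hn1, hn2⟩ := hs n hn
    have hn0 : 1 ≤ n := by omega
    rw [Nat.sub_add_cancel hn0, norm_a_sq k a (by omega) hn0, mul_assoc]
    have hc : ((n - 1 : ℕ) : ℝ) + 1 = n := by
      rw [Nat.cast_sub hn0]; simp
    rw [hc]
    gcongr
    have h3 : -4 * Real.pi * n * y = -(k * n / L) := by
      rw [hy, hκ]; push_cast; field_simp; ring
    rw [h3]
    have h4 : (k : ℝ) * n / L ≤ k + 1 := by
      rw [div_le_iff₀ hL0]; exact_mod_cast hn2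
    linarith
  rw [← Finset.sum_mul] at h2
  have hLk : (L : ℝ) ^ k = L ^ (k - 1) * L := by rw [← pow_succ]; congr 1; omega
  have h5 : (8 * B / y ^ κ) ^ 2 ≤ (64 * Real.exp 7 * (k : ℝ) ^ 6 * L) * ((L : ℝ) ^ (k - 1) * Real.exp (-(k + 1))) := by
    have e1 : (8 * B / y ^ κ) ^ 2 = 64 * (((κ + 3 : ℕ) : ℝ) / (2 * Real.pi * Real.exp 1)) ^ 6 * ((1 + 3 / κ) ^ κ) ^ 2 * L ^ k * Real.exp (-k) := by
      have e2 : Real.exp (-(k : ℝ)) = (Real.exp 1 ^ k)⁻¹ := by rw [Real.exp_neg, ← Real.exp_nat_mul, mul_one]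
      rw [e2, hB, hy, hκ]
      have e3 : (1 : ℝ) + 3 / κ = ((κ + 3 : ℕ) : ℝ) / κ := by push_cast; field_simp
      rw [e3]
      simp only [div_pow, mul_pow, pow_add, pow_mul']
      field_simp
      norm_num
    have e4 : ((1 + 3 / (κ : ℝ)) ^ κ) ^ 2 ≤ Real.exp 6 := by
      have e5 : (1 + 3 / (κ : ℝ)) ^ κ ≤ Real.exp 3 := by
        have := Real.add_one_le_exp (3 / (κ : ℝ))
        calc _ ≤ Real.exp (3 / (κ : ℝ)) ^ κ := by gcongr; linarith
          _ = _ := by rw [← Real.exp_nat_mul]; congr 1; field_simp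
      calc _ ≤ Real.exp 3 ^ 2 := by gcongr
        _ = _ := by rw [← Real.exp_nat_mul]; norm_num
    have e6 : ((κ + 3 : ℕ) : ℝ) / (2 * Real.pi * Real.exp 1) ≤ k := by
      have : (1 : ℝ) ≤ 2 * Real.pi * Real.exp 1 := by
        have h6 := Real.pi_gt_three
        have h7 := Real.add_one_le_exp (1 : ℝ)
        nlinarith
      calc _ ≤ ((κ + 3 : ℕ) : ℝ) := div_le_self (by positivity) this
        _ ≤ k := by exact_mod_cast (by omega)
    rw [e1]
    calc _ ≤ 64 * (k : ℝ) ^ 6 * Real.exp 6 * L ^ k * Real.exp (-k) := by gcongr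
      _ = _ := by
        rw [hLk, show (7 : ℝ) = 6 + 1 by norm_num, Real.exp_add 6 1, show -((k : ℝ) + 1) = -k + -1 by ring, Real.exp_add (-(k : ℝ)), Real.exp_neg 1]
        field_simp
  exact le_of_mul_le_mul_right (h2.trans h5) (by positivity)

end HES


namespace HES
variable {k : ℕ} {a : ℕ → ℂ}
open scoped ENNReal

/-- second moment series -/
noncomputable def D2 (k : ℕ) (a : ℕ → ℂ) (σ : ℝ) : ℝ≥0∞ :=
  ∑' n : ℕ, ENNReal.ofReal (‖lam k a n‖ ^ 2 * (n : ℝ) ^ (-σ))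

lemma D2_base {δ : ℝ} (hδ : 0 < δ) : ∃ C : ℝ, 0 ≤ C ∧ ∀ (k : ℕ) (a : ℕ → ℂ), IsNormalizedHeckeEigenform k a →
    D2 k a (1 + δ) ≤ ENNReal.ofReal (C * (k : ℝ) ^ (7 : ℝ)) := by
  have hz : Summable (fun n : ℕ => (n : ℝ) ^ (-(1 + δ))) := Real.summable_nat_rpow.2 (by linarith)
  refine ⟨2 * (64 * Real.exp 7) * ∑' n : ℕ, (n : ℝ) ^ (-(1 + δ)), by positivity, fun k a h => ?_⟩
  have hk12 := h.2.1
  rw [D2, ENNReal.tsum_eq_iSup_sum]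
  refine iSup_le fun s => ?_
  rw [← ENNReal.ofReal_sum_of_nonneg (fun i _ => by positivity)]
  refine ENNReal.ofReal_le_ofReal ?_
  -- reduce to a range
  obtain ⟨N, hN⟩ : ∃ N, s ⊆ Finset.range (N + 1) := by
    obtain ⟨N, hN⟩ := s.exists_nat_subset_range
    exact ⟨N, hN.trans (Finset.range_mono (by omega))⟩
  have h1 : ∀ n ∈ s, ‖lam k a n‖ ^ 2 * (n : ℝ) ^ (-(1 + δ)) ≤
      ∑ L ∈ (Finset.Icc 1 N).filter (fun L => L ≤ n ∧ k * n ≤ (k + 1) * L),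
        (k + 1) * ((L : ℝ) ^ (-(2 + δ)) * ‖lam k a n‖ ^ 2) := by
    intro n hn
    rcases Nat.eq_zero_or_pos n with rfl | hn0
    · simp [lam_zero]
    have hnN : n ≤ N := by have := Finset.mem_range.1 (hN hn); omega
    have hn' : (0 : ℝ) < n := by exact_mod_cast hn0
    have hk1 : (0 : ℝ) < (k : ℝ) + 1 := by positivity
    have hsub : (Finset.range (n / (k + 1) + 1)).image (fun j => n - j) ⊆
        (Finset.Icc 1 N).filter (fun L => L ≤ n ∧ k * n ≤ (k + 1) * L) := by
      intro L hL
      simp only [Finset.mem_image, Finset.mem_range] at hL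
      obtain ⟨j, hj, rfl⟩ := hL
      have hj' : (k + 1) * j ≤ n := by
        calc _ ≤ (k + 1) * (n / (k + 1)) := Nat.mul_le_mul_left _ (by omega)
          _ ≤ n := Nat.mul_div_le _ _
      have hjn : j < n := by nlinarith
      rw [Finset.mem_filter, Finset.mem_Icc]
      refine ⟨⟨by omega, by omega⟩, by omega, ?_⟩
      zify [hjn.le]
      zify at hj'
      nlinarith
    have hcard : ((n : ℝ) / (k + 1)) ≤ ((Finset.Icc 1 N).filter (fun L => L ≤ n ∧ k * n ≤ (k + 1) * L)).card := by
      have h2 := Finset.card_le_card hsub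
      rw [Finset.card_image_of_injOn, Finset.card_range] at h2
      · calc ((n : ℝ) / (k + 1)) ≤ ((n / (k + 1) + 1 : ℕ) : ℝ) := by
              rw [div_le_iff₀ hk1]
              have := Nat.lt_mul_div_succ n (by omega : 0 < k + 1)
              have h3 : n ≤ (n / (k + 1) + 1) * (k + 1) := by rw [mul_comm]; exact this.le
              exact_mod_cast h3
          _ ≤ _ := by exact_mod_cast h2
      · intro x hx y hy hxy
        have hx' := Finset.mem_range.1 (Finset.mem_coe.1 hx)
        have hy' := Finset.mem_range.1 (Finset.mem_coe.1 hy)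
        have h5 := Nat.div_le_self n (k + 1)
        simp only at hxy
        omega
    calc ‖lam k a n‖ ^ 2 * (n : ℝ) ^ (-(1 + δ)) = ((n : ℝ) / (k + 1)) * ((k + 1) * ((n : ℝ) ^ (-(2 + δ)) * ‖lam k a n‖ ^ 2)) := by
          rw [show -(1 + δ) = 1 + -(2 + δ) by ring, Real.rpow_add hn', Real.rpow_one]; field_simp
      _ ≤ (((Finset.Icc 1 N).filter (fun L => L ≤ n ∧ k * n ≤ (k + 1) * L)).card : ℝ) *
          ((k + 1) * ((n : ℝ) ^ (-(2 + δ)) * ‖lam k a n‖ ^ 2)) := by gcongr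
      _ ≤ _ := by
          rw [← nsmul_eq_mul]
          refine Finset.card_nsmul_le_sum _ _ _ fun L hL => ?_
          rw [Finset.mem_filter, Finset.mem_Icc] at hL
          have hL0 : (0 : ℝ) < L := by exact_mod_cast hL.1.1
          gcongr ?_ * (?_ * ?_)
          exact Real.rpow_le_rpow_of_nonpos hL0 (by exact_mod_cast hL.2.1) (by linarith)
  calc _ ≤ ∑ n ∈ s, ∑ L ∈ (Finset.Icc 1 N).filter (fun L => L ≤ n ∧ k * n ≤ (k + 1) * L),
        ((k : ℝ) + 1) * ((L : ℝ) ^ (-(2 + δ)) * ‖lam k a n‖ ^ 2) := Finset.sum_le_sum h1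
    _ = ∑ L ∈ Finset.Icc 1 N, ∑ n ∈ s.filter (fun n => L ≤ n ∧ k * n ≤ (k + 1) * L),
        ((k : ℝ) + 1) * ((L : ℝ) ^ (-(2 + δ)) * ‖lam k a n‖ ^ 2) := by
        refine Finset.sum_comm' fun n L => ?_
        simp only [Finset.mem_filter]; tauto
    _ ≤ ∑ L ∈ Finset.Icc 1 N, ((k : ℝ) + 1) * (64 * Real.exp 7 * (k : ℝ) ^ 6) * (L : ℝ) ^ (-(1 + δ)) := by
        refine Finset.sum_le_sum fun L hL => ?_
        have hL1 := (Finset.mem_Icc.1 hL).1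
        have hL0 : (0 : ℝ) < L := by exact_mod_cast hL1
        rw [← Finset.mul_sum, ← Finset.mul_sum]
        have h2 := window h L hL1 (s.filter (fun n => L ≤ n ∧ k * n ≤ (k + 1) * L)) (fun n hn => (Finset.mem_filter.1 hn).2)
        calc _ ≤ ((k : ℝ) + 1) * ((L : ℝ) ^ (-(2 + δ)) * (64 * Real.exp 7 * (k : ℝ) ^ 6 * L)) := by gcongr
          _ = _ := by rw [show -(1 + δ) = 1 + -(2 + δ) by ring, Real.rpow_add hL0, Real.rpow_one]; ring
    _ = ((k : ℝ) + 1) * (64 * Real.exp 7 * (k : ℝ) ^ 6) * ∑ L ∈ Finset.Icc 1 N, (L : ℝ) ^ (-(1 + δ)) := by rw [Finset.mul_sum]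
    _ ≤ (2 * k) * (64 * Real.exp 7 * (k : ℝ) ^ 6) * ∑' n : ℕ, (n : ℝ) ^ (-(1 + δ)) := by
        have : (12 : ℝ) ≤ k := by exact_mod_cast hk12
        gcongr
        · linarith
        · exact hz.sum_le_tsum _ (fun i _ => by positivity)
    _ = _ := by
        rw [show (7 : ℝ) = ((7 : ℕ) : ℝ) by norm_num, Real.rpow_natCast]; push_cast; ring

lemma tsum_dvd (d : ℕ) (hd : 1 ≤ d) (φ : ℕ → ℝ≥0∞) :
    ∑' m : ℕ, (if d ∣ m then φ (m / d) else 0) = ∑' m, φ m := by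
  have hinj : Function.Injective (fun m : ℕ => d * m) := fun x y h => Nat.eq_of_mul_eq_mul_left hd h
  rw [← hinj.tsum_eq]
  · refine tsum_congr fun m => ?_
    rw [if_pos (dvd_mul_right d m), Nat.mul_div_cancel_left _ hd]
  · intro m hm
    rw [Function.mem_support] at hm
    by_cases h : d ∣ m
    · obtain ⟨q, rfl⟩ := h; exact ⟨q, rfl⟩
    · simp [h] at hm

lemma tsum_mul_pairs (φ : ℕ → ℝ≥0∞) (h0 : φ 0 = 0) :
    ∑' m : ℕ, ∑' n : ℕ, φ (m * n) = ∑' N : ℕ, (N.divisors.card : ℝ≥0∞) * φ N := by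
  have h1 : ∀ m : ℕ, ∑' n : ℕ, φ (m * n) = ∑' N : ℕ, if m ∈ N.divisors then φ N else 0 := by
    intro m
    rcases Nat.eq_zero_or_pos m with rfl | hm
    · simp [h0]
    · rw [← tsum_dvd m hm (fun n => φ (m * n))]
      refine tsum_congr fun N => ?_
      rcases Nat.eq_zero_or_pos N with rfl | hN
      · simp [h0]
      · by_cases h : m ∣ N
        · rw [if_pos h, if_pos (Nat.mem_divisors.2 ⟨h, by omega⟩), Nat.mul_div_cancel' h]
        · rw [if_neg h, if_neg (fun h' => h (Nat.dvd_of_mem_divisors h'))]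
  simp_rw [h1]
  rw [ENNReal.tsum_comm]
  refine tsum_congr fun N => ?_
  rw [tsum_eq_sum (s := N.divisors) (fun m hm => if_neg hm), Finset.sum_congr rfl (fun m hm => if_pos hm)]
  simp

lemma D2_sq {σ η : ℝ} (hσ : 1 < σ) (hη : 0 < η) (hη1 : η ≤ 1 / 2) : ∃ C : ℝ, 0 ≤ C ∧ ∀ (k : ℕ) (a : ℕ → ℂ),
    IsNormalizedHeckeEigenform k a → D2 k a σ ^ 2 ≤ ENNReal.ofReal C * D2 k a (σ - 2 * η) := by
  obtain ⟨C, hC1, hC⟩ := tau_bound hη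
  have hz : Summable (fun n : ℕ => (n : ℝ) ^ (-(2 * σ - η))) := Real.summable_nat_rpow.2 (by linarith)
  refine ⟨C * C * ∑' n : ℕ, (n : ℝ) ^ (-(2 * σ - η)), by positivity, fun k a h => ?_⟩
  set f : ℕ → ℝ≥0∞ := fun n => ENNReal.ofReal (‖lam k a n‖ ^ 2 * (n : ℝ) ^ (-σ)) with hf
  set P : ℕ → ℝ≥0∞ := fun d => ENNReal.ofReal ((d : ℝ) ^ (-(2 * σ - η))) with hP
  set Q : ℕ → ℝ≥0∞ := fun N => ENNReal.ofReal (C * ‖lam k a N‖ ^ 2 * (N : ℝ) ^ (-(σ - η))) with hQ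
  have h1 : ∀ m n : ℕ, f m * f n ≤ ∑' d : ℕ, (if d ∣ m then (if d ∣ n then P d * Q ((m / d) * (n / d)) else 0) else 0) := by
    intro m n
    rcases Nat.eq_zero_or_pos m with rfl | hm
    · simp [hf, lam_zero]
    rcases Nat.eq_zero_or_pos n with rfl | hn
    · simp [hf, lam_zero]
    refine le_trans ?_ (ENNReal.sum_le_tsum (Nat.gcd m n).divisors)
    have h2 : ∀ d ∈ (Nat.gcd m n).divisors, (if d ∣ m then (if d ∣ n then P d * Q ((m / d) * (n / d)) else 0) else 0) =
        ENNReal.ofReal ((d : ℝ) ^ (-(2 * σ - η)) * (C * ‖lam k a (m / d * (n / d))‖ ^ 2 * ((m / d * (n / d) : ℕ) : ℝ) ^ (-(σ - η)))) := by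
      intro d hd
      have hdg := Nat.dvd_of_mem_divisors hd
      rw [if_pos (hdg.trans (Nat.gcd_dvd_left m n)), if_pos (hdg.trans (Nat.gcd_dvd_right m n)), hP, hQ,
        ← ENNReal.ofReal_mul (by positivity)]
    rw [Finset.sum_congr rfl h2, ← ENNReal.ofReal_sum_of_nonneg (fun i _ => by positivity), hf,
      ← ENNReal.ofReal_mul (by positivity)]
    refine ENNReal.ofReal_le_ofReal ?_
    have e1 : (0 : ℝ) < m := by exact_mod_cast hm
    have e2 : (0 : ℝ) < n := by exact_mod_cast hn
    have h3 : ‖lam k a m‖ ^ 2 * ‖lam k a n‖ ^ 2 ≤ (Nat.gcd m n).divisors.card * ∑ d ∈ (Nat.gcd m n).divisors, ‖lam k a (m * n / d ^ 2)‖ ^ 2 := by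
      rw [← mul_pow, ← norm_mul, lam_hecke h hm hn]
      calc _ ≤ (∑ d ∈ (Nat.gcd m n).divisors, ‖lam k a (m * n / d ^ 2)‖) ^ 2 := by gcongr; exact norm_sum_le _ _
        _ ≤ _ := sq_sum_le_card_mul_sum_sq
    calc _ = (‖lam k a m‖ ^ 2 * ‖lam k a n‖ ^ 2) * ((m : ℝ) ^ (-σ) * (n : ℝ) ^ (-σ)) := by ring
      _ ≤ ((Nat.gcd m n).divisors.card * ∑ d ∈ (Nat.gcd m n).divisors, ‖lam k a (m * n / d ^ 2)‖ ^ 2) * ((m : ℝ) ^ (-σ) * (n : ℝ) ^ (-σ)) := by gcongr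
      _ = ∑ d ∈ (Nat.gcd m n).divisors, ((Nat.gcd m n).divisors.card * ‖lam k a (m * n / d ^ 2)‖ ^ 2) * ((m : ℝ) ^ (-σ) * (n : ℝ) ^ (-σ)) := by
          rw [Finset.mul_sum, Finset.sum_mul]
      _ ≤ _ := by
          refine Finset.sum_le_sum fun d hd => ?_
          have hdg := Nat.dvd_of_mem_divisors hd
          have hd0 := Nat.pos_of_mem_divisors hd
          have hg : 0 < Nat.gcd m n := Nat.gcd_pos_of_pos_left _ hm
          have hgm : (Nat.gcd m n : ℕ) ≤ m := Nat.gcd_le_left _ hm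
          have ht := hC _ hg
          generalize hgg : Nat.gcd m n = g at *
          obtain ⟨m', rfl⟩ := hdg.trans (hgg ▸ Nat.gcd_dvd_left m n)
          obtain ⟨n', rfl⟩ := hdg.trans (hgg ▸ Nat.gcd_dvd_right _ n)
          have hm' : 1 ≤ m' := Nat.pos_of_mul_pos_left hm
          have hn' : 1 ≤ n' := Nat.pos_of_mul_pos_left hn
          have h4 : d * m' * (d * n') / d ^ 2 = m' * n' := by
            rw [show d * m' * (d * n') = m' * n' * d ^ 2 by ring]
            exact Nat.mul_div_cancel _ (by positivity)
          rw [h4, Nat.mul_div_cancel_left _ hd0, Nat.mul_div_cancel_left _ hd0]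
          have i1 : (0 : ℝ) < d := by exact_mod_cast hd0
          have i2 : (0 : ℝ) < m' := by exact_mod_cast hm'
          have i3 : (0 : ℝ) < n' := by exact_mod_cast hn'
          have i4 : (1 : ℝ) ≤ n' := by exact_mod_cast hn'
          have h5 : (g.divisors.card : ℝ) ≤ C * ((d : ℝ) * (m' * n')) ^ η := by
            refine ht.trans ?_
            gcongr
            calc (g : ℝ) ≤ ((d * m' : ℕ) : ℝ) := by exact_mod_cast hgm
              _ = d * (m' * 1) := by push_cast; ring
              _ ≤ _ := by gcongr
          have h6 : ((d * m' : ℕ) : ℝ) ^ (-σ) * ((d * n' : ℕ) : ℝ) ^ (-σ) = (d : ℝ) ^ (-(2 * σ)) * ((m' : ℝ) * n') ^ (-σ) := by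
            push_cast
            rw [← Real.mul_rpow (by positivity) (by positivity), show (d : ℝ) * m' * (d * n') = d ^ 2 * (m' * n') by ring,
              Real.mul_rpow (by positivity) (by positivity), ← Real.rpow_natCast, ← Real.rpow_mul i1.le]
            congr 2; push_cast; ring
          rw [h6]
          calc _ ≤ (C * ((d : ℝ) * (m' * n')) ^ η * ‖lam k a (m' * n')‖ ^ 2) * ((d : ℝ) ^ (-(2 * σ)) * ((m' : ℝ) * n') ^ (-σ)) := by gcongr
            _ = (d : ℝ) ^ (-(2 * σ) + η) * (C * ‖lam k a (m' * n')‖ ^ 2 * ((m' : ℝ) * n') ^ (-σ + η)) := by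
                rw [Real.mul_rpow i1.le (by positivity), Real.rpow_add i1, Real.rpow_add (by positivity)]; ring
            _ = _ := by
                push_cast
                rw [show -(2 * σ) + η = -(2 * σ - η) by ring, show -σ + η = -(σ - η) by ring]
  have hQ0 : Q 0 = 0 := by simp [hQ, lam_zero]
  have hP0 : ∀ d : ℕ, ∑' m : ℕ, ∑' n : ℕ, (if d ∣ m then (if d ∣ n then P d * Q ((m / d) * (n / d)) else 0) else 0) ≤
      P d * ∑' N : ℕ, (N.divisors.card : ℝ≥0∞) * Q N := by
    intro d
    rcases Nat.eq_zero_or_pos d with rfl | hd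
    · refine le_trans (le_of_eq ?_) (zero_le)
      rw [ENNReal.tsum_eq_zero]; intro m
      rw [ENNReal.tsum_eq_zero]; intro n
      simp [hQ0]
    · rw [← tsum_mul_pairs Q hQ0, ← ENNReal.tsum_mul_left]
      simp_rw [← ENNReal.tsum_mul_left]
      rw [← tsum_dvd d hd (fun m => ∑' n, P d * Q (m * n))]
      refine ENNReal.tsum_le_tsum fun m => ?_
      by_cases hm : d ∣ m
      · simp only [hm, if_true]
        rw [← tsum_dvd d hd (fun n => P d * Q (m / d * n))]
      · simp [hm]
  calc D2 k a σ ^ 2 = ∑' m, ∑' n, f m * f n := by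
        rw [sq, D2]
        simp_rw [ENNReal.tsum_mul_left, ENNReal.tsum_mul_right]
        rfl
    _ ≤ ∑' m, ∑' n, ∑' d : ℕ, (if d ∣ m then (if d ∣ n then P d * Q ((m / d) * (n / d)) else 0) else 0) :=
        ENNReal.tsum_le_tsum fun m => ENNReal.tsum_le_tsum fun n => h1 m n
    _ = ∑' d : ℕ, ∑' m, ∑' n, (if d ∣ m then (if d ∣ n then P d * Q ((m / d) * (n / d)) else 0) else 0) := by
        rw [tsum_congr fun m => ENNReal.tsum_comm, ENNReal.tsum_comm]
    _ ≤ ∑' d : ℕ, P d * ∑' N : ℕ, (N.divisors.card : ℝ≥0∞) * Q N := ENNReal.tsum_le_tsum hP0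
    _ = (∑' d : ℕ, P d) * ∑' N : ℕ, (N.divisors.card : ℝ≥0∞) * Q N := ENNReal.tsum_mul_right
    _ ≤ ENNReal.ofReal (∑' n : ℕ, (n : ℝ) ^ (-(2 * σ - η))) * (ENNReal.ofReal (C * C) * D2 k a (σ - 2 * η)) := by
        gcongr
        · rw [ENNReal.ofReal_tsum_of_nonneg (fun n => by positivity) hz]
        · rw [D2, ← ENNReal.tsum_mul_left]
          refine ENNReal.tsum_le_tsum fun N => ?_
          rcases Nat.eq_zero_or_pos N with rfl | hN
          · simp
          have e1 : (0 : ℝ) < N := by exact_mod_cast hN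
          rw [hQ, ← ENNReal.ofReal_mul (by positivity), ← ENNReal.ofReal_natCast, ← ENNReal.ofReal_mul (by positivity)]
          refine ENNReal.ofReal_le_ofReal ?_
          calc _ ≤ (C * (N : ℝ) ^ η) * (C * ‖lam k a N‖ ^ 2 * (N : ℝ) ^ (-(σ - η))) := by gcongr; exact hC N hN
            _ = C * C * (‖lam k a N‖ ^ 2 * (N : ℝ) ^ (η + -(σ - η))) := by rw [Real.rpow_add e1]; ring
            _ = _ := by rw [show η + -(σ - η) = -(σ - 2 * η) by ring]
    _ = _ := by
        rw [← mul_assoc, ← ENNReal.ofReal_mul (by positivity)]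
        congr 2; ring

lemma D2_final {δ : ℝ} (hδ : 0 < δ) (hδ1 : δ ≤ 1) : ∃ C : ℝ, 0 ≤ C ∧ ∀ (k : ℕ) (a : ℕ → ℂ),
    IsNormalizedHeckeEigenform k a → D2 k a (1 + δ) ≤ ENNReal.ofReal (C * (k : ℝ) ^ δ) := by
  have key : ∀ j : ℕ, ∀ δ : ℝ, 0 < δ → δ ≤ 1 → ∃ C : ℝ, 0 ≤ C ∧ ∀ (k : ℕ) (a : ℕ → ℂ),
      IsNormalizedHeckeEigenform k a → D2 k a (1 + δ) ≤ ENNReal.ofReal (C * (k : ℝ) ^ ((7 : ℝ) / 2 ^ j)) := by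
    intro j
    induction j with
    | zero => intro δ hδ _; simpa using D2_base hδ
    | succ j ih =>
      intro δ hδ hδ1
      obtain ⟨C1, hC1, h1⟩ := D2_sq (σ := 1 + δ) (η := δ / 4) (by linarith) (by linarith) (by linarith)
      obtain ⟨C2, hC2, h2⟩ := ih (δ / 2) (by linarith) (by linarith)
      refine ⟨√(C1 * C2), by positivity, fun k a h => ?_⟩
      have h3 := h1 k a h
      have h4 := h2 k a h
      rw [show 1 + δ - 2 * (δ / 4) = 1 + δ / 2 by ring] at h3
      have h5 := h3.trans (mul_le_mul_right h4 _)
      rw [← ENNReal.ofReal_mul hC1] at h5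
      have h6 : C1 * (C2 * (k : ℝ) ^ ((7 : ℝ) / 2 ^ j)) = (√(C1 * C2) * (k : ℝ) ^ ((7 : ℝ) / 2 ^ (j + 1))) ^ 2 := by
        rw [mul_pow, Real.sq_sqrt (by positivity), ← Real.rpow_natCast _ 2, ← Real.rpow_mul (by positivity)]
        rw [show (7 : ℝ) / 2 ^ (j + 1) * ((2 : ℕ) : ℝ) = 7 / 2 ^ j by rw [pow_succ]; push_cast; field_simp]
        ring
      rw [h6, ENNReal.ofReal_pow (by positivity)] at h5
      exact (ENNReal.pow_le_pow_left_iff two_ne_zero).1 h5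
  obtain ⟨j, hj⟩ := pow_unbounded_of_one_lt (7 / δ) (by norm_num : (1 : ℝ) < 2)
  obtain ⟨C, hC, h⟩ := key j δ hδ hδ1
  refine ⟨C, hC, fun k a hk => (h k a hk).trans (ENNReal.ofReal_le_ofReal ?_)⟩
  have : (1 : ℝ) ≤ k := by have := hk.2.1; exact_mod_cast (by omega : 1 ≤ k)
  gcongr
  rw [div_le_iff₀ (by positivity)]
  rw [div_lt_iff₀ hδ] at hj; linarith

lemma real_of_ennreal {g : ℕ → ℝ} (hg : ∀ n, 0 ≤ g n) {B : ℝ} (hB : 0 ≤ B)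
    (h : ∑' n, ENNReal.ofReal (g n) ≤ ENNReal.ofReal B) : Summable g ∧ ∑' n, g n ≤ B := by
  have h1 : ∀ s : Finset ℕ, ∑ n ∈ s, g n ≤ B := by
    intro s
    rw [← ENNReal.ofReal_le_ofReal_iff hB, ENNReal.ofReal_sum_of_nonneg fun i _ => hg i]
    exact (ENNReal.sum_le_tsum s).trans h
  exact ⟨summable_of_sum_le hg h1, Real.tsum_le_of_sum_le hg h1⟩

lemma gcd_sum {δ : ℝ} (hδ : 0 < δ) (hδ1 : δ ≤ 1) : ∃ C : ℝ, 0 ≤ C ∧ ∀ (k : ℕ) (a : ℕ → ℂ),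
    IsNormalizedHeckeEigenform k a → ∀ c : ℕ, 1 ≤ c →
    Summable (fun n : ℕ => ‖lam k a n‖ * √(Nat.gcd n c) * (n : ℝ) ^ (-(1 + δ))) ∧
    ∑' n : ℕ, ‖lam k a n‖ * √(Nat.gcd n c) * (n : ℝ) ^ (-(1 + δ)) ≤ C * (k : ℝ) ^ δ * c.divisors.card := by
  obtain ⟨C, hC, h⟩ := D2_final hδ hδ1
  have hz : Summable (fun n : ℕ => (n : ℝ) ^ (-(1 + δ))) := Real.summable_nat_rpow.2 (by linarith)
  set ζ := ∑' n : ℕ, (n : ℝ) ^ (-(1 + δ)) with hζ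
  have hζ0 : 0 ≤ ζ := tsum_nonneg fun n => by positivity
  refine ⟨C + ζ, by positivity, fun k a hk c hc => real_of_ennreal (fun n => by positivity) (by positivity) ?_⟩
  have hk1 : (1 : ℝ) ≤ k := by have := hk.2.1; exact_mod_cast (by omega : 1 ≤ k)
  have hkδ : (1 : ℝ) ≤ (k : ℝ) ^ δ := Real.one_le_rpow hk1 hδ.le
  have hτ : (1 : ℝ) ≤ c.divisors.card := by
    exact_mod_cast Finset.card_pos.2 ⟨1, Nat.one_mem_divisors.2 (by omega)⟩
  have h1 : ∀ n : ℕ, ENNReal.ofReal (‖lam k a n‖ * √(Nat.gcd n c) * (n : ℝ) ^ (-(1 + δ))) ≤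
      ENNReal.ofReal (‖lam k a n‖ ^ 2 * (n : ℝ) ^ (-(1 + δ))) +
      ∑ d ∈ c.divisors, (if d ∣ n then ENNReal.ofReal ((d : ℝ) * ((d * (n / d) : ℕ) : ℝ) ^ (-(1 + δ))) else 0) := by
    intro n
    have e1 : ENNReal.ofReal ((Nat.gcd n c : ℝ) * (n : ℝ) ^ (-(1 + δ))) ≤ ∑ d ∈ c.divisors, (if d ∣ n then ENNReal.ofReal ((d : ℝ) * ((d * (n / d) : ℕ) : ℝ) ^ (-(1 + δ))) else 0) := by
      refine le_trans (le_of_eq ?_) (Finset.single_le_sum (fun i _ => zero_le)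
        (Nat.mem_divisors.2 ⟨Nat.gcd_dvd_right n c, by omega⟩))
      rw [if_pos (Nat.gcd_dvd_left n c), Nat.mul_div_cancel' (Nat.gcd_dvd_left n c)]
    refine le_trans ?_ (add_le_add_right e1 _)
    rw [← ENNReal.ofReal_add (by positivity) (by positivity), ← add_mul]
    refine ENNReal.ofReal_le_ofReal ?_
    gcongr
    have := Real.sq_sqrt (Nat.cast_nonneg (α := ℝ) (Nat.gcd n c))
    nlinarith [sq_nonneg (‖lam k a n‖ - √(Nat.gcd n c)), sq_nonneg ‖lam k a n‖, sq_nonneg √(Nat.gcd n c : ℝ)]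
  refine (ENNReal.tsum_le_tsum h1).trans ?_
  rw [ENNReal.tsum_add, Summable.tsum_finsetSum (fun i _ => ENNReal.summable)]
  have h2 : ∀ d ∈ c.divisors, ∑' n : ℕ, (if d ∣ n then ENNReal.ofReal ((d : ℝ) * ((d * (n / d) : ℕ) : ℝ) ^ (-(1 + δ))) else 0) ≤ ENNReal.ofReal ζ := by
    intro d hd
    have hd0 := Nat.pos_of_mem_divisors hd
    have hd1 : (1 : ℝ) ≤ d := by exact_mod_cast hd0
    rw [tsum_dvd d hd0 (fun m => ENNReal.ofReal ((d : ℝ) * ((d * m : ℕ) : ℝ) ^ (-(1 + δ)))), hζ,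
      ENNReal.ofReal_tsum_of_nonneg (fun n => by positivity) hz]
    refine ENNReal.tsum_le_tsum fun m => ENNReal.ofReal_le_ofReal ?_
    push_cast
    rw [Real.mul_rpow (by positivity) (by positivity), ← mul_assoc]
    refine mul_le_of_le_one_left (by positivity) ?_
    calc (d : ℝ) * (d : ℝ) ^ (-(1 + δ)) = (d : ℝ) ^ (1 + -(1 + δ)) := by
          rw [Real.rpow_add (by positivity), Real.rpow_one]
      _ ≤ 1 := Real.rpow_le_one_of_one_le_of_nonpos hd1 (by linarith)
  calc _ ≤ ENNReal.ofReal (C * (k : ℝ) ^ δ) + ∑ d ∈ c.divisors, ENNReal.ofReal ζ := by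
        gcongr with d hd
        · exact h k a hk
        · exact h2 d hd
    _ = ENNReal.ofReal (C * (k : ℝ) ^ δ + c.divisors.card * ζ) := by
        rw [Finset.sum_const, nsmul_eq_mul, ← ENNReal.ofReal_natCast, ← ENNReal.ofReal_mul (by positivity),
          ← ENNReal.ofReal_add (by positivity) (by positivity)]
    _ ≤ _ := by
        refine ENNReal.ofReal_le_ofReal ?_
        have h3 : C * (k : ℝ) ^ δ * 1 ≤ C * (k : ℝ) ^ δ * c.divisors.card := by gcongr
        have h4 : c.divisors.card * ζ * 1 ≤ c.divisors.card * ζ * (k : ℝ) ^ δ := by gcongr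
        nlinarith

end HES


namespace HES
open MeasureTheory Set Complex

lemma hs_congr {f g : ℕ → ℂ} {s : ℂ} (h : ∀ m, f m = g m) (hg : HasSum g s) : HasSum f s := by
  rwa [funext h]

lemma int_exp_circle (n : ℤ) : ∫ θ in (0 : ℝ)..(2 * Real.pi), exp (n * I * θ) = if n = 0 then ((2 * Real.pi : ℝ) : ℂ) else 0 := by
  split_ifs with h
  · subst h; simp
  · rw [integral_exp_mul_complex (by simp [h])]
    have : exp ((n : ℂ) * I * ((2 * Real.pi : ℝ) : ℂ)) = 1 := by
      rw [exp_eq_one_iff]; exact ⟨n, by push_cast; ring⟩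
    rw [this]; simp

/-- Bessel integral -/
noncomputable def Jf (ν : ℕ) (y : ℝ) : ℂ :=
  (((2 * Real.pi : ℝ) : ℂ))⁻¹ * ∫ θ in (0 : ℝ)..(2 * Real.pi), exp (I * (2 * y * Real.sin θ - ν * θ : ℝ))

lemma Jf_cont (ν : ℕ) : Continuous (Jf ν) := by
  unfold Jf
  refine continuous_const.mul ?_
  refine intervalIntegral.continuous_parametric_intervalIntegral_of_continuous' ?_ _ _
  unfold Function.uncurry
  fun_prop

lemma Jf_norm (ν : ℕ) (y : ℝ) : ‖Jf ν y‖ ≤ 1 := by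
  have hpi := Real.pi_pos
  have h := intervalIntegral.norm_integral_le_of_norm_le_const (a := 0) (b := 2 * Real.pi) (C := 1)
    (f := fun θ : ℝ => exp (I * (2 * y * Real.sin θ - ν * θ : ℝ))) (fun θ _ => by
      rw [mul_comm, norm_exp_ofReal_mul_I])
  rw [Jf, norm_mul, norm_inv, norm_real, Real.norm_of_nonneg (by positivity)]
  rw [sub_zero, abs_of_pos (by positivity), one_mul] at h
  rw [inv_mul_le_iff₀ (by positivity)]
  linarith

lemma Jf_hasSum (ν : ℕ) (y : ℝ) :
    HasSum (fun m : ℕ => (-1 : ℂ) ^ m * (y : ℂ) ^ (2 * m + ν) / (m.factorial * (m + ν).factorial)) (Jf ν y) := by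
  have hpi := Real.pi_pos
  set Fs : ℕ × ℕ → ℝ → ℂ := fun p θ => ((y : ℂ) ^ p.1 / p.1.factorial * ((-y : ℂ) ^ p.2 / p.2.factorial)) *
    exp (((p.1 : ℤ) - p.2 - ν : ℤ) * I * θ) with hFs
  have hnorm : ∀ p θ, ‖Fs p θ‖ = |y| ^ p.1 / p.1.factorial * (|y| ^ p.2 / p.2.factorial) := by
    intro p θ
    simp only [hFs]
    rw [norm_mul, show ((((p.1 : ℤ) - p.2 - ν : ℤ) : ℂ) * I * θ) = ((((p.1 : ℤ) - p.2 - ν : ℤ) * θ : ℝ) : ℂ) * I by push_cast; ring,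
      norm_exp_ofReal_mul_I]
    simp
  have hsy : Summable (fun j : ℕ => |y| ^ j / (j.factorial : ℝ)) := Real.summable_pow_div_factorial _
  have hs2 : Summable (fun p : ℕ × ℕ => |y| ^ p.1 / p.1.factorial * (|y| ^ p.2 / p.2.factorial)) :=
    hsy.mul_of_nonneg hsy (fun _ => by positivity) (fun _ => by positivity)
  have h1 := hasSum_integral_of_summable_integral_norm (μ := volume.restrict (Ioc 0 (2 * Real.pi))) (F := Fs)
    (fun p => (Continuous.integrableOn_Ioc (by simp only [hFs]; fun_prop)))
    (by simp_rw [hnorm]; simpa using hs2.mul_left _)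
  have h2 : ∀ θ : ℝ, ∑' p, Fs p θ = exp (I * (2 * y * Real.sin θ - ν * θ : ℝ)) := by
    intro θ
    have e1 : HasSum (fun j : ℕ => (y * exp (I * θ)) ^ j / (j.factorial : ℂ)) (exp (y * exp (I * θ))) := by
      rw [exp_eq_exp_ℂ]; exact NormedSpace.expSeries_div_hasSum_exp _
    have e2 : HasSum (fun j : ℕ => (-y * exp (-(I * θ))) ^ j / (j.factorial : ℂ)) (exp (-y * exp (-(I * θ)))) := by
      rw [exp_eq_exp_ℂ]; exact NormedSpace.expSeries_div_hasSum_exp _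
    have n1 : Summable (fun j : ℕ => ‖(y * exp (I * θ)) ^ j / (j.factorial : ℂ)‖) := e1.summable.norm
    have n2 : Summable (fun j : ℕ => ‖(-y * exp (-(I * θ))) ^ j / (j.factorial : ℂ)‖) := e2.summable.norm
    have e3 := tsum_mul_tsum_of_summable_norm n1 n2
    rw [e1.tsum_eq, e2.tsum_eq, ← exp_add] at e3
    have e4 : I * ((2 * y * Real.sin θ - ν * θ : ℝ) : ℂ) = (y * exp (I * θ) + -y * exp (-(I * θ))) + (-ν * I * θ) := by
      have : ((Real.sin θ : ℝ) : ℂ) = (exp (-(I * θ)) - exp (I * θ)) * I / 2 := by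
        rw [ofReal_sin, Complex.sin]; congr 4 <;> ring_nf
      push_cast at this ⊢
      rw [this]
      ring_nf
      simp only [I_sq]; ring
    rw [e4, exp_add, e3, ← tsum_mul_right]
    refine tsum_congr fun p => ?_
    simp only [hFs]
    rw [show ((((p.1 : ℤ) - p.2 - ν : ℤ) : ℂ) * I * θ) = p.1 * (I * θ) + (p.2 * (-(I * θ)) + (-ν * I * θ)) by push_cast; ring,
      exp_add, exp_add, exp_nat_mul, exp_nat_mul, mul_pow, mul_pow]
    ring
  simp_rw [h2, ← intervalIntegral.integral_of_le (by positivity : (0 : ℝ) ≤ 2 * Real.pi)] at h1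
  have h3 := h1.mul_left (((2 * Real.pi : ℝ) : ℂ))⁻¹
  change HasSum _ (Jf ν y) at h3
  have hinj : Function.Injective (fun m : ℕ => (m + ν, m)) := fun a b h => (Prod.ext_iff.1 h).2
  have hI : ∀ p : ℕ × ℕ, ∫ θ in (0 : ℝ)..(2 * Real.pi), Fs p θ = ((y : ℂ) ^ p.1 / p.1.factorial * ((-y : ℂ) ^ p.2 / p.2.factorial)) * (if (p.1 : ℤ) - p.2 - ν = 0 then ((2 * Real.pi : ℝ) : ℂ) else 0) := by
    intro p
    simp only [hFs]
    rw [intervalIntegral.integral_const_mul, int_exp_circle]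
  rw [← hinj.hasSum_iff] at h3
  · convert h3 using 2 with m
    simp only [Function.comp]
    rw [hI, if_pos (by push_cast; ring)]
    have : ((2 * Real.pi : ℝ) : ℂ) ≠ 0 := by exact_mod_cast (by positivity)
    have f1 : (m.factorial : ℂ) ≠ 0 := by exact_mod_cast m.factorial_ne_zero
    have f2 : ((m + ν).factorial : ℂ) ≠ 0 := by exact_mod_cast (m + ν).factorial_ne_zero
    rw [neg_pow (y : ℂ)]
    field_simp
    ring
  · intro p hp
    rw [hI, if_neg, mul_zero, mul_zero]
    intro h
    apply hp
    exact ⟨p.2, Prod.ext (by simp only; omega) rfl⟩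

/-- the kernel -/
noncomputable def Bf (ν : ℕ) (β x : ℝ) : ℂ := (((x / β) ^ ((ν : ℝ) / 2) : ℝ) : ℂ) * Jf ν (√(β * x))

lemma Bf_cont (ν : ℕ) {β : ℝ} (hβ : 0 < β) : Continuous (Bf ν β) := by
  unfold Bf
  refine (continuous_ofReal.comp ((continuous_id.div_const β).rpow_const fun x => Or.inr (by positivity))).mul
    ((Jf_cont ν).comp (by fun_prop))

lemma Bf_norm (ν : ℕ) {β x : ℝ} (hβ : 0 < β) (hx : 0 ≤ x) : ‖Bf ν β x‖ ≤ (x / β) ^ ((ν : ℝ) / 2) := by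
  rw [Bf, norm_mul, norm_real, Real.norm_of_nonneg (by positivity)]
  exact mul_le_of_le_one_right (by positivity) (Jf_norm _ _)

lemma Bf_hasSum (ν : ℕ) {β x : ℝ} (hβ : 0 < β) (hx : 0 < x) :
    HasSum (fun m : ℕ => (((-β) ^ m / m.factorial : ℝ) : ℂ) * ((x ^ (m + ν) / (m + ν).factorial : ℝ) : ℂ)) (Bf ν β x) := by
  refine hs_congr (fun m => ?_) ((Jf_hasSum ν (√(β * x))).mul_left (((x / β) ^ ((ν : ℝ) / 2) : ℝ) : ℂ))
  have h1 : (x / β) ^ ((ν : ℝ) / 2) * √(β * x) ^ (2 * m + ν) = β ^ m * x ^ (m + ν) := by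
    rw [Real.sqrt_eq_rpow, ← Real.rpow_natCast, ← Real.rpow_mul (by positivity), Real.mul_rpow hβ.le hx.le,
      Real.div_rpow hx.le hβ.le, div_mul_eq_mul_div, div_eq_iff (by positivity)]
    rw [← Real.rpow_natCast β, ← Real.rpow_natCast x]
    rw [show x ^ ((ν : ℝ) / 2) * (β ^ (1 / 2 * ((2 * m + ν : ℕ) : ℝ)) * x ^ (1 / 2 * ((2 * m + ν : ℕ) : ℝ))) =
      β ^ (1 / 2 * ((2 * m + ν : ℕ) : ℝ)) * (x ^ ((ν : ℝ) / 2) * x ^ (1 / 2 * ((2 * m + ν : ℕ) : ℝ))) by ring]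
    rw [← Real.rpow_add hx, mul_right_comm, ← Real.rpow_add hβ]
    congr 2 <;> push_cast <;> ring
  rw [neg_pow β]
  push_cast
  have h2 := congrArg (fun u : ℝ => (u : ℂ)) h1
  simp only [ofReal_mul, ofReal_pow] at h2
  have f1 : (m.factorial : ℂ) ≠ 0 := by exact_mod_cast m.factorial_ne_zero
  have f2 : ((m + ν).factorial : ℂ) ≠ 0 := by exact_mod_cast (m + ν).factorial_ne_zero
  rw [mul_comm β x] at h2 ⊢
  field_simp
  linear_combination (-1) * h2

lemma pow_exp_int1 (N : ℕ) {s : ℂ} (hs : 0 < s.re) :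
    IntegrableOn (fun x : ℝ => ((x ^ N / N.factorial : ℝ) : ℂ) * exp (-(s * x))) (Ioi 0) := by
  have h0 := integrableOn_rpow_mul_exp_neg_mul_rpow (s := N) (p := 1) (b := s.re)
    (neg_one_lt_zero.trans_le N.cast_nonneg) one_pos hs
  refine Integrable.mono' (h0.const_mul (N.factorial : ℝ)⁻¹) (by fun_prop) ?_
  refine (ae_restrict_iff' measurableSet_Ioi).2 (Filter.Eventually.of_forall fun x hx => ?_)
  have hx' : (0 : ℝ) < x := hx
  rw [norm_mul, norm_exp, norm_real, Real.norm_of_nonneg (by positivity), Real.rpow_one, Real.rpow_natCast]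
  simp only [neg_re, mul_re, ofReal_re, ofReal_im, mul_zero, sub_zero]
  refine le_of_eq ?_
  rw [neg_mul]; ring

lemma pow_exp_int (N : ℕ) {s : ℂ} (hs : 0 < s.re) :
    IntegrableOn (fun x : ℝ => ((x ^ N / N.factorial : ℝ) : ℂ) * exp (-(s * x))) (Ioi 0) ∧
    ∫ x in Ioi (0 : ℝ), ((x ^ N / N.factorial : ℝ) : ℂ) * exp (-(s * x)) = s⁻¹ ^ (N + 1) := by
  refine ⟨pow_exp_int1 N hs, ?_⟩
  have hs0 : s ≠ 0 := fun h => by simp [h] at hs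
  induction N with
  | zero =>
    have := integral_exp_mul_complex_Ioi (a := -s) (by simpa using hs) 0
    simpa [hs0] using this
  | succ N ih =>
    have hd : ∀ x ∈ Ici (0 : ℝ), HasDerivAt (fun x : ℝ => ((x ^ (N + 1) / (N + 1).factorial : ℝ) : ℂ) * exp (-(s * x)))
        (((x ^ N / N.factorial : ℝ) : ℂ) * exp (-(s * x)) - s * (((x ^ (N + 1) / (N + 1).factorial : ℝ) : ℂ) * exp (-(s * x)))) x := by
      intro x _
      have d1 : HasDerivAt (fun x : ℝ => ((x ^ (N + 1) / (N + 1).factorial : ℝ) : ℂ)) ((x ^ N / N.factorial : ℝ) : ℂ) x := by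
        refine HasDerivAt.ofReal_comp ?_
        refine ((hasDerivAt_pow (N + 1) x).div_const ((N + 1).factorial : ℝ)).congr_deriv ?_
        rw [Nat.factorial_succ]; push_cast
        have : (N : ℝ) + 1 ≠ 0 := by positivity
        field_simp
      have d2 : HasDerivAt (fun x : ℝ => exp (-(s * x))) (exp (-(s * x)) * (-(s * 1))) x := by
        refine HasDerivAt.cexp ?_
        exact ((hasDerivAt_id x).ofReal_comp.const_mul s).neg
      exact (d1.mul d2).congr_deriv (by ring)
    have ht : Filter.Tendsto (fun x : ℝ => ((x ^ (N + 1) / (N + 1).factorial : ℝ) : ℂ) * exp (-(s * x))) Filter.atTop (nhds 0) := by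
      rw [tendsto_zero_iff_norm_tendsto_zero]
      have := (tendsto_rpow_mul_exp_neg_mul_atTop_nhds_zero (N + 1 : ℕ) s.re hs).const_mul ((N + 1).factorial : ℝ)⁻¹
      rw [mul_zero] at this
      refine this.congr' ?_
      filter_upwards [Filter.eventually_gt_atTop 0] with x hx
      rw [norm_mul, norm_exp, norm_real, Real.norm_of_nonneg (by positivity), Real.rpow_natCast]
      simp only [neg_re, mul_re, ofReal_re, ofReal_im, mul_zero, sub_zero, neg_mul]
      ring
    have h1 := integral_Ioi_of_hasDerivAt_of_tendsto' hd ((pow_exp_int1 N hs).sub ((pow_exp_int1 (N + 1) hs).const_mul s)) ht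
    rw [integral_sub (pow_exp_int1 N hs) ((pow_exp_int1 (N + 1) hs).const_mul s), ih, integral_const_mul] at h1
    simp only [ne_eq, Nat.add_eq_zero_iff, one_ne_zero, and_false, not_false_eq_true, zero_pow, zero_div, ofReal_zero, zero_mul, sub_zero] at h1
    rw [sub_eq_zero] at h1
    rw [pow_succ, h1]
    field_simp

lemma Bf_laplace (ν : ℕ) {β : ℝ} (hβ : 0 < β) {s : ℂ} (hs : 0 < s.re) :
    ∫ x in Ioi (0 : ℝ), Bf ν β x * exp (-(s * x)) = s⁻¹ ^ (ν + 1) * exp (-(β / s)) := by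
  have hre : (0 : ℝ) < ((s.re : ℝ) : ℂ).re := by simpa using hs
  have hs0 : s ≠ 0 := fun h => by simp [h] at hs
  set G : ℕ → ℝ → ℂ := fun m x => (((-β) ^ m / m.factorial : ℝ) : ℂ) * (((x ^ (m + ν) / (m + ν).factorial : ℝ) : ℂ) * exp (-(s * x))) with hG
  have hint : ∀ m, IntegrableOn (G m) (Ioi 0) := fun m => (pow_exp_int (m + ν) hs).1.const_mul _
  have hnorm : ∀ m, ∫ x in Ioi (0 : ℝ), ‖G m x‖ = s.re⁻¹ ^ (ν + 1) * ((β * s.re⁻¹) ^ m / m.factorial) := by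
    intro m
    have h1 := (pow_exp_int (m + ν) hre).2
    have h2 : ∫ x in Ioi (0 : ℝ), (x ^ (m + ν) / (m + ν).factorial) * Real.exp (-(s.re * x)) = s.re⁻¹ ^ (m + ν + 1) := by
      apply ofReal_injective
      refine integral_complex_ofReal.symm.trans ?_
      push_cast at h1 ⊢
      exact h1
    have h3 : ∀ x ∈ Ioi (0 : ℝ), ‖G m x‖ = (β ^ m / m.factorial) * ((x ^ (m + ν) / (m + ν).factorial) * Real.exp (-(s.re * x))) := by
      intro x hx
      have hx' : (0 : ℝ) < x := hx
      simp only [hG]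
      rw [norm_mul, norm_mul, norm_exp, norm_real, norm_real, Real.norm_of_nonneg (by positivity : 0 ≤ x ^ (m + ν) / ((m + ν).factorial : ℝ))]
      congr 2
      · simp [abs_of_pos hβ]
      · simp
    rw [setIntegral_congr_fun measurableSet_Ioi h3, integral_const_mul, h2, mul_pow]
    ring
  have h1 := hasSum_integral_of_summable_integral_norm hint (by
    simp_rw [hnorm]
    exact (Real.summable_pow_div_factorial _).mul_left _)
  have h2 : ∀ x ∈ Ioi (0 : ℝ), ∑' m, G m x = Bf ν β x * exp (-(s * x)) := by
    intro x hx
    rw [← ((Bf_hasSum ν hβ hx).mul_right (exp (-(s * x)))).tsum_eq]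
    refine tsum_congr fun m => ?_
    simp only [hG]; ring
  rw [setIntegral_congr_fun measurableSet_Ioi h2] at h1
  refine h1.unique ?_
  have e1 : HasSum (fun j : ℕ => (-(β / s)) ^ j / (j.factorial : ℂ)) (exp (-(β / s))) := by
    rw [exp_eq_exp_ℂ]; exact NormedSpace.expSeries_div_hasSum_exp _
  refine hs_congr (fun m => ?_) (e1.mul_left (s⁻¹ ^ (ν + 1)))
  simp only [hG]
  rw [integral_const_mul, (pow_exp_int (m + ν) hs).2]
  push_cast
  rw [← neg_div, div_pow, show m + ν + 1 = m + (ν + 1) by ring, pow_add, inv_pow s m]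
  field_simp

end HES


namespace HES
open MeasureTheory Set Complex FourierTransform
open scoped ContDiff

/-- line parameter -/
noncomputable def sv (t : ℝ) : ℂ := 2 * Real.pi * (1 - I * t)

lemma sv_re (t : ℝ) : (sv t).re = 2 * Real.pi := by simp [sv]
lemma sv_re_pos (t : ℝ) : 0 < (sv t).re := by rw [sv_re]; positivity
lemma sv_ne (t : ℝ) : sv t ≠ 0 := fun h => by have := sv_re_pos t; simp [h] at this
lemma sv_cont : Continuous sv := by unfold sv; fun_prop
lemma sv_normSq (t : ℝ) : ‖sv t‖ ^ 2 = (2 * Real.pi) ^ 2 * (1 + t ^ 2) := by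
  rw [← normSq_eq_norm_sq, normSq_apply]; simp [sv]; ring

/-- exponential twist and Fourier transform -/
noncomputable def tw (H : ℝ → ℂ) (x : ℝ) : ℂ := H x * exp (2 * Real.pi * x)
noncomputable def hat (H : ℝ → ℂ) : ℝ → ℂ := 𝓕 (tw H)

section
variable {H : ℝ → ℂ} (hH : ContDiff ℝ ∞ H) (hc : HasCompactSupport H)
include hH hc

lemma hat_schwartz : ∃ S : SchwartzMap ℝ ℂ, ∃ T : SchwartzMap ℝ ℂ, (∀ x, S x = tw H x) ∧ (∀ x, T x = hat H x) := by
  have h1 : ContDiff ℝ ∞ (tw H) := by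
    unfold tw
    refine hH.mul (ContDiff.cexp (contDiff_const.mul ofRealCLM.contDiff))
  have h2 : HasCompactSupport (tw H) := hc.mul_right
  refine ⟨h2.toSchwartzMap h1, 𝓕 (h2.toSchwartzMap h1), fun x => rfl, fun x => ?_⟩
  rw [SchwartzMap.fourier_coe]; rfl

lemma hat_int : Integrable (hat H) := by
  obtain ⟨S, T, hS, hT⟩ := hat_schwartz hH hc
  rw [← funext hT]; exact T.integrable

lemma hat_cont : Continuous (hat H) := by
  obtain ⟨S, T, hS, hT⟩ := hat_schwartz hH hc
  rw [← funext hT]; exact T.continuous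

lemma hat_inv (x : ℝ) : ∫ t : ℝ, hat H t * exp (-(sv t * x)) = H x := by
  obtain ⟨S, T, hS, hT⟩ := hat_schwartz hH hc
  have h1 : 𝓕⁻ (hat H) = tw H := by
    rw [hat]
    refine Continuous.fourierInv_fourier_eq ?_ ?_ (hat_int hH hc)
    · rw [← funext hS]; exact S.continuous
    · rw [← funext hS]; exact S.integrable
  have h2 := congrFun h1 x
  rw [Real.fourierInv_eq'] at h2
  have h3 : H x = tw H x * exp (-(2 * Real.pi * x)) := by
    rw [tw, mul_assoc, ← exp_add]; simp
  rw [h3, ← h2, ← integral_mul_const]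
  congr 1; funext t
  rw [smul_eq_mul, mul_comm _ (hat H t), mul_assoc, ← exp_add]
  congr 2
  simp [sv]; ring

lemma hat_deriv (t : ℝ) : hat (deriv H) t = -sv t * hat H t := by
  obtain ⟨S, T, hS, hT⟩ := hat_schwartz hH hc
  have hH' : ContDiff ℝ ∞ (deriv H) := (contDiff_infty_iff_deriv.1 hH).2
  have hd : ∀ x, HasDerivAt (tw H) (tw (deriv H) x + 2 * Real.pi * tw H x) x := by
    intro x
    have d1 := (hH.differentiable (by simp)).differentiableAt (x := x) |>.hasDerivAt
    have d2 : HasDerivAt (fun x : ℝ => exp (2 * Real.pi * x)) (exp (2 * Real.pi * x) * (2 * Real.pi * 1)) x :=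
      HasDerivAt.cexp ((hasDerivAt_id x).ofReal_comp.const_mul (2 * Real.pi : ℂ))
    refine (d1.mul d2).congr_deriv ?_
    simp only [tw]; ring
  obtain ⟨S', -, hS', -⟩ := hat_schwartz hH' hc.deriv
  have i1 : Integrable (tw H) := by rw [← funext hS]; exact S.integrable
  have i2 : Integrable (tw (deriv H)) := by rw [← funext hS']; exact S'.integrable
  have hde : deriv (tw H) = fun x => tw (deriv H) x + 2 * Real.pi * tw H x := funext fun x => (hd x).deriv
  have h1 := congrFun (Real.fourier_deriv i1 (fun x => (hd x).differentiableAt) (by rw [hde]; exact i2.add (i1.const_mul _))) t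
  rw [hde] at h1
  have h2 : 𝓕 (fun x => tw (deriv H) x + 2 * Real.pi * tw H x) t = hat (deriv H) t + 2 * Real.pi * hat H t := by
    simp only [hat]
    rw [Real.fourier_real_eq, Real.fourier_real_eq, Real.fourier_real_eq]
    simp_rw [smul_add]
    rw [integral_add, ← integral_const_mul]
    · congr 2; funext x; simp only [Circle.smul_def, smul_eq_mul]; ring
    · simpa [mul_comm] using! (Real.fourierIntegral_convergent_iff t).2 i2
    · simpa [mul_comm] using! (Real.fourierIntegral_convergent_iff t).2 (i1.const_mul (2 * Real.pi : ℂ))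
  rw [h2, smul_eq_mul] at h1
  simp only [sv]
  change _ = 2 * Real.pi * I * t * hat H t at h1
  linear_combination h1

lemma iter_smooth (j : ℕ) : ContDiff ℝ ∞ (iteratedDeriv j H) ∧ HasCompactSupport (iteratedDeriv j H) := by
  induction j with
  | zero => simpa using ⟨hH, hc⟩
  | succ j ih =>
    rw [iteratedDeriv_succ]
    exact ⟨(contDiff_infty_iff_deriv.1 ih.1).2, ih.2.deriv⟩

lemma hat_iter (j : ℕ) (t : ℝ) : hat (iteratedDeriv j H) t = (-sv t) ^ j * hat H t := by
  induction j with
  | zero => simp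
  | succ j ih =>
    rw [iteratedDeriv_succ, hat_deriv (iter_smooth hH hc j).1 (iter_smooth hH hc j).2, ih]; ring

lemma hat_decay (M : ℕ) : Integrable (fun t => (1 + t ^ 2) ^ M * ‖hat H t‖) := by
  have h1 := (hat_int (iter_smooth hH hc (2 * M)).1 (iter_smooth hH hc (2 * M)).2).norm.const_mul (((2 * Real.pi) ^ 2) ^ M)⁻¹
  refine h1.congr (Filter.Eventually.of_forall fun t => ?_)
  simp only
  rw [hat_iter hH hc, norm_mul, norm_pow, norm_neg, pow_mul, sv_normSq, mul_pow _ _ M, ← mul_assoc,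
    inv_mul_cancel_left₀ (by positivity)]

lemma fubini (ν : ℕ) {β : ℝ} (hβ : 0 < β) :
    ∫ t : ℝ, hat H t * ((sv t)⁻¹ ^ (ν + 1) * exp (-(β / sv t))) = ∫ x in Ioi (0 : ℝ), Bf ν β x * H x := by
  have hB : IntegrableOn (fun x : ℝ => Bf ν β x * exp (-(2 * Real.pi * x))) (Ioi 0) := by
    have h0 := integrableOn_rpow_mul_exp_neg_mul_rpow (s := (ν : ℝ) / 2) (p := 1) (b := 2 * Real.pi)
      (neg_one_lt_zero.trans_le (by positivity)) one_pos (by positivity)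
    refine Integrable.mono' (h0.const_mul ((1 / β) ^ ((ν : ℝ) / 2)))
      ((Bf_cont ν hβ).mul (by fun_prop)).aestronglyMeasurable ?_
    refine (ae_restrict_iff' measurableSet_Ioi).2 (Filter.Eventually.of_forall fun x hx => ?_)
    have hx' : (0 : ℝ) < x := hx
    rw [norm_mul, norm_exp, Real.rpow_one, ← mul_assoc, ← Real.mul_rpow (by positivity) (by positivity)]
    have := Bf_norm ν hβ hx'.le
    refine mul_le_mul (this.trans_eq (by congr 1; ring)) (le_of_eq ?_) (by positivity) (by positivity)
    congr 1; simp
  have hP : Integrable (Function.uncurry fun (t x : ℝ) => hat H t * (Bf ν β x * exp (-(sv t * x)))) (volume.prod (volume.restrict (Ioi 0))) := by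
    have h1 := (hat_int hH hc).mul_prod hB
    refine h1.mono ?_ (Filter.Eventually.of_forall fun p => le_of_eq ?_)
    · refine Continuous.aestronglyMeasurable ?_
      have := hat_cont hH hc
      have := Bf_cont ν hβ
      have := sv_cont
      unfold Function.uncurry
      fun_prop
    · simp only [Function.uncurry, norm_mul, norm_exp]
      congr 3
      simp [sv_re]
  calc _ = ∫ t : ℝ, ∫ x in Ioi (0 : ℝ), hat H t * (Bf ν β x * exp (-(sv t * x))) := by
        congr 1; funext t
        rw [integral_const_mul, Bf_laplace ν hβ (sv_re_pos t)]
    _ = ∫ x in Ioi (0 : ℝ), ∫ t : ℝ, hat H t * (Bf ν β x * exp (-(sv t * x))) := integral_integral_swap hP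
    _ = _ := by
        congr 1; funext x
        rw [← hat_inv hH hc x, ← integral_const_mul]
        congr 1; funext t; ring

lemma Phi_bound (k A : ℕ) (hk : 1 ≤ k) {β : ℝ} (hβ : 0 < β) :
    ‖∫ t : ℝ, hat H t * ((sv t)⁻¹ ^ k * exp (-(β / sv t)))‖ ≤
      ∫ x in Ioi (0 : ℝ), (x / β) ^ (((k - 1 + A : ℕ) : ℝ) / 2) * ‖iteratedDeriv A H x‖ := by
  have h1 := fubini (iter_smooth hH hc A).1 (iter_smooth hH hc A).2 (k - 1 + A) hβ
  have h2 : ∀ t : ℝ, hat (iteratedDeriv A H) t * ((sv t)⁻¹ ^ (k - 1 + A + 1) * exp (-(β / sv t))) =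
      (-1) ^ A * (hat H t * ((sv t)⁻¹ ^ k * exp (-(β / sv t)))) := by
    intro t
    have := sv_ne t
    rw [hat_iter hH hc, show k - 1 + A + 1 = k + A by omega, pow_add, neg_pow, inv_pow (sv t) A]
    field_simp
  simp_rw [h2] at h1
  rw [integral_const_mul] at h1
  have h3 := congrArg norm h1
  rw [norm_mul, norm_pow, norm_neg, norm_one, one_pow, one_mul] at h3
  rw [h3]
  refine (norm_integral_le_integral_norm _).trans ?_
  refine setIntegral_mono_on ?_ ?_ measurableSet_Ioi ?_
  · refine ((Continuous.integrable_of_hasCompactSupport ?_ ?_).norm).integrableOn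
    · exact (Bf_cont _ hβ).mul (iter_smooth hH hc A).1.continuous
    · exact (iter_smooth hH hc A).2.mul_left
  · refine (Continuous.integrable_of_hasCompactSupport ?_ ?_).integrableOn
    · refine (((continuous_id.div_const β).rpow_const fun x => Or.inr (by positivity))).mul (iter_smooth hH hc A).1.continuous.norm
    · exact (iter_smooth hH hc A).2.norm.mul_left
  · intro x hx
    rw [norm_mul]
    gcongr
    exact Bf_norm _ hβ (le_of_lt hx)
end

end HES


namespace HES
open MeasureTheory Set Complex
open UpperHalfPlane hiding I
open scoped ContDiff MatrixGroups

/-- dual frequency -/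
noncomputable def be (c n : ℕ) : ℝ := 4 * Real.pi ^ 2 * (n + 1) / c ^ 2

noncomputable def Phi (k c : ℕ) (H : ℝ → ℂ) (n : ℕ) : ℂ :=
  ∫ t : ℝ, hat H t * ((sv t)⁻¹ ^ k * exp (-(be c n / sv t)))

lemma a_le {k : ℕ} {a : ℕ → ℂ} (h : IsNormalizedHeckeEigenform k a) (n : ℕ) :
    ‖a (n + 1)‖ ≤ 2 * ((n : ℝ) + 1) ^ k := by
  have hk := h.2.1
  have h1 := norm_a k a (n := n + 1) (by omega)
  have h2 := lam_le h (n + 1)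
  rw [h1]
  have h0 : (1 : ℝ) ≤ ((n + 1 : ℕ) : ℝ) := by push_cast; linarith [Nat.cast_nonneg (α := ℝ) n]
  calc _ ≤ 2 * ((n + 1 : ℕ) : ℝ) * ((n + 1 : ℕ) : ℝ) ^ (((k : ℝ) - 1) / 2) := by gcongr
    _ = 2 * ((n + 1 : ℕ) : ℝ) ^ (1 + ((k : ℝ) - 1) / 2) := by
        rw [Real.rpow_add (by linarith), Real.rpow_one]; ring
    _ ≤ 2 * ((n + 1 : ℕ) : ℝ) ^ (k : ℝ) := by
        have : (12 : ℝ) ≤ k := by exact_mod_cast hk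
        gcongr
        linarith
    _ = _ := by rw [Real.rpow_natCast]; push_cast; rfl

lemma norm_exp_inv_sv (β t : ℝ) : ‖exp (-(β / sv t))‖ = Real.exp (-(β * (2 * Real.pi) / ((2 * Real.pi) ^ 2 * (1 + t ^ 2)))) := by
  rw [norm_exp, neg_re, div_re, normSq_eq_norm_sq, sv_normSq, sv_re]; simp

lemma norm_inv_sv_le (t : ℝ) : ‖(sv t)⁻¹‖ ≤ 1 := by
  rw [norm_inv]
  refine inv_le_one_of_one_le₀ ?_
  have h1 := Complex.re_le_norm (sv t)
  rw [sv_re] at h1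
  linarith [Real.pi_gt_three]

lemma phi_term_int {H : ℝ → ℂ} (hH : ContDiff ℝ ∞ H) (hc : HasCompactSupport H) (k : ℕ) {β : ℝ} (hβ : 0 ≤ β) :
    Integrable (fun t : ℝ => hat H t * ((sv t)⁻¹ ^ k * exp (-(β / sv t)))) := by
  refine (hat_int hH hc).mono ?_ (Filter.Eventually.of_forall fun t => ?_)
  · refine Continuous.aestronglyMeasurable ?_
    have := hat_cont hH hc
    have h2 : Continuous (fun t => (sv t)⁻¹) := sv_cont.inv₀ sv_ne
    simp_rw [div_eq_mul_inv]
    fun_prop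
  · rw [norm_mul, norm_mul, norm_pow]
    refine mul_le_of_le_one_right (norm_nonneg _) (mul_le_one₀ (pow_le_one₀ (norm_nonneg _) (norm_inv_sv_le t)) (norm_nonneg _) ?_)
    rw [norm_exp_inv_sv, Real.exp_le_one_iff]
    have : 0 ≤ β * (2 * Real.pi) / ((2 * Real.pi) ^ 2 * (1 + t ^ 2)) := by positivity
    linarith

lemma exp_neg_le_pow (M : ℕ) {v : ℝ} (hv : 0 < v) : Real.exp (-v) ≤ M.factorial / v ^ M := by
  have := Real.pow_div_factorial_le_exp v hv.le M
  rw [Real.exp_neg, inv_le_comm₀ (Real.exp_pos _) (by positivity), inv_div]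
  exact this

lemma phi_norm_int {H : ℝ → ℂ} (hH : ContDiff ℝ ∞ H) (hc : HasCompactSupport H) (k c M : ℕ) (hc1 : 1 ≤ c) :
    ∃ K : ℝ, ∀ n : ℕ, ∫ t : ℝ, ‖hat H t * ((sv t)⁻¹ ^ k * exp (-(be c n / sv t)))‖ ≤ K / ((n : ℝ) + 1) ^ M := by
  have hc0 : (0 : ℝ) < c := by exact_mod_cast hc1
  refine ⟨M.factorial * ((c : ℝ) ^ 2 / (2 * Real.pi)) ^ M * ∫ t : ℝ, (1 + t ^ 2) ^ M * ‖hat H t‖, fun n => ?_⟩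
  rw [mul_div_right_comm, ← integral_const_mul]
  have hb : 0 ≤ be c n := by unfold be; positivity
  refine integral_mono (phi_term_int hH hc k hb).norm ((hat_decay hH hc M).const_mul _) fun t => ?_
  simp only
  have ht : (0 : ℝ) < 1 + t ^ 2 := by positivity
  rw [norm_mul, norm_mul, norm_pow, norm_exp_inv_sv]
  have hv : be c n * (2 * Real.pi) / ((2 * Real.pi) ^ 2 * (1 + t ^ 2)) = ((n : ℝ) + 1) * (2 * Real.pi) / (c ^ 2 * (1 + t ^ 2)) := by
    unfold be; field_simp; ring
  rw [hv]
  calc _ ≤ ‖hat H t‖ * (1 * (M.factorial / (((n : ℝ) + 1) * (2 * Real.pi) / (c ^ 2 * (1 + t ^ 2))) ^ M)) := by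
        gcongr
        · exact pow_le_one₀ (norm_nonneg _) (norm_inv_sv_le t)
        · exact exp_neg_le_pow M (by positivity)
    _ = _ := by
        simp only [div_pow, mul_pow]
        field_simp

lemma voronoi {k : ℕ} {a : ℕ → ℂ} (h : IsNormalizedHeckeEigenform k a) {H : ℝ → ℂ} (hH : ContDiff ℝ ∞ H)
    (hcs : HasCompactSupport H) (c : ℕ) (hc : 1 ≤ c) (u d b : ℤ) (hud : u * d - b * c = 1) :
    Summable (fun m : ℕ => a (m + 1) * exp (2 * Real.pi * I * ((m + 1) * u / c)) * H (m + 1)) ∧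
    Summable (fun n : ℕ => a (n + 1) * exp (2 * Real.pi * I * (-((n + 1) * d) / c)) * Phi k c H n) ∧
    ∑' m : ℕ, a (m + 1) * exp (2 * Real.pi * I * ((m + 1) * u / c)) * H (m + 1) =
      (2 * Real.pi / (c * I)) ^ k * ∑' n : ℕ, a (n + 1) * exp (2 * Real.pi * I * (-((n + 1) * d) / c)) * Phi k c H n := by
  obtain ⟨F, hFs, hF, hmod, -⟩ := eigen_pkg h
  have hc0 : (c : ℂ) ≠ 0 := by exact_mod_cast (by omega : c ≠ 0)
  have hpi : (Real.pi : ℂ) ≠ 0 := by exact_mod_cast Real.pi_ne_zero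
  let z : ℝ → ℍ := fun t => ⟨(u : ℂ) / c + t + I, by
    have : ((u : ℂ) / c).im = 0 := by
      rw [show (u : ℂ) / c = ((u / c : ℝ) : ℂ) by push_cast; rfl]; exact ofReal_im _
    simp [this]⟩
  have hz : ∀ t, ((z t : ℍ) : ℂ) = (u : ℂ) / c + t + I := fun t => rfl
  -- first side
  have hx1 : ∀ (m : ℕ) (t : ℝ), exp (2 * Real.pi * I * (m + 1) * (z t : ℂ)) = exp (2 * Real.pi * I * ((m + 1) * u / c)) * exp (-(sv t * ((m : ℝ) + 1 : ℝ))) := by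
    intro m t
    rw [← exp_add, hz]
    congr 1
    simp only [sv]; push_cast
    ring_nf; simp only [I_sq]; ring
  have hne : ∀ (q : ℝ), ‖exp (2 * Real.pi * I * q)‖ = 1 := by
    intro q
    rw [show (2 * Real.pi * I * q : ℂ) = ((2 * Real.pi * q : ℝ) : ℂ) * I by push_cast; ring, norm_exp_ofReal_mul_I]
  have hne1 : ∀ m : ℕ, ‖exp (2 * Real.pi * I * ((m + 1) * u / c))‖ = 1 := by
    intro m; have := hne (((m : ℝ) + 1) * u / c); push_cast at this; exact this
  have hne2 : ∀ m : ℕ, ‖exp (2 * Real.pi * I * (-((m + 1) * d) / c))‖ = 1 := by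
    intro m; have := hne (-(((m : ℝ) + 1) * d) / c); push_cast at this; exact this
  have hhat := hat_int hH hcs
  have hhc := hat_cont hH hcs
  have hsvc := sv_cont
  have s1 := hasSum_integral_of_summable_integral_norm (μ := volume)
    (F := fun (m : ℕ) (t : ℝ) => a (m + 1) * exp (2 * Real.pi * I * ((m + 1) * u / c)) * (hat H t * exp (-(sv t * ((m : ℝ) + 1 : ℝ)))))
    (fun m => by
      refine Integrable.const_mul ?_ _
      refine hhat.mono (by fun_prop) (Filter.Eventually.of_forall fun t => ?_)
      rw [norm_mul]
      refine mul_le_of_le_one_right (norm_nonneg _) ?_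
      rw [norm_exp, neg_re, re_mul_ofReal, sv_re, Real.exp_le_one_iff]
      have : 0 ≤ 2 * Real.pi * ((m : ℝ) + 1) := by positivity
      linarith)
    (by
      refine ((hFs 1 one_pos).mul_right (∫ t, ‖hat H t‖)).congr fun m => ?_
      rw [← integral_const_mul]
      congr 1; funext t
      rw [norm_mul, norm_mul, norm_mul, hne1, norm_exp, neg_re, re_mul_ofReal, sv_re]
      rw [show -(2 * Real.pi * ((m : ℝ) + 1)) = -2 * Real.pi * (m + 1) * 1 by ring]
      ring)
  have e1 : ∀ m : ℕ, ∫ t : ℝ, a (m + 1) * exp (2 * Real.pi * I * ((m + 1) * u / c)) * (hat H t * exp (-(sv t * ((m : ℝ) + 1 : ℝ)))) =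
      a (m + 1) * exp (2 * Real.pi * I * ((m + 1) * u / c)) * H (m + 1) := by
    intro m
    rw [integral_const_mul, hat_inv hH hcs]
  simp_rw [e1] at s1
  -- second side
  have s2 := hasSum_integral_of_summable_integral_norm (μ := volume)
    (F := fun (n : ℕ) (t : ℝ) => a (n + 1) * exp (2 * Real.pi * I * (-((n + 1) * d) / c)) * (hat H t * ((sv t)⁻¹ ^ k * exp (-(be c n / sv t)))))
    (fun n => (phi_term_int hH hcs k (by unfold be; positivity)).const_mul _)
    (by
      obtain ⟨K, hK⟩ := phi_norm_int hH hcs k c (k + 2) hc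
      have hz2 : Summable (fun n : ℕ => 2 * K * (1 / ((n : ℝ) + 1) ^ 2)) := by
        refine Summable.mul_left _ ?_
        have := (summable_nat_add_iff 1).2 (Real.summable_one_div_nat_pow.2 (by norm_num : 1 < 2))
        simpa using this
      refine hz2.of_nonneg_of_le (fun n => integral_nonneg fun t => norm_nonneg _) fun n => ?_
      simp_rw [norm_mul (a (n + 1) * _), norm_mul (a (n + 1)), hne2, mul_one]
      rw [integral_const_mul]
      have hn : (0 : ℝ) < (n : ℝ) + 1 := by positivity
      calc _ ≤ (2 * ((n : ℝ) + 1) ^ k) * (K / ((n : ℝ) + 1) ^ (k + 2)) :=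
            mul_le_mul (a_le h n) (hK n) (integral_nonneg fun t => norm_nonneg _) (by positivity)
        _ = _ := by rw [pow_add]; field_simp)
  have e2 : ∀ n : ℕ, ∫ t : ℝ, a (n + 1) * exp (2 * Real.pi * I * (-((n + 1) * d) / c)) * (hat H t * ((sv t)⁻¹ ^ k * exp (-(be c n / sv t)))) =
      a (n + 1) * exp (2 * Real.pi * I * (-((n + 1) * d) / c)) * Phi k c H n := by
    intro n
    rw [integral_const_mul, Phi]
  simp_rw [e2] at s2
  refine ⟨s1.summable, s2.summable, ?_⟩
  rw [s1.tsum_eq, s2.tsum_eq, ← integral_const_mul]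
  congr 1; funext t
  let γ : SL(2, ℤ) := ⟨!![-d, b; c, -u], by rw [Matrix.det_fin_two_of]; linarith⟩
  have hden : denom γ (z t) = c * I / (2 * Real.pi) * sv t := by
    rw [ModularGroup.denom_apply, hz]
    simp [γ, sv]
    field_simp
    ring_nf; simp only [I_sq]; ring
  have hgz : ((γ • z t : ℍ) : ℂ) = -d / c - 2 * Real.pi / (c ^ 2 * I * sv t) := by
    have hs := sv_ne t
    have hub : (u : ℂ) * d - b * c = 1 := by exact_mod_cast hud
    have hb : (b : ℂ) = (u * d - 1) / c := by rw [eq_div_iff hc0]; linear_combination -hub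
    have hq : sv t = -(2 * Real.pi * I * (t + I)) := by
      simp only [sv]; ring_nf; simp only [I_sq]; ring
    have hq0 : (t + I : ℂ) ≠ 0 := fun h0 => hs (by rw [hq, h0]; simp)
    rw [coe_specialLinearGroup_apply, hz]
    simp only [γ, Matrix.SpecialLinearGroup.coe_mk, Matrix.of_apply, Matrix.cons_val', Matrix.cons_val_zero, Matrix.cons_val_one,
      Matrix.cons_val_fin_one, algebraMap_int_eq, eq_intCast, Int.cast_neg, ofReal_neg, ofReal_intCast, Int.cast_natCast, ofReal_natCast]
    rw [hb, hq]
    have hd0 : (c : ℂ) * (u / c + t + I) + -u = c * (t + I) := by field_simp; ring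
    rw [hd0]
    field_simp
    ring_nf; simp only [I_sq]; ring
  have hFz : F (z t) = (2 * Real.pi / (c * I)) ^ k * ((sv t)⁻¹ ^ k * F (γ • z t)) := by
    rw [hmod, hden]
    have hs := sv_ne t
    have hx : (2 * Real.pi / (c * I)) * ((sv t)⁻¹ * (c * I / (2 * Real.pi) * sv t)) = 1 := by
      field_simp
    rw [zpow_natCast, ← mul_assoc, ← mul_assoc, ← mul_pow, ← mul_pow, mul_assoc, hx, one_pow, one_mul]
  calc _ = hat H t * F (z t) := by
        rw [hF, ← tsum_mul_left]
        refine tsum_congr fun m => ?_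
        rw [hx1]; ring
    _ = _ := by
        rw [hFz, hF, ← tsum_mul_left, ← tsum_mul_left, ← tsum_mul_left, ← tsum_mul_left]
        refine tsum_congr fun n => ?_
        have : exp (2 * Real.pi * I * (n + 1) * ((γ • z t : ℍ) : ℂ)) = exp (2 * Real.pi * I * (-((n + 1) * d) / c)) * exp (-(be c n / sv t)) := by
          rw [← exp_add, hgz]
          congr 1
          have hs := sv_ne t
          simp only [be]; push_cast
          field_simp
          ring
        rw [this]; ring

end HES


namespace HES
open Complex MeasureTheory Set Filter Topology
open scoped ContDiff

def DB (f : ℝ → ℂ) (x C E : ℝ) (w : ℝ) : Prop := ∀ ν : ℕ, ν ≤ 3 → ‖iteratedDeriv ν f x‖ ≤ C * E ^ ν * w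

lemma DB.mul {f g : ℝ → ℂ} {x C E w C' E' w' : ℝ} (hf : ContDiffAt ℝ ∞ f x) (hg : ContDiffAt ℝ ∞ g x)
    (h1 : DB f x C E w) (h2 : DB g x C' E' w') (hC : 0 ≤ C) (hE : 0 ≤ E) (hw : 0 ≤ w) :
    DB (f * g) x (C * C') (E + E') (w * w') := by
  intro ν hν
  rw [iteratedDeriv_mul (hf.of_le (by exact_mod_cast le_top)) (hg.of_le (by exact_mod_cast le_top))]
  refine (norm_sum_le _ _).trans ?_
  rw [add_pow, Finset.mul_sum, Finset.sum_mul]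
  refine Finset.sum_le_sum fun i hi => ?_
  have hi' : i ≤ ν := by simp at hi; omega
  rw [norm_mul, norm_mul, Complex.norm_natCast]
  have := mul_le_mul (h1 i (by omega)) (h2 (ν - i) (by omega)) (norm_nonneg _) (by positivity)
  calc _ = (ν.choose i : ℝ) * (‖iteratedDeriv i f x‖ * ‖iteratedDeriv (ν - i) g x‖) := by ring
    _ ≤ (ν.choose i : ℝ) * ((C * E ^ i * w) * (C' * E' ^ (ν - i) * w')) := by gcongr
    _ = _ := by ring

lemma iter_ofReal (g : ℝ → ℝ) (x : ℝ) (hg : ContDiffAt ℝ ∞ g x) (n : ℕ) :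
    ‖iteratedDeriv n (fun y => (g y : ℂ)) x‖ = |iteratedDeriv n g x| := by
  have h : iteratedDeriv n (fun y => (g y : ℂ)) x = ((iteratedDeriv n g x : ℝ) : ℂ) := by
    have := ContinuousLinearMap.iteratedFDeriv_comp_left (n := ∞) Complex.ofRealCLM hg (i := n) (by exact_mod_cast le_top)
    rw [iteratedDeriv_eq_iteratedFDeriv, iteratedDeriv_eq_iteratedFDeriv]
    have e : (fun y => (g y : ℂ)) = Complex.ofRealCLM ∘ g := rfl
    rw [e, this]; rfl
  rw [h, Complex.norm_real, Real.norm_eq_abs]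

lemma DB_rpow {k : ℕ} (hk : 12 ≤ k) {x Ξ : ℝ} (hΞ : 0 < Ξ) (hx : Ξ / 2 ≤ x) :
    DB (fun y : ℝ => ((y ^ (-(((k : ℝ) - 1) / 2)) : ℝ) : ℂ)) x 1 (2 * k / Ξ) (x ^ (-(((k : ℝ) - 1) / 2))) := by
  intro ν hν
  have hx0 : 0 < x := by linarith
  have hk' : (12 : ℝ) ≤ k := by exact_mod_cast hk
  set s := ((k : ℝ) - 1) / 2 with hs
  rw [iter_ofReal _ _ (Real.contDiffAt_rpow_const_of_ne hx0.ne'), iteratedDeriv_eq_iterate, Real.iter_deriv_rpow_const, abs_mul,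
    Real.rpow_sub hx0, Real.rpow_natCast, abs_of_nonneg (a := x ^ (-s) / x ^ ν) (by positivity)]
  have h1 : |(descPochhammer ℝ ν).eval (-s)| ≤ (k : ℝ) ^ ν := by
    have h0 : ∀ j : ℕ, j ≤ 2 → |(-s) - j| ≤ (k : ℝ) := by
      intro j hj
      have : (j : ℝ) ≤ 2 := by exact_mod_cast hj
      have : (0 : ℝ) ≤ j := by positivity
      rw [abs_le]; constructor <;> linarith
    clear hs
    induction ν with
    | zero => simp
    | succ m ih =>
      rw [descPochhammer_succ_eval, abs_mul, pow_succ]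
      exact mul_le_mul (ih (by omega)) (h0 m (by omega)) (abs_nonneg _) (by positivity)
  have h2 : 1 / x ^ ν ≤ (2 / Ξ) ^ ν := by
    rw [← one_div_pow]
    refine pow_le_pow_left₀ (by positivity) ?_ ν
    rw [div_le_div_iff₀ hx0 hΞ]; linarith
  calc _ = |(descPochhammer ℝ ν).eval (-s)| * (1 / x ^ ν) * x ^ (-s) := by ring
    _ ≤ (k : ℝ) ^ ν * (2 / Ξ) ^ ν * x ^ (-s) := by gcongr
    _ = _ := by rw [← mul_pow]; ring

lemma DB_affine {h : ℝ → ℂ} (hh : ContDiff ℝ ∞ h) {C E : ℝ} (hb : ∀ x, DB h x C E 1) (a b : ℝ) (x : ℝ) :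
    DB (fun y => h (a * y + b)) x C (|a| * E) 1 := by
  intro ν hν
  have h1 : iteratedDeriv ν (fun y => h (a * y + b)) = fun y => a ^ ν • iteratedDeriv ν h (a * y + b) := by
    have h2 := iteratedDeriv_comp_const_smul (n := ν) (f := fun z => h (z + b)) ((hh.comp (by fun_prop)).of_le (by exact_mod_cast le_top)) a
    rw [iteratedDeriv_comp_add_const] at h2
    simpa using h2
  rw [h1]
  simp only [norm_smul, norm_pow, Real.norm_eq_abs]
  calc _ ≤ |a| ^ ν * (C * E ^ ν * 1) := by gcongr; exact hb _ ν hν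
    _ = _ := by rw [mul_pow]; ring

lemma phi_le {H : ℝ → ℂ} (hH : ContDiff ℝ ∞ H) (hcs : HasCompactSupport H) {k A : ℕ} (hk : 1 ≤ k) {β : ℝ} (hβ : 0 < β)
    {C E Ξ α L : ℝ} (hC : 0 ≤ C) (hE : 0 ≤ E) (hL : 0 ≤ L) (hΞ : 0 < Ξ)
    (hS : ∀ x ∈ tsupport H, α ≤ x ∧ x ≤ α + L) (hX : ∀ x ∈ tsupport H, 0 < x ∧ x ≤ 3 * Ξ)
    (hb : ∀ x ∈ tsupport H, ‖iteratedDeriv A H x‖ ≤ C * E ^ A * x ^ (-(((k : ℝ) - 1) / 2))) :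
    ‖∫ t, hat H t * ((sv t)⁻¹ ^ k * exp (-(β / sv t)))‖ ≤
      β ^ (-(((k : ℝ) - 1) / 2)) * (C * L) * (3 * E ^ 2 * Ξ / β) ^ ((A : ℝ) / 2) := by
  refine (Phi_bound hH hcs k A hk hβ).trans ?_
  set M := β ^ (-(((k : ℝ) - 1) / 2)) * C * (3 * E ^ 2 * Ξ / β) ^ ((A : ℝ) / 2) with hM
  have hM0 : 0 ≤ M := by positivity
  have hi : IntegrableOn (fun _ : ℝ => M) (Icc α (α + L)) := by simp
  have key : ∀ x ∈ Ioi (0 : ℝ), (x / β) ^ (((k - 1 + A : ℕ) : ℝ) / 2) * ‖iteratedDeriv A H x‖ ≤ (Icc α (α + L)).indicator (fun _ => M) x := by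
    intro x hx
    have hx0 : 0 < x := hx
    by_cases hxs : x ∈ tsupport H
    · rw [indicator_of_mem (show x ∈ Icc α (α + L) from hS x hxs)]
      have e1 : (((k - 1 + A : ℕ) : ℝ) / 2) = ((k : ℝ) - 1) / 2 + (A : ℝ) / 2 := by
        push_cast [Nat.cast_sub hk]; ring
      rw [e1, Real.rpow_add (by positivity), Real.div_rpow hx0.le hβ.le, Real.rpow_neg hβ.le] at *
      calc _ ≤ x ^ (((k : ℝ) - 1) / 2) / β ^ (((k : ℝ) - 1) / 2) * (x / β) ^ ((A : ℝ) / 2) * (C * E ^ A * x ^ (-(((k : ℝ) - 1) / 2))) := by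
            gcongr; exact hb x hxs
        _ = (β ^ (((k : ℝ) - 1) / 2))⁻¹ * C * (E ^ A * (x / β) ^ ((A : ℝ) / 2)) := by
            rw [Real.rpow_neg hx0.le]
            have : x ^ (((k : ℝ) - 1) / 2) ≠ 0 := by positivity
            field_simp
        _ ≤ (β ^ (((k : ℝ) - 1) / 2))⁻¹ * C * (3 * E ^ 2 * Ξ / β) ^ ((A : ℝ) / 2) := by
            gcongr
            have : E ^ A = (E ^ 2) ^ ((A : ℝ) / 2) := by
              rw [← Real.rpow_natCast E 2, ← Real.rpow_mul hE, ← Real.rpow_natCast]; congr 1; push_cast; ring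
            rw [this, ← Real.mul_rpow (by positivity) (by positivity)]
            refine Real.rpow_le_rpow (by positivity) ?_ (by positivity)
            rw [← mul_div_assoc]
            refine div_le_div_of_nonneg_right ?_ hβ.le
            nlinarith [(hX x hxs).2, sq_nonneg E]
        _ ≤ _ := by rw [hM]
    · have : iteratedDeriv A H x = 0 := by
        have := image_eq_zero_of_notMem_tsupport hxs
        have h2 : H =ᶠ[𝓝 x] fun _ => 0 := notMem_tsupport_iff_eventuallyEq.1 hxs
        rw [h2.iteratedDeriv_eq]; simp
      rw [this, norm_zero, mul_zero]
      exact indicator_nonneg (fun _ _ => hM0) _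
  calc _ ≤ ∫ x in Ioi (0 : ℝ), (Icc α (α + L)).indicator (fun _ => M) x := by
        refine integral_mono_of_nonneg ?_ ((integrable_indicator_iff measurableSet_Icc).2 hi).integrableOn ?_
        · filter_upwards [ae_restrict_mem measurableSet_Ioi] with x hx
          have : (0 : ℝ) < x := hx
          simp only [Pi.zero_apply]; positivity
        · filter_upwards [ae_restrict_mem measurableSet_Ioi] with x hx using key x hx
    _ ≤ ∫ x, (Icc α (α + L)).indicator (fun _ => M) x :=
        setIntegral_le_integral ((integrable_indicator_iff measurableSet_Icc).2 hi) (Eventually.of_forall fun x => indicator_nonneg (fun _ _ => hM0) _)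
    _ = L * M := by
        rw [integral_indicator measurableSet_Icc, setIntegral_const]
        simp [Measure.real, hL]
    _ = _ := by rw [hM]; ring

end HES


namespace HES
open Complex MeasureTheory Set Filter Topology
open scoped ContDiff

lemma phi_interp {H : ℝ → ℂ} (hH : ContDiff ℝ ∞ H) (hcs : HasCompactSupport H) {k : ℕ} (hk : 1 ≤ k) {β : ℝ} (hβ : 0 < β)
    {C E Ξ α L δ : ℝ} (hC : 0 ≤ C) (hE : 0 < E) (hL : 0 ≤ L) (hΞ : 0 < Ξ) (hδ : 0 < δ) (hδ1 : δ ≤ 1 / 2)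
    (hS : ∀ x ∈ tsupport H, α ≤ x ∧ x ≤ α + L) (hX : ∀ x ∈ tsupport H, 0 < x ∧ x ≤ 3 * Ξ)
    (hb : ∀ x ∈ tsupport H, DB H x C E (x ^ (-(((k : ℝ) - 1) / 2)))) :
    ‖∫ t, hat H t * ((sv t)⁻¹ ^ k * exp (-(β / sv t)))‖ ≤
      β ^ (-(((k : ℝ) - 1) / 2)) * (C * L) * (3 * E ^ 2 * Ξ / β) ^ (1 + δ) := by
  have h0 := phi_le hH hcs (A := 0) hk hβ hC hE.le hL hΞ hS hX fun x hx => hb x hx 0 (by norm_num)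
  have h3 := phi_le hH hcs (A := 3) hk hβ hC hE.le hL hΞ hS hX fun x hx => hb x hx 3 le_rfl
  have hq : 0 < 3 * E ^ 2 * Ξ / β := by positivity
  rcases le_total (3 * E ^ 2 * Ξ / β) 1 with h | h
  · refine h3.trans ?_
    gcongr ?_ * ?_
    exact Real.rpow_le_rpow_of_exponent_ge hq h (by push_cast; linarith)
  · refine h0.trans ?_
    gcongr ?_ * ?_
    exact Real.rpow_le_rpow_of_exponent_le h (by push_cast; linarith)

noncomputable def wb : ContDiffBump (3 / 2 : ℝ) := ⟨1 / 2, 1, by norm_num, by norm_num⟩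

lemma wb_bound : ∃ C : ℝ, 0 ≤ C ∧ ∀ x, DB (fun y => (wb y : ℂ)) x C 1 1 := by
  have : ∀ ν : ℕ, ∃ C, ∀ x, ‖iteratedDeriv ν (fun y => (wb y : ℂ)) x‖ ≤ C := by
    intro ν
    have hs : ContDiff ℝ ∞ (fun y => (wb y : ℂ)) := Complex.ofRealCLM.contDiff.comp wb.contDiff
    have hc : HasCompactSupport (fun y => (wb y : ℂ)) := wb.hasCompactSupport.comp_left (g := ((↑) : ℝ → ℂ)) Complex.ofReal_zero
    obtain ⟨h1, h2⟩ := iter_smooth hs hc ν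
    exact h2.exists_bound_of_continuous h1.continuous
  choose C hC using this
  refine ⟨∑ ν ∈ Finset.range 4, |C ν|, Finset.sum_nonneg fun _ _ => abs_nonneg _, fun x ν hν => ?_⟩
  rw [one_pow, mul_one, mul_one]
  refine ((hC ν x).trans (le_abs_self _)).trans ?_
  exact Finset.single_le_sum (f := fun ν => |C ν|) (fun _ _ => abs_nonneg _) (by simp; omega)

lemma test_fn (κ : ℕ → ℝ) : ∃ C : ℝ, 0 ≤ C ∧ ∀ (k : ℕ) (r f : ℤ) (X₁ Z Ξ : ℝ) (h : ℝ → ℂ), 12 ≤ k →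
    r ≠ 0 → 1 ≤ X₁ → 1 ≤ Z → 0 < Ξ → ContDiff ℝ ∞ h →
    (∀ x : ℝ, h x ≠ 0 → X₁ ≤ x ∧ x ≤ 2 * X₁) →
    (∀ ν : ℕ, ∀ x : ℝ, ‖iteratedDeriv ν h x‖ ≤ κ ν * (X₁ / Z) ^ (-(ν : ℝ))) →
    ∃ H : ℝ → ℂ, ContDiff ℝ ∞ H ∧ HasCompactSupport H ∧
      (∀ x, Ξ ≤ x → x ≤ 2 * Ξ → H x = h ((x - f) / r) * ((x ^ (-(((k : ℝ) - 1) / 2)) : ℝ) : ℂ)) ∧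
      (∀ x, h ((x - f) / r) = 0 → H x = 0) ∧
      ∀ (δ : ℝ), 0 < δ → δ ≤ 1 / 2 → ∀ c n : ℕ, 1 ≤ c → ‖Phi k c H n‖ ≤ (be c n) ^ (-(((k : ℝ) - 1) / 2)) *
        (C * min (|(r : ℝ)| * X₁) (2 * Ξ)) * (3 * (Z / (|(r : ℝ)| * X₁) + 3 * k / Ξ) ^ 2 * Ξ / be c n) ^ (1 + δ) := by
  obtain ⟨Cw, hCw, hw⟩ := wb_bound
  set Ck := ∑ ν ∈ Finset.range 4, |κ ν|
  have hCk : 0 ≤ Ck := Finset.sum_nonneg fun _ _ => abs_nonneg _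
  refine ⟨Ck * Cw * 1, by positivity, fun k r f X₁ Z Ξ h hk hr hX1 hZ hΞ hh hsupp hder => ?_⟩
  have hr0 : (r : ℝ) ≠ 0 := by exact_mod_cast hr
  have hk' : (12 : ℝ) ≤ k := by exact_mod_cast hk
  let h1 : ℝ → ℂ := fun y => h ((r : ℝ)⁻¹ * y + -(f / r))
  let h2 : ℝ → ℂ := fun y => (fun y => (wb y : ℂ)) (Ξ⁻¹ * y + 0)
  let h3 : ℝ → ℂ := fun y : ℝ => ((y ^ (-(((k : ℝ) - 1) / 2)) : ℝ) : ℂ)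
  have hwb : ContDiff ℝ ∞ (fun y => (wb y : ℂ)) := Complex.ofRealCLM.contDiff.comp wb.contDiff
  have c1 : ContDiff ℝ ∞ h1 := hh.comp (by fun_prop)
  have c2 : ContDiff ℝ ∞ h2 := hwb.comp (by fun_prop)
  have c3 : ∀ x, 0 < x → ContDiffAt ℝ ∞ h3 x := fun x hx =>
    Complex.ofRealCLM.contDiff.contDiffAt.comp x (Real.contDiffAt_rpow_const_of_ne hx.ne')
  have hdb : ∀ x, DB h x Ck (Z / X₁) 1 := by
    intro x ν hν
    refine (hder ν x).trans ?_
    rw [Real.rpow_neg (by positivity), Real.rpow_natCast, ← inv_pow, inv_div, mul_one]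
    gcongr
    exact (le_abs_self _).trans (Finset.single_le_sum (f := fun ν => |κ ν|) (fun _ _ => abs_nonneg _) (by simp; omega))
  have d1 := DB_affine hh hdb (r : ℝ)⁻¹ (-(f / r))
  have d2 := DB_affine hwb hw Ξ⁻¹ 0
  set H : ℝ → ℂ := h1 * h2 * h3 with hHdef
  have e1 : ∀ x, h1 x = h ((x - f) / r) := fun x => by simp only [h1]; congr 1; field_simp; ring
  -- supports
  have hs2 : tsupport H ⊆ Icc (Ξ / 2) (Ξ / 2 + 2 * Ξ) := by
    refine closure_minimal (fun x hx => ?_) isClosed_Icc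
    have : h2 x ≠ 0 := fun h0 => hx (by simp [hHdef, h0])
    have h4 : wb (Ξ⁻¹ * x + 0) ≠ 0 := fun h0 => this (by simp only [h2, h0]; simp)
    have h5 : Ξ⁻¹ * x + 0 ∈ Metric.ball (3 / 2 : ℝ) 1 := by
      have := wb.support_eq ▸ (Function.mem_support.2 h4)
      exact this
    rw [Metric.mem_ball, Real.dist_eq, abs_lt, add_zero, inv_mul_eq_div] at h5
    have a1 : 1 / 2 < x / Ξ := by linarith
    have a2 : x / Ξ < 5 / 2 := by linarith
    rw [lt_div_iff₀ hΞ] at a1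
    rw [div_lt_iff₀ hΞ] at a2
    constructor <;> linarith
  have hs1 : ∃ α, tsupport H ⊆ Icc α (α + |(r : ℝ)| * X₁) := by
    have hx' : ∀ x, x ∈ Function.support H → X₁ ≤ (x - f) / r ∧ (x - f) / r ≤ 2 * X₁ := by
      intro x hx
      refine hsupp _ fun h0 => hx ?_
      simp [hHdef, e1, h0]
    rcases lt_or_gt_of_ne hr0 with hneg | hpos
    · refine ⟨f + 2 * r * X₁, closure_minimal (fun x hx => ?_) isClosed_Icc⟩
      obtain ⟨a1, a2⟩ := hx' x hx
      rw [le_div_iff_of_neg hneg] at a1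
      rw [div_le_iff_of_neg hneg] at a2
      rw [abs_of_neg hneg]
      constructor <;> linarith
    · refine ⟨f + r * X₁, closure_minimal (fun x hx => ?_) isClosed_Icc⟩
      obtain ⟨a1, a2⟩ := hx' x hx
      rw [le_div_iff₀ hpos] at a1
      rw [div_le_iff₀ hpos] at a2
      rw [abs_of_pos hpos]
      constructor <;> linarith
  obtain ⟨α, hs1⟩ := hs1
  have hcs : HasCompactSupport H := isCompact_Icc.of_isClosed_subset (isClosed_tsupport H) hs2
  have hH : ContDiff ℝ ∞ H := by
    rw [contDiff_iff_contDiffAt]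
    intro x
    by_cases hx : x ∈ tsupport H
    · exact (c1.contDiffAt.mul c2.contDiffAt).mul (c3 x (by have := (hs2 hx).1; linarith))
    · exact contDiffAt_const.congr_of_eventuallyEq (notMem_tsupport_iff_eventuallyEq.1 hx)
  refine ⟨H, hH, hcs, fun x hx1 hx2 => ?_, fun x hx => by simp [hHdef, e1, hx], fun δ hδ hδ1 c n hc => ?_⟩
  · have : wb (Ξ⁻¹ * x + 0) = 1 := by
      refine wb.one_of_mem_closedBall ?_
      have a1 : 1 ≤ x / Ξ := by rw [le_div_iff₀ hΞ]; linarith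
      have a2 : x / Ξ ≤ 2 := by rw [div_le_iff₀ hΞ]; linarith
      rw [Metric.mem_closedBall, Real.dist_eq, add_zero, inv_mul_eq_div]
      change _ ≤ (1 / 2 : ℝ)
      rw [abs_le]; constructor <;> linarith
    simp only [hHdef, Pi.mul_apply, e1, h2, this, h3]; simp
  · set E := Z / (|(r : ℝ)| * X₁) + 3 * k / Ξ with hE
    have hrp : 0 < |(r : ℝ)| := abs_pos.2 hr0
    have hE0 : 0 < E := by positivity
    have hb : ∀ x ∈ tsupport H, DB H x (Ck * Cw * 1) E (x ^ (-(((k : ℝ) - 1) / 2))) := by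
      intro x hx
      have hx1 := (hs2 hx).1
      have hx0 : 0 < x := by linarith
      have := ((d1 x).mul c1.contDiffAt c2.contDiffAt (d2 x) hCk (by positivity) zero_le_one).mul
        (c1.contDiffAt.mul c2.contDiffAt) (c3 x hx0) (DB_rpow hk hΞ hx1) (by positivity) (by positivity) (by norm_num)
      intro ν hν
      refine (this ν hν).trans ?_
      rw [one_mul, one_mul]
      gcongr
      rw [hE, abs_inv, abs_inv, abs_of_pos hΞ]
      have e2 : |(r : ℝ)|⁻¹ * (Z / X₁) = Z / (|(r : ℝ)| * X₁) := by field_simp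
      have e3 : Ξ⁻¹ * 1 + 2 * k / Ξ ≤ 3 * k / Ξ := by
        rw [mul_one, ← one_div, ← add_div]; gcongr; linarith
      rw [e2]; linarith
    have hX : ∀ x ∈ tsupport H, 0 < x ∧ x ≤ 3 * Ξ := fun x hx => by
      have := hs2 hx
      constructor <;> linarith [this.1, this.2]
    have hbe : 0 < be c n := by unfold be; positivity
    rcases min_choice (|(r : ℝ)| * X₁) (2 * Ξ) with hm | hm <;> rw [hm]
    · exact phi_interp hH hcs (by omega) hbe (by positivity) hE0 (by positivity) hΞ hδ hδ1 (fun x hx => hs1 hx) hX hb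
    · exact phi_interp hH hcs (by omega) hbe (by positivity) hE0 (by positivity) hΞ hδ hδ1 (fun x hx => hs2 hx) hX hb

end HES


namespace HES
open Complex MeasureTheory Set Filter Topology
open scoped ContDiff

lemma std_exp (c : ℕ) [NeZero c] (m u : ℤ) (x : ZMod c) (hx : (u : ZMod c) = x) :
    ZMod.stdAddChar ((m : ZMod c) * x) = exp (2 * Real.pi * I * (m * u / c)) := by
  rw [← hx, ← Int.cast_mul, ZMod.stdAddChar_coe]; congr 1; push_cast; ring

/-- Sum over the reduced residues mod `c` after Voronoi. -/
lemma Sc_eq {k : ℕ} {a : ℕ → ℂ} (h : IsNormalizedHeckeEigenform k a) {H : ℝ → ℂ} (hH : ContDiff ℝ ∞ H)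
    (hcs : HasCompactSupport H) (c : ℕ) [NeZero c] (f : ℤ) :
    Summable (fun n : ℕ => a (n + 1) * Phi k c H n * KS (ZMod.stdAddChar (N := c)) (-f) (-(n + 1 : ℕ))) ∧
    ∑ u : (ZMod c)ˣ, ∑' m : ℕ, ZMod.stdAddChar (((((m + 1 : ℕ) : ℤ) - f : ℤ) : ZMod c) * (u : ZMod c)) * (a (m + 1) * H (m + 1)) =
      (2 * Real.pi / (c * I)) ^ k * ∑' n : ℕ, a (n + 1) * Phi k c H n * KS (ZMod.stdAddChar (N := c)) (-f) (-(n + 1 : ℕ)) := by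
  have hc : 1 ≤ c := NeZero.one_le
  have key : ∀ u : (ZMod c)ˣ, Summable (fun n : ℕ => a (n + 1) * Phi k c H n * ZMod.stdAddChar (((-f : ℤ) : ZMod c) * (u : ZMod c) + ((-(n + 1 : ℕ) : ℤ) : ZMod c) * ((u⁻¹ : (ZMod c)ˣ) : ZMod c))) ∧
      ∑' m : ℕ, ZMod.stdAddChar (((((m + 1 : ℕ) : ℤ) - f : ℤ) : ZMod c) * (u : ZMod c)) * (a (m + 1) * H (m + 1)) =
      (2 * Real.pi / (c * I)) ^ k * ∑' n : ℕ, a (n + 1) * Phi k c H n * ZMod.stdAddChar (((-f : ℤ) : ZMod c) * (u : ZMod c) + ((-(n + 1 : ℕ) : ℤ) : ZMod c) * ((u⁻¹ : (ZMod c)ˣ) : ZMod c)) := by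
    intro u
    set U : ℤ := ((u : ZMod c).val : ℤ)
    set D : ℤ := (((u⁻¹ : (ZMod c)ˣ) : ZMod c).val : ℤ)
    have hU : ((U : ℤ) : ZMod c) = u := by simp [U]
    have hD : ((D : ℤ) : ZMod c) = (u⁻¹ : (ZMod c)ˣ) := by simp [D]
    have hdv : (c : ℤ) ∣ U * D - 1 := by
      rw [← ZMod.intCast_zmod_eq_zero_iff_dvd]; push_cast; rw [hU, hD]; simp
    obtain ⟨b, hb⟩ := hdv
    obtain ⟨s1, s2, e⟩ := voronoi h hH hcs c hc U D b (by linarith)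
    have e1 : ∀ n : ℕ, exp (2 * Real.pi * I * (-((n + 1) * D) / c)) = ZMod.stdAddChar (((-(n + 1 : ℕ) : ℤ) : ZMod c) * ((u⁻¹ : (ZMod c)ˣ) : ZMod c)) := by
      intro n; rw [std_exp c _ D _ hD]; congr 1; push_cast; ring
    have e2 : ∀ m : ℕ, exp (2 * Real.pi * I * ((m + 1) * U / c)) = ZMod.stdAddChar ((((m + 1 : ℕ) : ℤ) : ZMod c) * (u : ZMod c)) := by
      intro m; rw [std_exp c _ U _ hU]; congr 1; push_cast; ring
    simp only [e1] at s2 e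
    simp only [e2] at e
    set y := ZMod.stdAddChar (((-f : ℤ) : ZMod c) * (u : ZMod c))
    have e3 : ∀ n : ℕ, a (n + 1) * Phi k c H n * ZMod.stdAddChar (((-f : ℤ) : ZMod c) * (u : ZMod c) + ((-(n + 1 : ℕ) : ℤ) : ZMod c) * ((u⁻¹ : (ZMod c)ˣ) : ZMod c)) =
        y * (a (n + 1) * ZMod.stdAddChar (((-(n + 1 : ℕ) : ℤ) : ZMod c) * ((u⁻¹ : (ZMod c)ˣ) : ZMod c)) * Phi k c H n) := by
      intro n; rw [AddChar.map_add_eq_mul]; ring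
    have e4 : ∀ m : ℕ, ZMod.stdAddChar (((((m + 1 : ℕ) : ℤ) - f : ℤ) : ZMod c) * (u : ZMod c)) * (a (m + 1) * H (m + 1)) =
        y * (a (m + 1) * ZMod.stdAddChar ((((m + 1 : ℕ) : ℤ) : ZMod c) * (u : ZMod c)) * H (m + 1)) := by
      intro m
      have : ((((m + 1 : ℕ) : ℤ) - f : ℤ) : ZMod c) * (u : ZMod c) = ((-f : ℤ) : ZMod c) * (u : ZMod c) + (((m + 1 : ℕ) : ℤ) : ZMod c) * (u : ZMod c) := by
        push_cast; ring
      rw [this, AddChar.map_add_eq_mul]; ring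
    simp only [e3, e4]
    refine ⟨s2.mul_left y, ?_⟩
    rw [tsum_mul_left, tsum_mul_left, e]; ring
  have e5 : ∀ n : ℕ, a (n + 1) * Phi k c H n * KS (ZMod.stdAddChar (N := c)) (-f) (-(n + 1 : ℕ)) =
      ∑ u : (ZMod c)ˣ, a (n + 1) * Phi k c H n * ZMod.stdAddChar (((-f : ℤ) : ZMod c) * (u : ZMod c) + ((-(n + 1 : ℕ) : ℤ) : ZMod c) * ((u⁻¹ : (ZMod c)ˣ) : ZMod c)) := by
    intro n; rw [KS, Finset.mul_sum]
  simp only [e5]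
  refine ⟨summable_sum fun u _ => (key u).1, ?_⟩
  rw [Summable.tsum_finsetSum fun u _ => (key u).1, Finset.mul_sum]
  exact Finset.sum_congr rfl fun u _ => (key u).2

lemma Sc_bound {δ : ℝ} (hδ : 0 < δ) (hδ1 : δ ≤ 1 / 2) : ∃ B : ℝ, 0 ≤ B ∧ ∀ (k : ℕ) (a : ℕ → ℂ), IsNormalizedHeckeEigenform k a →
    ∀ (H : ℝ → ℂ), ContDiff ℝ ∞ H → HasCompactSupport H → ∀ (c : ℕ) [NeZero c] (f : ℤ) (M P : ℝ), 0 ≤ M → 0 ≤ P →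
    (∀ n : ℕ, ‖Phi k c H n‖ ≤ (be c n) ^ (-(((k : ℝ) - 1) / 2)) * M * (P / be c n) ^ (1 + δ)) →
    ‖∑ u : (ZMod c)ˣ, ∑' m : ℕ, ZMod.stdAddChar (((((m + 1 : ℕ) : ℤ) - f : ℤ) : ZMod c) * (u : ZMod c)) * (a (m + 1) * H (m + 1))‖ ≤
      B * (M * P ^ (1 + δ)) * (k : ℝ) ^ δ * (c.divisors.card : ℝ) ^ 4 * (c : ℝ) ^ (3 / 2 + 2 * δ) := by
  obtain ⟨B, hB, hg⟩ := gcd_sum hδ (by linarith)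
  refine ⟨2 * Real.pi * B, by positivity, fun k a h H hH hcs c _ f M P hM hP hPhi => ?_⟩
  have hc : 1 ≤ c := NeZero.one_le
  have hc0 : (0 : ℝ) < c := by exact_mod_cast hc
  have hc1 : (1 : ℝ) ≤ c := by exact_mod_cast hc
  have hk : 12 ≤ k := h.2.1
  obtain ⟨s, e⟩ := Sc_eq h hH hcs c f
  obtain ⟨gs, gl⟩ := hg k a h c hc
  rw [e, norm_mul]
  set τ : ℝ := (c.divisors.card : ℝ)
  set W : ℝ := 2 * Real.pi / c with hW
  have hW0 : 0 < W := by positivity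
  have hnW : ‖(2 * Real.pi / (c * I) : ℂ) ^ k‖ = W ^ k := by
    rw [norm_pow, hW]; simp [abs_of_pos Real.pi_pos]
  set g : ℕ → ℝ := fun n => ‖lam k a n‖ * √(Nat.gcd n c) * (n : ℝ) ^ (-(1 + δ))
  have hterm : ∀ n : ℕ, W ^ k * ‖a (n + 1) * Phi k c H n * KS (ZMod.stdAddChar (N := c)) (-f) (-(n + 1 : ℕ))‖ ≤
      (2 * Real.pi * (M * P ^ (1 + δ)) * τ ^ 3 * (c : ℝ) ^ (3 / 2 + 2 * δ)) * g (n + 1) := by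
    intro n
    have hn : (0 : ℝ) < ((n + 1 : ℕ) : ℝ) := by positivity
    set N : ℝ := ((n + 1 : ℕ) : ℝ)
    have hbe : be c n = W ^ 2 * N := by simp only [be, hW, N]; push_cast; ring
    rw [norm_mul, norm_mul, norm_a k a (Nat.succ_le_succ (Nat.zero_le n))]
    have hKS := KS_bound c (ZMod.isPrimitive_stdAddChar c) (-f) (-(n + 1 : ℕ))
    have hgc : Int.gcd (-((n + 1 : ℕ) : ℤ)) c = Nat.gcd (n + 1) c := by rw [Int.neg_gcd, Int.gcd_natCast_natCast]
    rw [hgc, Real.sqrt_mul hc0.le] at hKS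
    have hP2 := hPhi n
    rw [hbe] at hP2
    have e1 : W ^ k * (N ^ (((k : ℝ) - 1) / 2) * (W ^ 2 * N) ^ (-(((k : ℝ) - 1) / 2))) = W := by
      rw [Real.mul_rpow (by positivity) hn.le, Real.rpow_neg hn.le, ← Real.rpow_natCast W 2, ← Real.rpow_mul hW0.le]
      have : ((2 : ℕ) : ℝ) * (-(((k : ℝ) - 1) / 2)) = 1 - k := by push_cast; ring
      rw [this, Real.rpow_sub hW0, Real.rpow_one, Real.rpow_natCast]
      have : N ^ (((k : ℝ) - 1) / 2) ≠ 0 := by positivity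
      field_simp
    have e2 : (P / (W ^ 2 * N)) ^ (1 + δ) ≤ P ^ (1 + δ) * (c : ℝ) ^ (2 + 2 * δ) * N ^ (-(1 + δ)) := by
      have : P / (W ^ 2 * N) ≤ P * (c : ℝ) ^ (2 : ℝ) * N⁻¹ := by
        have h1 : (1 : ℝ) ≤ (2 * Real.pi) ^ 2 := by nlinarith [Real.pi_gt_three]
        rw [hW, div_pow, Real.rpow_two]
        rw [show P / ((2 * Real.pi) ^ 2 / (c : ℝ) ^ 2 * N) = (P * (c : ℝ) ^ 2 * N⁻¹) / (2 * Real.pi) ^ 2 by field_simp]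
        exact div_le_self (by positivity) h1
      refine (Real.rpow_le_rpow (by positivity) this (by positivity)).trans_eq ?_
      rw [Real.mul_rpow (by positivity) (by positivity), Real.mul_rpow hP (by positivity), ← Real.rpow_mul hc0.le, Real.inv_rpow hn.le, Real.rpow_neg hn.le]
      ring_nf
    have e3 : W * (c : ℝ) ^ (2 + 2 * δ) * √c = 2 * Real.pi * (c : ℝ) ^ (3 / 2 + 2 * δ) := by
      rw [hW, Real.sqrt_eq_rpow, show 3 / 2 + 2 * δ = (2 + 2 * δ) + 1 / 2 - 1 by ring, Real.rpow_sub hc0, Real.rpow_add hc0 (2 + 2 * δ) (1 / 2), Real.rpow_one]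
      ring
    calc _ ≤ W ^ k * (‖lam k a (n + 1)‖ * N ^ (((k : ℝ) - 1) / 2) *
          ((W ^ 2 * N) ^ (-(((k : ℝ) - 1) / 2)) * M * (P ^ (1 + δ) * (c : ℝ) ^ (2 + 2 * δ) * N ^ (-(1 + δ)))) * (τ ^ 3 * (√c * √(Nat.gcd (n + 1) c)))) := by
          gcongr
          exact hP2.trans (by gcongr)
      _ = (W ^ k * (N ^ (((k : ℝ) - 1) / 2) * (W ^ 2 * N) ^ (-(((k : ℝ) - 1) / 2)))) * (c : ℝ) ^ (2 + 2 * δ) * √c * (M * P ^ (1 + δ)) * τ ^ 3 *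
          (‖lam k a (n + 1)‖ * √(Nat.gcd (n + 1) c) * N ^ (-(1 + δ))) := by ring
      _ = _ := by rw [e1, e3]; simp only [g, N]; ring
  have gs1 : Summable fun n => g (n + 1) := (summable_nat_add_iff 1).2 gs
  have g0 : ∑' n, g (n + 1) ≤ B * (k : ℝ) ^ δ * τ := by
    refine le_trans ?_ gl
    rw [gs.tsum_eq_zero_add]
    have : 0 ≤ g 0 := by positivity
    linarith
  calc _ ≤ W ^ k * ∑' n, ‖a (n + 1) * Phi k c H n * KS (ZMod.stdAddChar (N := c)) (-f) (-(n + 1 : ℕ))‖ := by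
        rw [hnW]; gcongr; exact norm_tsum_le_tsum_norm s.norm
    _ = ∑' n, W ^ k * ‖a (n + 1) * Phi k c H n * KS (ZMod.stdAddChar (N := c)) (-f) (-(n + 1 : ℕ))‖ := by rw [tsum_mul_left]
    _ ≤ ∑' n, (2 * Real.pi * (M * P ^ (1 + δ)) * τ ^ 3 * (c : ℝ) ^ (3 / 2 + 2 * δ)) * g (n + 1) :=
        Summable.tsum_le_tsum hterm (s.norm.mul_left _) (gs1.mul_left _)
    _ ≤ (2 * Real.pi * (M * P ^ (1 + δ)) * τ ^ 3 * (c : ℝ) ^ (3 / 2 + 2 * δ)) * (B * (k : ℝ) ^ δ * τ) := by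
        rw [tsum_mul_left]; gcongr
    _ = _ := by ring

end HES


namespace HES
open Complex MeasureTheory Set Filter Topology
open scoped ContDiff

lemma units_sum (c : ℕ) [NeZero c] (g : ZMod c → ℂ) :
    ∑ u : (ZMod c)ˣ, g u = ∑ j ∈ (Finset.range c).filter (fun j => Nat.Coprime j c), g j := by
  refine Finset.sum_bij (fun u _ => (u : ZMod c).val) (fun u _ => ?_) (fun u _ v _ huv => ?_) (fun j hj => ?_) fun u _ => by simp
  · simp only [Finset.mem_filter, Finset.mem_range]
    exact ⟨ZMod.val_lt _, ZMod.val_coe_unit_coprime u⟩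
  · exact Units.ext (ZMod.val_injective c huv)
  · simp only [Finset.mem_filter, Finset.mem_range] at hj
    exact ⟨ZMod.unitOfCoprime j hj.2, Finset.mem_univ _, by simp [ZMod.val_natCast, Nat.mod_eq_of_lt hj.1]⟩

lemma range_gcd_sum (R : ℕ) (hR : 1 ≤ R) (F : ℚ → ℂ) :
    ∑ x ∈ Finset.range R, F ((x : ℚ) / R) = ∑ c ∈ R.divisors, ∑ j ∈ (Finset.range c).filter (fun j => Nat.Coprime j c), F ((j : ℚ) / c) := by
  rw [← Nat.sum_div_divisors, ← Finset.sum_fiberwise_of_maps_to (s := Finset.range R) (t := R.divisors) (g := fun x => Nat.gcd x R)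
    (fun x _ => Nat.mem_divisors.2 ⟨Nat.gcd_dvd_right _ _, by omega⟩)]
  refine Finset.sum_congr rfl fun d hd => ?_
  have hdR := Nat.dvd_of_mem_divisors hd
  obtain ⟨c, rfl⟩ := hdR
  have hd0 : 0 < d := Nat.pos_of_mem_divisors hd
  rw [Nat.mul_div_cancel_left _ hd0]
  symm
  refine Finset.sum_bij (fun j _ => d * j) (fun j hj => ?_) (fun j _ j' _ hh => ?_) (fun x hx => ?_) fun j _ => ?_
  · simp only [Finset.mem_filter, Finset.mem_range] at hj ⊢
    refine ⟨Nat.mul_lt_mul_of_pos_left hj.1 hd0, ?_⟩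
    rw [Nat.gcd_mul_left, hj.2.gcd_eq_one, mul_one]
  · exact Nat.eq_of_mul_eq_mul_left hd0 hh
  · simp only [Finset.mem_filter, Finset.mem_range] at hx
    obtain ⟨hx1, hx2⟩ := hx
    obtain ⟨j, rfl⟩ : d ∣ x := hx2 ▸ Nat.gcd_dvd_left _ _
    refine ⟨j, ?_, rfl⟩
    simp only [Finset.mem_filter, Finset.mem_range]
    refine ⟨Nat.lt_of_mul_lt_mul_left hx1, ?_⟩
    rw [Nat.gcd_mul_left] at hx2
    exact Nat.eq_of_mul_eq_mul_left hd0 (by rw [hx2, mul_one])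
  · congr 1; push_cast; rw [mul_div_mul_left]; positivity

lemma divisibility_sum (R : ℕ) (hR : 1 ≤ R) (b : ℤ) :
    (if (R : ℤ) ∣ b then (R : ℂ) else 0) = ∑ c ∈ R.divisors.attach, haveI : NeZero (c : ℕ) := ⟨(Nat.pos_of_mem_divisors c.2).ne'⟩
      ∑ u : (ZMod c)ˣ, ZMod.stdAddChar ((b : ZMod c) * (u : ZMod c)) := by
  haveI : NeZero R := ⟨by omega⟩
  have h1 := sum_prim (ZMod.isPrimitive_stdAddChar R) (b : ZMod R)
  simp only [ZMod.intCast_zmod_eq_zero_iff_dvd] at h1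
  rw [← h1]
  set F : ℚ → ℂ := fun q => exp (2 * Real.pi * I * (b * (q : ℂ)))
  have h2 : ∀ (c : ℕ) [NeZero c] (j : ℕ), ZMod.stdAddChar ((b : ZMod c) * (j : ZMod c)) = F ((j : ℚ) / c) := by
    intro c _ j
    rw [std_exp c b j _ (by simp)]; simp only [F]; congr 1; push_cast; ring
  have h3 : ∑ x : ZMod R, ZMod.stdAddChar ((b : ZMod R) * x) = ∑ x ∈ Finset.range R, F ((x : ℚ) / R) := by
    refine Finset.sum_bij (fun x _ => x.val) (fun x _ => by simp [ZMod.val_lt]) (fun x _ y _ hh => ZMod.val_injective R hh)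
      (fun j hj => ⟨(j : ZMod R), Finset.mem_univ _, by simp at hj; simp [ZMod.val_natCast, Nat.mod_eq_of_lt hj]⟩) fun x _ => ?_
    rw [← h2]; simp
  rw [h3, range_gcd_sum R hR, ← Finset.sum_attach]
  refine Finset.sum_congr rfl fun c _ => ?_
  haveI : NeZero (c : ℕ) := ⟨(Nat.pos_of_mem_divisors c.2).ne'⟩
  rw [units_sum (c : ℕ) (fun x => ZMod.stdAddChar ((b : ZMod c) * x))]
  exact Finset.sum_congr rfl fun j _ => (h2 c j).symm

lemma ap_sum (k : ℕ) (a : ℕ → ℂ) (r f : ℤ) (X₁ Ξ : ℝ) (h H : ℝ → ℂ) (hr : r ≠ 0) (hX1 : 1 ≤ X₁) (hΞ : 0 < Ξ)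
    (hsupp : ∀ x : ℝ, h x ≠ 0 → X₁ ≤ x ∧ x ≤ 2 * X₁)
    (hz : ∀ n : ℕ, ¬(Ξ ≤ ((r * n + f : ℤ) : ℝ) ∧ ((r * n + f : ℤ) : ℝ) ≤ 2 * Ξ) → h (n : ℝ) = 0)
    (H1 : ∀ x, Ξ ≤ x → x ≤ 2 * Ξ → H x = h ((x - f) / r) * ((x ^ (-(((k : ℝ) - 1) / 2)) : ℝ) : ℂ))
    (H2 : ∀ x, h ((x - f) / r) = 0 → H x = 0) :
    ∑' n : ℕ, h (n : ℝ) * heckeLambda k a (r * n + f) =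
      ∑' m : ℕ, if (r.natAbs : ℤ) ∣ ((m + 1 : ℕ) : ℤ) - f then a (m + 1) * H (m + 1) else 0 := by
  have hr0 : (r : ℝ) ≠ 0 := by exact_mod_cast hr
  have hm : ∀ n : ℕ, h n ≠ 0 → ∃ m : ℕ, r * n + f = ((m + 1 : ℕ) : ℤ) := by
    intro n hn
    have h1 : Ξ ≤ ((r * n + f : ℤ) : ℝ) ∧ ((r * n + f : ℤ) : ℝ) ≤ 2 * Ξ := by
      by_contra hc; exact hn (hz n hc)
    have h2 : (0 : ℝ) < ((r * n + f : ℤ) : ℝ) := by linarith [h1.1]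
    have h3 : 0 < r * n + f := by exact_mod_cast h2
    exact ⟨(r * n + f - 1).toNat, by push_cast; rw [Int.toNat_of_nonneg (by omega)]; ring⟩
  have hval : ∀ n m : ℕ, r * n + f = ((m + 1 : ℕ) : ℤ) → h n * heckeLambda k a (r * n + f) = a (m + 1) * H (m + 1) := by
    intro n m e
    have e1 : (((m : ℝ) + 1) - f) / r = n := by
      have : (r : ℝ) * n + f = m + 1 := by exact_mod_cast e
      rw [← this]; field_simp; ring
    by_cases hn : h n = 0
    · rw [hn, zero_mul, H2 _ (by rw [e1, hn]), mul_zero]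
    · have h1 : Ξ ≤ ((r * n + f : ℤ) : ℝ) ∧ ((r * n + f : ℤ) : ℝ) ≤ 2 * Ξ := by
        by_contra hc; exact hn (hz n hc)
      rw [e] at h1
      push_cast at h1
      rw [H1 _ h1.1 h1.2, e1, e, heckeLambda, if_pos (by positivity), Int.toNat_natCast]
      push_cast; ring
  set g : ℕ → ℂ := fun n => h (n : ℝ) * heckeLambda k a (r * n + f)
  have hg : ∀ x : Function.support g, h ((x : ℕ) : ℝ) ≠ 0 := fun x h0 => x.2 (by simp [g, h0])
  choose i hi using fun x : Function.support g => hm x (hg x)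
  symm
  refine tsum_eq_tsum_of_ne_zero_bij i (fun x y hxy => ?_) (fun m hm' => ?_) (fun x => ?_)
  · have h1 := hi x; have h2 := hi y
    rw [hxy, ← h2] at h1
    have h3 : r * ((x : ℕ) : ℤ) = r * ((y : ℕ) : ℤ) := by linarith
    have := mul_left_cancel₀ hr h3
    exact Subtype.ext (by exact_mod_cast this)
  · rw [Function.mem_support] at hm'
    split_ifs at hm' with hd
    · rw [Int.natAbs_dvd] at hd
      obtain ⟨q, hq⟩ := hd
      have hH : H (m + 1) ≠ 0 := fun h0 => hm' (by rw [h0, mul_zero])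
      have h1 : h ((((m : ℝ) + 1) - f) / r) ≠ 0 := fun h0 => hH (by exact H2 _ h0)
      have e1 : (((m : ℝ) + 1) - f) / r = q := by
        have : (m : ℝ) + 1 - f = r * q := by exact_mod_cast hq
        rw [this]; field_simp
      rw [e1] at h1
      have hq0 : (0 : ℝ) < q := by linarith [(hsupp _ h1).1]
      have hq1 : 0 < q := by exact_mod_cast hq0
      lift q to ℕ using hq1.le
      have e2 : r * (q : ℤ) + f = ((m + 1 : ℕ) : ℤ) := by linarith
      have hgq : g q ≠ 0 := by
        have := hval q m e2
        simp only [g]; rw [this]; exact hm'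
      refine ⟨⟨q, hgq⟩, ?_⟩
      have := hi ⟨q, hgq⟩
      simp only at this
      omega
    · exact absurd rfl hm'
  · have h1 := hi x
    rw [if_pos (by rw [Int.natAbs_dvd, ← h1]; exact ⟨x, by ring⟩)]
    exact (hval _ _ h1).symm

end HES


namespace HES
open Complex MeasureTheory Set Filter Topology
open scoped ContDiff

lemma dual_sum {k : ℕ} {a : ℕ → ℂ} (h : IsNormalizedHeckeEigenform k a) {H : ℝ → ℂ} (hH : ContDiff ℝ ∞ H)
    (hcs : HasCompactSupport H) (R : ℕ) (hR : 1 ≤ R) (f : ℤ) (V : ℝ)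
    (hV : ∀ (c : ℕ) [NeZero c], c ∣ R → ‖∑ u : (ZMod c)ˣ, ∑' m : ℕ, ZMod.stdAddChar (((((m + 1 : ℕ) : ℤ) - f : ℤ) : ZMod c) * (u : ZMod c)) * (a (m + 1) * H (m + 1))‖ ≤ V) :
    (R : ℝ) * ‖∑' m : ℕ, if (R : ℤ) ∣ ((m + 1 : ℕ) : ℤ) - f then a (m + 1) * H (m + 1) else 0‖ ≤ R.divisors.card * V := by
  have hG : Summable fun m : ℕ => a (m + 1) * H (m + 1) := by
    have := (voronoi h hH hcs 1 le_rfl 0 0 (-1) (by norm_num)).1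
    simpa using this
  have hs : ∀ (c : ℕ) [NeZero c] (u : (ZMod c)ˣ), Summable fun m : ℕ => ZMod.stdAddChar (((((m + 1 : ℕ) : ℤ) - f : ℤ) : ZMod c) * (u : ZMod c)) * (a (m + 1) * H (m + 1)) := by
    intro c _ u
    refine Summable.of_norm ?_
    simp only [norm_mul, norm_char, one_mul]
    simpa only [norm_mul] using hG.norm
  have key : (R : ℂ) * ∑' m : ℕ, (if (R : ℤ) ∣ ((m + 1 : ℕ) : ℤ) - f then a (m + 1) * H (m + 1) else 0) =
      ∑ c ∈ R.divisors.attach, haveI : NeZero (c : ℕ) := ⟨(Nat.pos_of_mem_divisors c.2).ne'⟩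
      ∑ u : (ZMod c)ˣ, ∑' m : ℕ, ZMod.stdAddChar (((((m + 1 : ℕ) : ℤ) - f : ℤ) : ZMod c) * (u : ZMod c)) * (a (m + 1) * H (m + 1)) := by
    rw [← tsum_mul_left]
    have e : ∀ m : ℕ, (R : ℂ) * (if (R : ℤ) ∣ ((m + 1 : ℕ) : ℤ) - f then a (m + 1) * H (m + 1) else 0) =
        ∑ c ∈ R.divisors.attach, haveI : NeZero (c : ℕ) := ⟨(Nat.pos_of_mem_divisors c.2).ne'⟩
        ∑ u : (ZMod c)ˣ, ZMod.stdAddChar (((((m + 1 : ℕ) : ℤ) - f : ℤ) : ZMod c) * (u : ZMod c)) * (a (m + 1) * H (m + 1)) := by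
      intro m
      have h1 := divisibility_sum R hR (((m + 1 : ℕ) : ℤ) - f)
      have h2 : (R : ℂ) * (if (R : ℤ) ∣ ((m + 1 : ℕ) : ℤ) - f then a (m + 1) * H (m + 1) else 0) =
        (if (R : ℤ) ∣ ((m + 1 : ℕ) : ℤ) - f then (R : ℂ) else 0) * (a (m + 1) * H (m + 1)) := by split_ifs <;> ring
      rw [h2, h1, Finset.sum_mul]
      refine Finset.sum_congr rfl fun c _ => ?_
      rw [Finset.sum_mul]
    simp only [e]
    rw [Summable.tsum_finsetSum fun c _ => ?_]
    · refine Finset.sum_congr rfl fun c _ => ?_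
      haveI : NeZero (c : ℕ) := ⟨(Nat.pos_of_mem_divisors c.2).ne'⟩
      rw [Summable.tsum_finsetSum fun u _ => hs c u]
    · haveI : NeZero (c : ℕ) := ⟨(Nat.pos_of_mem_divisors c.2).ne'⟩
      exact summable_sum fun u _ => hs c u
  have h3 : (R : ℝ) = ‖(R : ℂ)‖ := by simp
  rw [h3, ← norm_mul, key]
  refine (norm_sum_le _ _).trans ?_
  refine (Finset.sum_le_card_nsmul _ _ V fun c _ => ?_).trans_eq (by simp)
  haveI : NeZero (c : ℕ) := ⟨(Nat.pos_of_mem_divisors c.2).ne'⟩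
  exact hV c (Nat.dvd_of_mem_divisors c.2)

/-- The numerics: `P = 3E²Ξ`. -/
lemma LP_bound {k R X Z Ξ f : ℝ} (hk : 1 ≤ k) (hR : 1 ≤ R) (hX : 1 ≤ X) (hZ : 1 ≤ Z) (hf : 0 ≤ f)
    (h1 : X / (100 * Z) ≤ Ξ) (h2 : Ξ ≤ 100 * (X + f)) :
    min X (2 * Ξ) * (3 * (Z / X + 3 * k / Ξ) ^ 2 * Ξ) ≤ 708 * (Z * (1 + f / X) + k) ^ 2 ∧
    3 * (Z / X + 3 * k / Ξ) ^ 2 * Ξ ≤ 6000 * (k * R * Z * (1 + f)) ^ 2 := by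
  have hΞ : 0 < Ξ := lt_of_lt_of_le (by positivity) h1
  have hX0 : 0 < X := by linarith
  have hP : 3 * (Z / X + 3 * k / Ξ) ^ 2 * Ξ ≤ 6 * Z ^ 2 * (Ξ / X) / X + 54 * k ^ 2 / Ξ := by
    have : (Z / X + 3 * k / Ξ) ^ 2 ≤ 2 * ((Z / X) ^ 2 + (3 * k / Ξ) ^ 2) := by nlinarith [sq_nonneg (Z / X - 3 * k / Ξ)]
    calc _ ≤ 3 * (2 * ((Z / X) ^ 2 + (3 * k / Ξ) ^ 2)) * Ξ := by gcongr
      _ = _ := by field_simp; ring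
  have hq : Ξ / X ≤ 100 * (1 + f / X) := by
    rw [div_le_iff₀ hX0]; refine h2.trans_eq ?_; field_simp
  have hfX : 0 ≤ f / X := by positivity
  constructor
  · calc _ ≤ min X (2 * Ξ) * (6 * Z ^ 2 * (Ξ / X) / X + 54 * k ^ 2 / Ξ) := by gcongr
      _ = min X (2 * Ξ) * (6 * Z ^ 2 * (Ξ / X) / X) + min X (2 * Ξ) * (54 * k ^ 2 / Ξ) := by ring
      _ ≤ X * (6 * Z ^ 2 * (Ξ / X) / X) + (2 * Ξ) * (54 * k ^ 2 / Ξ) := by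
        gcongr
        · exact min_le_left _ _
        · exact min_le_right _ _
      _ = 6 * Z ^ 2 * (Ξ / X) + 108 * k ^ 2 := by field_simp; ring
      _ ≤ 6 * Z ^ 2 * (100 * (1 + f / X)) + 108 * k ^ 2 := by gcongr
      _ ≤ 708 * ((Z * (1 + f / X)) ^ 2 + k ^ 2) := by
        nlinarith [mul_nonneg (sq_nonneg Z) hfX, mul_nonneg (sq_nonneg Z) (sq_nonneg (f / X)), sq_nonneg Z, sq_nonneg k]
      _ ≤ _ := by
        have : 0 ≤ Z * (1 + f / X) * k := by positivity
        nlinarith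
  · have a1 : f / X ≤ f := div_le_self hf hX
    have a2 : 54 * k ^ 2 / Ξ ≤ 5400 * k ^ 2 * Z := by
      rw [div_le_iff₀ hΞ]
      rw [div_le_iff₀ (by positivity)] at h1
      have : k ^ 2 * 1 ≤ k ^ 2 * (Ξ * (100 * Z)) := by gcongr; linarith
      nlinarith
    have a3 : 6 * Z ^ 2 * (Ξ / X) / X ≤ 600 * Z ^ 2 * (1 + f) := by
      refine (div_le_self (by positivity) hX).trans ?_
      calc _ ≤ 6 * Z ^ 2 * (100 * (1 + f)) := by gcongr; linarith
        _ = _ := by ring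
    have b1 : Z ≤ Z ^ 2 := by nlinarith
    have b2 : 1 ≤ k ^ 2 := by nlinarith
    have b3 : 1 ≤ R ^ 2 := by nlinarith
    have b4 : 1 ≤ 1 + f := by linarith
    have b5 : 1 + f ≤ (1 + f) ^ 2 := by nlinarith
    have a4 : 5400 * k ^ 2 * Z ≤ 5400 * (k * R * Z * (1 + f)) ^ 2 := by
      calc 5400 * k ^ 2 * Z = 5400 * (k ^ 2 * 1 * Z * 1) := by ring
        _ ≤ 5400 * (k ^ 2 * R ^ 2 * Z ^ 2 * (1 + f) ^ 2) := by gcongr; linarith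
        _ = _ := by ring
    have a5 : 600 * Z ^ 2 * (1 + f) ≤ 600 * (k * R * Z * (1 + f)) ^ 2 := by
      calc 600 * Z ^ 2 * (1 + f) = 600 * (1 * 1 * Z ^ 2 * (1 + f)) := by ring
        _ ≤ 600 * (k ^ 2 * R ^ 2 * Z ^ 2 * (1 + f) ^ 2) := by gcongr
        _ = _ := by ring
    linarith

lemma final_num {k R Q δ ε Cτ τ L P U : ℝ} (hk : 1 ≤ k) (hR : 1 ≤ R) (hQk : k ≤ Q) (hQR : R ≤ Q)
    (hδ : 0 < δ) (hδ1 : δ ≤ 1 / 2) (hδε : 10 * δ ≤ ε) (hτ0 : 0 ≤ τ) (hτ : τ ≤ Cτ * R ^ δ) (hC : 0 ≤ Cτ) (hL : 0 ≤ L) (hP : 0 ≤ P)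
    (hLP : L * P ≤ 708 * U) (hPQ : P ≤ 6000 * Q ^ 2) :
    (τ * (L * P ^ (1 + δ) * k ^ δ * τ ^ 4 * R ^ (3 / 2 + 2 * δ))) ≤ R * (Cτ ^ 5 * 708 * 6000 * Q ^ ε * U * R ^ ((1 : ℝ) / 2)) := by
  have hQ1 : 1 ≤ Q := by linarith
  have hQ0 : 0 < Q := by linarith
  have hR0 : 0 < R := by linarith
  have hU : 0 ≤ 708 * U := le_trans (by positivity) hLP
  have h1 : P ^ δ ≤ 6000 * Q ^ (2 * δ) := by
    refine (Real.rpow_le_rpow hP hPQ hδ.le).trans ?_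
    rw [Real.mul_rpow (by norm_num) (by positivity), ← Real.rpow_natCast Q 2, ← Real.rpow_mul hQ0.le]
    gcongr
    · have := Real.rpow_le_rpow_of_exponent_le (x := 6000) (by norm_num) (show δ ≤ 1 by linarith)
      simpa using this
    · norm_num
  have h2 : k ^ δ ≤ Q ^ δ := Real.rpow_le_rpow (by linarith) hQk hδ.le
  have h3 : R ^ δ ≤ Q ^ δ := Real.rpow_le_rpow (by linarith) hQR hδ.le
  have h4 : τ ^ 5 ≤ Cτ ^ 5 * Q ^ (5 * δ) := by
    have : τ ≤ Cτ * Q ^ δ := hτ.trans (by gcongr)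
    calc τ ^ 5 ≤ (Cτ * Q ^ δ) ^ 5 := by gcongr
      _ = _ := by rw [mul_pow, ← Real.rpow_natCast (Q ^ δ), ← Real.rpow_mul hQ0.le]; congr 2; push_cast; ring
  have h5 : R ^ (3 / 2 + 2 * δ) ≤ R * R ^ ((1 : ℝ) / 2) * Q ^ (2 * δ) := by
    rw [show 3 / 2 + 2 * δ = 1 + 1 / 2 + 2 * δ by ring, Real.rpow_add hR0, Real.rpow_add hR0, Real.rpow_one]
    gcongr
  have h6 : Q ^ (2 * δ) * Q ^ δ * Q ^ (5 * δ) * Q ^ (2 * δ) ≤ Q ^ ε := by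
    rw [← Real.rpow_add hQ0, ← Real.rpow_add hQ0, ← Real.rpow_add hQ0]
    exact Real.rpow_le_rpow_of_exponent_le hQ1 (by linarith)
  have h7 : P ^ (1 + δ) = P * P ^ δ := by
    rw [Real.rpow_add' hP (by linarith), Real.rpow_one]
  calc _ = (L * P) * P ^ δ * k ^ δ * τ ^ 5 * R ^ (3 / 2 + 2 * δ) := by rw [h7]; ring
    _ ≤ (708 * U) * (6000 * Q ^ (2 * δ)) * Q ^ δ * (Cτ ^ 5 * Q ^ (5 * δ)) * (R * R ^ ((1 : ℝ) / 2) * Q ^ (2 * δ)) := by gcongr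
    _ = (Q ^ (2 * δ) * Q ^ δ * Q ^ (5 * δ) * Q ^ (2 * δ)) * (R * (Cτ ^ 5 * 6000 * (708 * U) * R ^ ((1 : ℝ) / 2))) := by ring
    _ ≤ Q ^ ε * (R * (Cτ ^ 5 * 6000 * (708 * U) * R ^ ((1 : ℝ) / 2))) := by gcongr
    _ = _ := by ring

end HES


/-- **Hecke eigenvalues along an arithmetic progression with long shift**
(Corollary 7.7, level 1): `Σ_n h(n) λ(rn+f) ≪_ε (k|r|Z(1+|f|))^ε (Z(1+|f|/X)+k)² |r|^{1/2}`. -/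
theorem hecke_eigenvalues_shifted :
    ∀ ε : ℝ, 0 < ε → ∀ κ : ℕ → ℝ, ∃ K : ℝ,
      ∀ (k : ℕ) (a : ℕ → ℂ), IsNormalizedHeckeEigenform k a →
        ∀ (r f : ℤ) (X₁ Z Ξ : ℝ) (h : ℝ → ℂ),
          r ≠ 0 → f ≠ 0 → 1 ≤ X₁ → 1 ≤ Z →
          ContDiff ℝ (⊤ : ℕ∞) h →
          (∀ x : ℝ, h x ≠ 0 → X₁ ≤ x ∧ x ≤ 2 * X₁) →
          (∀ ν : ℕ, ∀ x : ℝ, ‖iteratedDeriv ν h x‖ ≤ κ ν * (X₁ / Z) ^ (-(ν : ℝ))) →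
          |(r : ℝ)| * X₁ / (100 * Z) ≤ Ξ → Ξ ≤ 100 * (|(r : ℝ)| * X₁ + |(f : ℝ)|) →
          (∀ n : ℕ, ¬(Ξ ≤ ((r * n + f : ℤ) : ℝ) ∧ ((r * n + f : ℤ) : ℝ) ≤ 2 * Ξ) →
            h (n : ℝ) = 0) →
          ‖∑' n : ℕ, h (n : ℝ) * heckeLambda k a (r * n + f)‖ ≤
            K * ((k : ℝ) * |(r : ℝ)| * Z * (1 + |(f : ℝ)|)) ^ ε *
              (Z * (1 + |(f : ℝ)| / (|(r : ℝ)| * X₁)) + (k : ℝ)) ^ 2 *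
              |(r : ℝ)| ^ ((1 : ℝ) / 2) := by
  intro ε hε κ
  obtain ⟨δ, hδ, hδ1, hδε⟩ : ∃ δ : ℝ, 0 < δ ∧ δ ≤ 1 / 2 ∧ 10 * δ ≤ ε :=
    ⟨min (1 / 2) (ε / 10), by positivity, min_le_left _ _, by linarith [min_le_right (1 / 2) (ε / 10)]⟩
  obtain ⟨C, hC, htest⟩ := HES.test_fn κ
  obtain ⟨B, hB, hSc⟩ := HES.Sc_bound hδ hδ1
  obtain ⟨Cτ, hCτ, htau⟩ := HES.tau_bound hδ
  refine ⟨B * C * (Cτ ^ 5 * 708 * 6000), ?_⟩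
  intro k a ha r f X₁ Z Ξ h hr hf hX1 hZ hh hsupp hder hΞ1 hΞ2 hz
  have hR : 1 ≤ r.natAbs := Nat.one_le_iff_ne_zero.2 (Int.natAbs_ne_zero.2 hr)
  have hRr : |(r : ℝ)| = (r.natAbs : ℝ) := by rw [Nat.cast_natAbs]; push_cast; rfl
  rw [hRr] at hΞ1 hΞ2 ⊢
  set R := r.natAbs with hRdef
  have hR' : (1 : ℝ) ≤ R := by exact_mod_cast hR
  have hk : 12 ≤ k := ha.2.1
  have hk' : (1 : ℝ) ≤ k := by exact_mod_cast (by omega : 1 ≤ k)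
  have hX : (1 : ℝ) ≤ R * X₁ := one_le_mul_of_one_le_of_one_le hR' hX1
  have hΞ : 0 < Ξ := lt_of_lt_of_le (by positivity) hΞ1
  obtain ⟨H, hH, hcs, H1, H2, hPhi⟩ := htest k r f X₁ Z Ξ h hk hr hX1 hZ hΞ hh hsupp hder
  rw [hRr] at hPhi
  rw [HES.ap_sum k a r f X₁ Ξ h H hr hX1 hΞ hsupp hz H1 H2]
  obtain ⟨n1, n2⟩ := HES.LP_bound hk' hR' hX hZ (abs_nonneg (f : ℝ)) hΞ1 hΞ2
  set L := min (R * X₁) (2 * Ξ)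
  set P := 3 * (Z / (R * X₁) + 3 * k / Ξ) ^ 2 * Ξ
  set U := (Z * (1 + |(f : ℝ)| / (R * X₁)) + (k : ℝ)) ^ 2
  set Q := (k : ℝ) * R * Z * (1 + |(f : ℝ)|)
  have hL : 0 ≤ L := le_min (by linarith) (by linarith)
  have hP : 0 ≤ P := by positivity
  have hf0 := abs_nonneg (f : ℝ)
  have hQk : (k : ℝ) ≤ Q := by
    calc (k : ℝ) = k * 1 * 1 * 1 := by ring
      _ ≤ Q := by simp only [Q]; gcongr; linarith
  have hQR : (R : ℝ) ≤ Q := by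
    calc (R : ℝ) = 1 * R * 1 * 1 := by ring
      _ ≤ Q := by simp only [Q]; gcongr; linarith
  set τ : ℝ := (R.divisors.card : ℝ)
  set V : ℝ := B * ((C * L) * P ^ (1 + δ)) * (k : ℝ) ^ δ * τ ^ 4 * (R : ℝ) ^ (3 / 2 + 2 * δ)
  have hd := HES.dual_sum ha hH hcs R hR f V (fun c _ hc => by
    refine (hSc k a ha H hH hcs c f (C * L) P (by positivity) hP (fun n => hPhi δ hδ hδ1 c n NeZero.one_le)).trans ?_
    have h1 : (c : ℝ) ≤ R := by exact_mod_cast Nat.le_of_dvd hR hc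
    have h2 : (c.divisors.card : ℝ) ≤ τ := by
      exact Nat.cast_le.2 (Finset.card_le_card (Nat.divisors_subset_of_dvd (by omega) hc))
    simp only [V]
    gcongr)
  have hfin := HES.final_num hk' hR' hQk hQR hδ hδ1 hδε (Nat.cast_nonneg _) (htau R hR) (by linarith) hL hP n1 n2
  refine le_of_mul_le_mul_left (hd.trans ?_) (show (0 : ℝ) < R by linarith)
  calc τ * V = B * C * (τ * (L * P ^ (1 + δ) * (k : ℝ) ^ δ * τ ^ 4 * (R : ℝ) ^ (3 / 2 + 2 * δ))) := by simp only [V]; ring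
    _ ≤ B * C * (R * (Cτ ^ 5 * 708 * 6000 * Q ^ ε * U * (R : ℝ) ^ ((1 : ℝ) / 2))) := by gcongr
    _ = _ := by ring
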